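/- Let M = g⁻¹(0) be a nonempty compact hypersurface in ℝ⁴ (g : ℝ⁴ → ℝ smooth with dg_x ≠ 0 for all x ∈ M), and let Y be a Liouville vector field for ω_st defined on an open set U ⊆ ℝ⁴ containing M and transverse to M. Then the induced contact form α = (ι_Y ω_st)|TM has a closed Reeb orbit of period T with 0 < T ≤ (2/5)·π·(diam M)², where diam M is the Euclidean diameter of M: there exist such a T and a nonconstant smooth map γ : ℝ → ℝ⁴ with image in M such that for all t ∈ ℝ one has γ(t + T) = γ(t), γ′(t) ∈ ker(dg_{γ(t)}), ω_st(γ′(t), v) = 0 for all v ∈ ker(dg_{γ(t)}), and ω_st(Y(γ(t)), γ′(t)) = 1. -/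

import Mathlib

noncomputable section

open scoped ContDiff
open Real

/-- ℝ⁴ with the Euclidean inner product. -/
abbrev R4 : Type := EuclideanSpace ℝ (Fin 4)

/-- The standard symplectic form ω_st = dx₁∧dy₁ + dx₂∧dy₂ on ℝ⁴. -/
def omegaSt (u v : R4) : ℝ := u 0 * v 1 - u 1 * v 0 + u 2 * v 3 - u 3 * v 2

open Set Filter Topology MeasureTheory Metric

section Brouwer

variable {E : Type*} [NormedAddCommGroup E] [InnerProductSpace ℝ E]

lemma exists_lipschitz_extension_by_zero {g : E → E} {K : NNReal}
    (hK : LipschitzOnWith K g (closedBall 0 1)) (h0 : ∀ x, ‖x‖ = 1 → g x = 0) :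
    ∃ G : E → E, LipschitzWith K G ∧ (∀ x, ‖x‖ ≤ 1 → G x = g x) ∧ ∀ x, 1 ≤ ‖x‖ → G x = 0 := by
  classical
  refine ⟨fun x => if ‖x‖ ≤ 1 then g x else 0, ?_, fun x hx => by simp [hx], ?_⟩
  · have key : ∀ x y : E, ‖x‖ ≤ 1 → 1 < ‖y‖ → dist (g x) 0 ≤ K * dist x y := by
      intro x y hx hy
      have hcont : ContinuousOn (fun s : ℝ => ‖x + s • (y - x)‖) (Icc 0 1) := by fun_prop
      obtain ⟨s, hs, hs1⟩ := intermediate_value_Icc zero_le_one hcont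
        (show (1 : ℝ) ∈ Icc _ _ by simp [hx, hy.le])
      simp only at hs1
      have h1 := hK.dist_le_mul x (by simpa using hx) (x + s • (y - x)) (by simp [hs1])
      rw [h0 _ hs1] at h1
      refine h1.trans ?_
      gcongr
      rw [dist_self_add_right, norm_smul, dist_comm, dist_eq_norm, Real.norm_of_nonneg hs.1]
      exact mul_le_of_le_one_left (norm_nonneg _) hs.2
    refine LipschitzWith.of_dist_le_mul fun x y => ?_
    by_cases hx : ‖x‖ ≤ 1 <;> by_cases hy : ‖y‖ ≤ 1
    · simp only [hx, hy, if_true]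
      exact hK.dist_le_mul x (by simpa using hx) y (by simpa using hy)
    · simp only [hx, hy, if_true, if_false]
      exact key x y hx (not_le.1 hy)
    · simp only [hx, hy, if_true, if_false]
      rw [dist_comm, dist_comm x]
      exact key y x hy (not_le.1 hx)
    · simp only [hx, hy, if_false, dist_self]
      positivity
  · intro x hx
    by_cases h : ‖x‖ ≤ 1
    · simp only [h, if_true]
      exact h0 x (le_antisymm h hx)
    · simp [h]

variable [FiniteDimensional ℝ E]

lemma det_id_add_smul_eq_sum (s : Finset ℝ) (hs : Module.finrank ℝ E < s.card) (A : E →L[ℝ] E)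
    (t : ℝ) :
    (ContinuousLinearMap.id ℝ E + t • A).det =
      ∑ i ∈ s, (ContinuousLinearMap.id ℝ E + i • A).det * (Lagrange.basis s id i).eval t := by
  classical
  let b := Module.finBasis ℝ E
  let M := LinearMap.toMatrix b b (A : E →ₗ[ℝ] E)
  let p : Polynomial ℝ := Matrix.det ((Polynomial.X : Polynomial ℝ) • M.map Polynomial.C +
    (1 : Matrix _ _ ℝ).map Polynomial.C)
  have hp : ∀ r : ℝ, p.eval r = (ContinuousLinearMap.id ℝ E + r • A).det := by
    intro r
    have h1 : p.eval r = Matrix.det (r • M + 1) := by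
      simp only [p]
      rw [← Polynomial.coe_evalRingHom, RingHom.map_det]
      congr 1
      ext i j
      rcases eq_or_ne i j with rfl | h
      · simp
        exact mul_comm _ _
      · simp [h]
        exact mul_comm _ _
    rw [h1, ContinuousLinearMap.det, ← LinearMap.det_toMatrix b]
    congr 1
    simp [M, add_comm]
  have hdeg : p.degree < s.card := by
    have := Polynomial.natDegree_det_X_add_C_le M (1 : Matrix _ _ ℝ)
    rw [Fintype.card_fin] at this
    exact lt_of_le_of_lt Polynomial.degree_le_natDegree
      (by exact_mod_cast lt_of_le_of_lt this hs)
  have h := Lagrange.eq_interpolate_of_eval_eq (s := s) (v := id)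
    (fun i => p.eval i) (injOn_id _) hdeg (fun i _ => rfl)
  rw [← hp t, h, Lagrange.interpolate_apply]
  simp [Polynomial.eval_finsetSum, hp]

lemma surjective_add_smul_of_lipschitz {K : NNReal} {g : E → E} (hg : LipschitzWith K g) {t : ℝ}
    (ht : |t| * K < 1) (y : E) : ∃ x, x + t • g x = y := by
  have hc : ContractingWith (Real.nnabs t * K) (fun x => y - t • g x) := by
    refine ⟨by
      rw [← NNReal.coe_lt_coe]; simpa using ht, LipschitzWith.of_dist_le_mul fun a b => ?_⟩
    rw [dist_sub_left, dist_smul₀, Real.norm_eq_abs]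
    have := hg.dist_le_mul a b
    calc |t| * dist (g a) (g b) ≤ |t| * (K * dist a b) := by gcongr
      _ = _ := by simp [mul_assoc]
  refine ⟨hc.fixedPoint _, ?_⟩
  have := hc.fixedPoint_isFixedPt
  rw [Function.IsFixedPt] at this
  nth_rewrite 1 [← this]
  abel

lemma no_contDiff_retraction {r : E → E} (hr : ∀ x, ‖x‖ ≤ 1 → ContDiffAt ℝ 1 r x)
    (hid : ∀ x, ‖x‖ = 1 → r x = x) (hsph : ∀ x, ‖x‖ ≤ 1 → ‖r x‖ = 1) : False := by
  borelize E
  set B : Set E := closedBall 0 1 with hB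
  have hBc : IsCompact B := isCompact_closedBall 0 1
  have memB : ∀ {x : E}, x ∈ B ↔ ‖x‖ ≤ 1 := by simp [hB]
  set g : E → E := fun x => r x - x with hg
  have hgd : ∀ x ∈ B, ContDiffAt ℝ 1 g x := fun x hx => (hr x (memB.1 hx)).sub contDiffAt_id
  have hgder : ∀ x ∈ B, HasFDerivAt g (fderiv ℝ g x) x := fun x hx =>
    ((hgd x hx).differentiableAt (by norm_num)).hasFDerivAt
  have hgc : ContinuousOn (fderiv ℝ g) B := fun x hx =>
    ((hgd x hx).fderiv_right (m := 0) (by norm_num)).continuousAt.continuousWithinAt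
  obtain ⟨K, hK⟩ : ∃ K, LipschitzOnWith K g B := by
    refine LocallyLipschitzOn.exists_lipschitzOnWith_of_compact hBc fun x hx => ?_
    obtain ⟨K, t, ht, hKt⟩ := (hgd x hx).exists_lipschitzOnWith
    exact ⟨K, t, mem_nhdsWithin_of_mem_nhds ht, hKt⟩
  obtain ⟨G, hGl, hGin, hGout⟩ := exists_lipschitz_extension_by_zero hK
    (fun x hx => by simp [hg, hid x hx])
  obtain ⟨C, hC⟩ := hBc.exists_bound_of_continuousOn hgc
  have hdet : ∀ᶠ A in 𝓝 (0 : E →L[ℝ] E), 0 < (ContinuousLinearMap.id ℝ E + A).det := by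
    have hc : ContinuousAt (fun A : E →L[ℝ] E => (ContinuousLinearMap.id ℝ E + A).det) 0 :=
      (ContinuousLinearMap.continuous_det.comp (by fun_prop)).continuousAt
    refine hc.eventually_const_lt ?_
    simp [ContinuousLinearMap.det]
  obtain ⟨ε, hε, hεd⟩ := Metric.eventually_nhds_iff.1 hdet
  -- for small `t` the map `x + t g x` is a bijection of the ball with positive Jacobian
  set t₀ : ℝ := min (1 / (2 * (K + 1))) (ε / (2 * (|C| + 1))) with ht₀
  have ht₀pos : 0 < t₀ := by positivity
  have hvol : ∀ t ∈ Ioc 0 t₀, ∫ x in B, (ContinuousLinearMap.id ℝ E + t • fderiv ℝ g x).det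
      = volume.real B := by
    rintro t ⟨ht0, htt⟩
    have htK : t * K < 1 := by
      have : t ≤ 1 / (2 * (K + 1)) := htt.trans (min_le_left _ _)
      calc t * K ≤ 1 / (2 * (K + 1)) * K := by gcongr
        _ < 1 := by
          rw [div_mul_eq_mul_div, div_lt_one (by positivity)]
          have := K.2
          have : (0:ℝ) ≤ K := this
          linarith
    have hpos : ∀ x ∈ B, 0 < (ContinuousLinearMap.id ℝ E + t • fderiv ℝ g x).det := by
      intro x hx
      apply hεd
      rw [dist_zero_right, norm_smul, Real.norm_of_nonneg ht0.le]
      have h1 : t ≤ ε / (2 * (|C| + 1)) := htt.trans (min_le_right _ _)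
      have h2 : ‖fderiv ℝ g x‖ ≤ |C| := (hC x hx).trans (le_abs_self _)
      calc t * ‖fderiv ℝ g x‖ ≤ ε / (2 * (|C| + 1)) * |C| := by gcongr
        _ < ε := by
          rw [div_mul_eq_mul_div, div_lt_iff₀ (by positivity)]
          nlinarith [abs_nonneg C]
    have hfd : ∀ x ∈ B, HasFDerivWithinAt (fun x => x + t • g x)
        (ContinuousLinearMap.id ℝ E + t • fderiv ℝ g x) B x := fun x hx =>
      ((hasFDerivAt_id x).add ((hgder x hx).const_smul t)).hasFDerivWithinAt
    have hinj' : Function.Injective (fun x => x + t • G x) := by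
      intro x y hxy
      by_contra hne
      have h1 : x - y = t • (G y - G x) := by
        simp only at hxy
        rw [smul_sub, sub_eq_sub_iff_add_eq_add, hxy, add_comm]
      have h2 : dist x y ≤ t * (K * dist x y) := by
        calc dist x y = t * dist (G y) (G x) := by
              rw [dist_eq_norm, h1, norm_smul, Real.norm_of_nonneg ht0.le, ← dist_eq_norm]
          _ ≤ t * (K * dist x y) := by
              rw [dist_comm x y]
              gcongr
              exact hGl.dist_le_mul y x
      have h3 : 0 < dist x y := dist_pos.2 hne
      nlinarith
    have hinj : InjOn (fun x => x + t • g x) B := by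
      intro x hx y hy hxy
      apply hinj'
      simpa [hGin x (memB.1 hx), hGin y (memB.1 hy)] using hxy
    have himg : (fun x => x + t • g x) '' B = B := by
      have ht1 : t ≤ 1 := by
        refine (htt.trans (min_le_left _ _)).trans ?_
        rw [div_le_one (by positivity)]
        have : (0:ℝ) ≤ K := K.2
        linarith
      apply Subset.antisymm
      · rintro _ ⟨x, hx, rfl⟩
        rw [memB] at hx ⊢
        have : x + t • g x = (1 - t) • x + t • r x := by
          simp only [hg, smul_sub, sub_smul, one_smul]; abel
        simp only [this]
        calc ‖(1 - t) • x + t • r x‖ ≤ ‖(1 - t) • x‖ + ‖t • r x‖ := norm_add_le _ _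
          _ = (1 - t) * ‖x‖ + t * 1 := by
            rw [norm_smul, norm_smul, hsph x hx, Real.norm_of_nonneg ht0.le,
              Real.norm_of_nonneg (by linarith)]
          _ ≤ 1 := by nlinarith
      · intro y hy
        obtain ⟨x, hx⟩ := surjective_add_smul_of_lipschitz hGl
          (t := t) (by rwa [abs_of_pos ht0]) y
        by_cases hxB : ‖x‖ ≤ 1
        · exact ⟨x, memB.2 hxB, by simpa [hGin x hxB] using hx⟩
        · rw [hGout x (not_le.1 hxB).le, smul_zero, add_zero] at hx
          exact absurd (hx ▸ memB.1 hy) hxB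
    have := integral_image_eq_integral_abs_det_fderiv_smul volume measurableSet_closedBall
      hfd hinj (fun _ => (1 : ℝ))
    rw [himg] at this
    simp only [smul_eq_mul, mul_one, integral_const, MeasurableSet.univ, measureReal_restrict_apply,
      univ_inter] at this
    rw [this]
    exact setIntegral_congr_fun measurableSet_closedBall fun x hx => (abs_of_pos (hpos x hx)).symm
  have hInteg : ∀ t : ℝ, IntegrableOn
      (fun x => (ContinuousLinearMap.id ℝ E + t • fderiv ℝ g x).det) B := fun t =>
    (ContinuousLinearMap.continuous_det.comp_continuousOn
      (continuousOn_const.add (hgc.const_smul t))).integrableOn_compact hBc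
  obtain ⟨s, hs, hscard⟩ := (Ioc_infinite ht₀pos).exists_subset_card_eq (Module.finrank ℝ E + 1)
  have hsn : s.Nonempty := by
    rw [← Finset.card_pos, hscard]; omega
  have h1 : ∫ x in B, (ContinuousLinearMap.id ℝ E + (1 : ℝ) • fderiv ℝ g x).det
      = volume.real B := by
    simp_rw [fun x => det_id_add_smul_eq_sum s (by omega) (fderiv ℝ g x) 1]
    rw [integral_finsetSum _ (fun i _ => (hInteg i).mul_const _)]
    simp_rw [integral_mul_const]
    rw [Finset.sum_congr rfl (fun i hi => by rw [hvol i (hs hi)]), ← Finset.mul_sum,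
      ← Polynomial.eval_finsetSum, Lagrange.sum_basis (injOn_id _) hsn]
    simp
  have h2 : ∀ x ∈ interior B, (ContinuousLinearMap.id ℝ E + (1 : ℝ) • fderiv ℝ g x).det = 0 := by
    intro x hx
    have hxB := interior_subset hx
    have hrd : HasFDerivAt r (ContinuousLinearMap.id ℝ E + (1 : ℝ) • fderiv ℝ g x) x := by
      have := (hasFDerivAt_id x).add ((hgder x hxB).const_smul (1:ℝ))
      refine this.congr_of_eventuallyEq (Eventually.of_forall fun y => ?_)
      simp [hg]
    set L := ContinuousLinearMap.id ℝ E + (1 : ℝ) • fderiv ℝ g x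
    by_contra hne
    have hn := hrd.norm_sq
    have hconst : (fun y => ‖r y‖ ^ 2) =ᶠ[𝓝 x] fun _ => 1 := by
      filter_upwards [isOpen_interior.mem_nhds hx] with y hy
      rw [hsph y (memB.1 (interior_subset hy))]; norm_num
    have h0 := hn.unique ((hasFDerivAt_const (1:ℝ) x).congr_of_eventuallyEq hconst)
    have hunit : IsUnit (L : E →ₗ[ℝ] E) := (LinearMap.isUnit_iff_isUnit_det _).2
      (isUnit_iff_ne_zero.2 hne)
    obtain ⟨v, hv⟩ := ((Module.End.isUnit_iff _).1 hunit).2 (r x)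
    have h3 := congrArg (fun A : E →L[ℝ] ℝ => A v) h0
    have hv' : L v = r x := hv
    simp [hv', hsph x (memB.1 hxB)] at h3
  have h3 : ∫ x in B, (ContinuousLinearMap.id ℝ E + (1 : ℝ) • fderiv ℝ g x).det = 0 := by
    have hae : (interior B : Set E) =ᵐ[volume] B :=
      interior_ae_eq_of_null_frontier ((convex_closedBall 0 1).addHaar_frontier volume)
    rw [← setIntegral_congr_set hae]
    exact setIntegral_eq_zero_of_forall_eq_zero h2
  have h4 : 0 < volume.real B := by
    refine ENNReal.toReal_pos (measure_closedBall_pos volume 0 one_pos).ne' hBc.measure_lt_top.ne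
  linarith

lemma exists_fixedPoint_of_contDiff {p : E → E} (hp : ContDiff ℝ 1 p)
    (hB : ∀ x, ‖x‖ ≤ 1 → ‖p x‖ ≤ 1) : ∃ x, ‖x‖ ≤ 1 ∧ p x = x := by
  by_contra! hne
  set v : E → E := fun x => x - p x with hv
  have hvs : ContDiff ℝ 1 v := contDiff_id.sub hp
  have hv0 : ∀ x, ‖x‖ ≤ 1 → 0 < ‖v x‖ ^ 2 := fun x hx => by
    have : v x ≠ 0 := fun h => hne x hx (sub_eq_zero.1 h).symm
    positivity
  set b : E → ℝ := fun x => inner ℝ x (v x) with hb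
  set Δ : E → ℝ := fun x => b x ^ 2 + ‖v x‖ ^ 2 * (1 - ‖x‖ ^ 2) with hΔ
  have hbs : ContDiff ℝ 1 b := contDiff_id.inner ℝ hvs
  have hΔs : ContDiff ℝ 1 Δ :=
    (hbs.pow 2).add ((hvs.norm_sq ℝ).mul (contDiff_const.sub (contDiff_id.norm_sq ℝ)))
  have hb1 : ∀ x, ‖x‖ = 1 → 0 < b x := by
    intro x hx
    have h1 : b x = 1 - inner ℝ x (p x) := by
      simp [hb, hv, inner_sub_right, hx]
    have h2 : ‖v x‖ ^ 2 = 1 - 2 * inner ℝ x (p x) + ‖p x‖ ^ 2 := by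
      rw [hv, norm_sub_sq_real, hx]; norm_num
    have h3 := hv0 x hx.le
    have h4 := hB x hx.le
    nlinarith [norm_nonneg (p x)]
  have hΔ0 : ∀ x, ‖x‖ ≤ 1 → 0 < Δ x := by
    intro x hx
    rcases hx.lt_or_eq with h | h
    · have : 0 < 1 - ‖x‖ ^ 2 := by nlinarith [norm_nonneg x]
      have := mul_pos (hv0 x hx) this
      simp only [hΔ]; positivity
    · have := hb1 x h
      simp only [hΔ, h]; norm_num; positivity
  set s : E → ℝ := fun x => (-b x + √(Δ x)) / ‖v x‖ ^ 2 with hs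
  refine no_contDiff_retraction (r := fun x => x + s x • v x) (fun x hx => ?_) (fun x hx => ?_)
    (fun x hx => ?_)
  · have : ContDiffAt ℝ 1 s x :=
      (hbs.contDiffAt.neg.add (hΔs.contDiffAt.sqrt (hΔ0 x hx).ne')).div
        (hvs.norm_sq ℝ).contDiffAt (hv0 x hx).ne'
    exact contDiffAt_id.add (this.smul hvs.contDiffAt)
  · have h1 : √(Δ x) = b x := by
      simp only [hΔ, hx]; norm_num; rw [Real.sqrt_sq (hb1 x hx).le]
    simp [hs, h1]
  · have h1 := Real.sq_sqrt (hΔ0 x hx).le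
    have h2 := hv0 x hx
    have h3 : ‖x + s x • v x‖ ^ 2 = 1 := by
      rw [norm_add_sq_real, inner_smul_right, norm_smul, mul_pow, Real.norm_eq_abs, sq_abs]
      change ‖x‖ ^ 2 + 2 * (s x * b x) + s x ^ 2 * ‖v x‖ ^ 2 = 1
      have h4 : s x * ‖v x‖ ^ 2 = -b x + √(Δ x) := div_mul_cancel₀ _ h2.ne'
      have h5 : (s x * ‖v x‖ ^ 2 + b x) ^ 2 = Δ x := by rw [h4]; ring_nf; ring_nf at h1; exact h1
      have h6 : ‖v x‖ ^ 2 * (‖x‖ ^ 2 + 2 * (s x * b x) + s x ^ 2 * ‖v x‖ ^ 2 - 1) = 0 := by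
        have h7 : Δ x = b x ^ 2 + ‖v x‖ ^ 2 * (1 - ‖x‖ ^ 2) := rfl
        linear_combination h5 + h7
      have := (mul_eq_zero.1 h6).resolve_left h2.ne'
      linarith
    nlinarith [norm_nonneg (x + s x • v x)]

/-- Brouwer's fixed point theorem for the unit ball. -/
lemma exists_fixedPoint_of_continuous {h : E → E} (hc : Continuous h)
    (hB : ∀ x, ‖h x‖ ≤ 1) : ∃ x, h x = x := by
  by_contra! hne
  have hpos : ∀ x, 0 < ‖h x - x‖ := fun x => norm_pos_iff.2 (sub_ne_zero.2 (hne x))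
  obtain ⟨x₀, -, hx₀⟩ := (isCompact_closedBall (0 : E) 1).exists_isMinOn ⟨0, by simp⟩
    (f := fun x => ‖h x - x‖) (by fun_prop)
  set ε := ‖h x₀ - x₀‖ / 3 with hε
  have hε0 : 0 < ε := by have := hpos x₀; positivity
  obtain ⟨p, hp, hpd, -⟩ := hc.exists_contDiff_approx 1 (continuous_const (y := ε)) (fun _ => hε0)
  have hpb : ∀ x, ‖p x‖ ≤ 1 + ε := fun x => by
    have h1 := hpd x
    rw [dist_eq_norm] at h1
    calc ‖p x‖ = ‖h x + (p x - h x)‖ := by congr 1; abel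
      _ ≤ ‖h x‖ + ‖p x - h x‖ := norm_add_le _ _
      _ ≤ 1 + ε := add_le_add (hB x) h1.le
  obtain ⟨x, hx, hfix⟩ := exists_fixedPoint_of_contDiff (p := fun x => (1 + ε)⁻¹ • p x)
    (contDiff_const.smul hp) (fun x _ => by
      rw [norm_smul, norm_inv, Real.norm_of_nonneg (by positivity), inv_mul_le_one₀ (by positivity)]
      exact hpb x)
  have h1 : p x = x + ε • x := by
    rw [← one_smul ℝ x, smul_smul, ← add_smul, mul_one, one_smul]
    nth_rewrite 2 [← hfix]
    rw [smul_inv_smul₀ (by positivity)]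
  have h2 : 3 * ε ≤ ‖h x - x‖ := by
    have : ‖h x₀ - x₀‖ ≤ ‖h x - x‖ := hx₀ (by simpa using hx)
    rw [hε]; linarith
  have h3 := hpd x
  rw [dist_eq_norm, norm_sub_rev] at h3
  have h4 : h x - x = (h x - p x) + ε • x := by rw [h1]; abel
  have h5 : ‖h x - x‖ ≤ ε + ε * ‖x‖ := by
    rw [h4]
    refine (norm_add_le _ _).trans (add_le_add h3.le ?_)
    rw [norm_smul, Real.norm_of_nonneg hε0.le]
  nlinarith

end Brouwer

/-- The Poincaré–Miranda theorem on a box. -/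
theorem poincare_miranda {ι : Type*} [Fintype ι] (lo hi : ι → ℝ) (hlh : ∀ i, lo i < hi i)
    (F : (ι → ℝ) → ι → ℝ) (hF : Continuous F)
    (hlo : ∀ u ∈ Icc lo hi, ∀ i, u i = lo i → F u i ≤ 0)
    (hhi : ∀ u ∈ Icc lo hi, ∀ i, u i = hi i → 0 ≤ F u i) :
    ∃ u ∈ Icc lo hi, F u = 0 := by
  set cl : (ι → ℝ) → ι → ℝ := fun u i => max (lo i) (min (hi i) (u i)) with hcl
  have hclc : Continuous cl := by fun_prop
  have hclm : ∀ u, cl u ∈ Icc lo hi := fun u =>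
    ⟨fun i => le_max_left _ _, fun i => max_le (hlh i).le (min_le_left _ _)⟩
  -- a Euclidean ball containing the box
  let e := EuclideanSpace.equiv ι ℝ
  obtain ⟨R, hR0, hR⟩ : ∃ R > 0, ∀ u ∈ Icc lo hi, ‖e.symm u‖ ≤ R := by
    obtain ⟨C, hC⟩ := isCompact_Icc.exists_bound_of_continuousOn
      (f := fun u : ι → ℝ => e.symm u) (s := Icc lo hi) e.symm.continuous.continuousOn
    exact ⟨|C| + 1, by positivity, fun u hu => (hC u hu).trans (by linarith [le_abs_self C])⟩
  obtain ⟨x, hx⟩ := exists_fixedPoint_of_continuous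
    (h := fun x : EuclideanSpace ℝ ι => R⁻¹ • e.symm (cl (cl (e (R • x)) - F (cl (e (R • x))))))
    (by fun_prop) (fun x => by
      rw [norm_smul, norm_inv, Real.norm_of_nonneg hR0.le, inv_mul_le_one₀ hR0]
      exact hR _ (hclm _))
  set u := cl (e (R • x)) with hu
  have hxu : e (R • x) = cl (u - F u) := by
    rw [← hx, smul_inv_smul₀ hR0.ne', ContinuousLinearEquiv.apply_symm_apply]
  have hum : u ∈ Icc lo hi := hclm _
  have hclid : ∀ w ∈ Icc lo hi, cl w = w := fun w hw => by
    ext i; simp [hcl, hw.1 i, hw.2 i]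
  have hfix : u = cl (u - F u) := by rw [← hclid _ (hclm (u - F u)), ← hxu]
  refine ⟨u, hum, ?_⟩
  ext i
  have hi1 : u i = max (lo i) (min (hi i) (u i - F u i)) := congrFun hfix i
  have h1 := hlo u hum i
  have h2 := hhi u hum i
  have h3 := hlh i
  have h4 := hum.1 i
  have h5 := hum.2 i
  simp only [Pi.zero_apply]
  grind

/-- A quantitative minimax principle for a monotone family of functions `φ σ` with
(approximate) gradients `g σ`: if near-critical points at positive levels force the values of `φ` to
drop at rate at least `τ` when the parameter decreases, then a linking family bounds
the length of the parameter interval. -/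
theorem minimax_monotonicity {E P : Type*} [NormedAddCommGroup E] [InnerProductSpace ℝ E]
    [TopologicalSpace P] (φ : ℝ → E → ℝ) (g : ℝ → E → E) {σ₀ σ₁ τ β C₀ ν a s₁ : ℝ}
    (hσ : σ₀ ≤ σ₁) (hτ : 0 ≤ τ) (hβ : 0 < β) (hν : 0 < ν) (ha : 0 < a) (hs₁ : 0 < s₁)
    (hφc : ∀ σ ∈ Icc σ₀ σ₁, Continuous (φ σ)) (hgc : ∀ σ ∈ Icc σ₀ σ₁, Continuous (g σ))
    (hstep : ∀ σ ∈ Icc σ₀ σ₁, ∀ u v, ‖v‖ ≤ a →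
      φ σ (u + v) ≤ φ σ u + inner ℝ (g σ u) v + ν / 4 * ‖v‖)
    (hgrad : ∀ σ ∈ Icc σ₀ σ₁, ∀ u v, ‖v‖ ≤ a → ‖g σ (u + v)‖ ≤ ‖g σ u‖ + ν)
    (hmono : ∀ σ ∈ Icc σ₀ σ₁, ∀ σ' ∈ Icc σ₀ σ₁, σ' ≤ σ → ∀ u, φ σ' u ≤ φ σ u)
    (hcrit : ∀ σ ∈ Icc σ₀ σ₁, ∀ u, ‖g σ u‖ ≤ 2 * ν → φ σ u ∈ Icc (β / 2) C₀ →
      ∀ s ∈ Icc 0 s₁, σ₀ ≤ σ - s → φ (σ - s) u ≤ φ σ u - τ * s)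
    (S bd : Set P) (i : P → E) (hi : Continuous i)
    (hbd : ∀ p ∈ bd, ∀ σ ∈ Icc σ₀ σ₁, φ σ (i p) ≤ 0)
    (hS : ∀ p ∈ S, φ σ₁ (i p) ≤ C₀)
    (link : ∀ h : P → E, Continuous h → (∀ p ∈ bd, h p = i p) → ∃ p ∈ S, β ≤ φ σ₀ (h p)) :
    τ * (σ₁ - σ₀) < C₀ := by
  have m0 : σ₀ ∈ Icc σ₀ σ₁ := left_mem_Icc.2 hσ
  have m1 : σ₁ ∈ Icc σ₀ σ₁ := right_mem_Icc.2 hσ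
  have hβC : β ≤ C₀ := by
    obtain ⟨p, hp, h⟩ := link i hi fun _ _ => rfl
    exact h.trans ((hmono σ₁ m1 σ₀ m0 hσ _).trans (hS p hp))
  set δ : ℝ := a * ν ^ 2 / (2 * (1 + ν)) with hδ
  have hδ0 : 0 < δ := by positivity
  set s₂ : ℝ := min s₁ (δ / (τ + 1)) with hs₂
  have hs₂0 : 0 < s₂ := by positivity
  have hs₂δ : ∀ s ≤ s₂, 0 ≤ s → τ * s ≤ δ := by
    intro s hs hs0
    have h1 : s ≤ δ / (τ + 1) := hs.trans (min_le_right _ _)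
    rw [le_div_iff₀ (by linarith)] at h1
    nlinarith
  have main : ∀ σ ∈ Icc σ₀ σ₁, ∀ C ≤ C₀,
      (∃ h : P → E, Continuous h ∧ (∀ p ∈ bd, h p = i p) ∧ ∀ p ∈ S, φ σ (h p) ≤ C) →
      ∀ s ∈ Icc 0 s₂, σ₀ ≤ σ - s →
      ∃ h : P → E, Continuous h ∧ (∀ p ∈ bd, h p = i p) ∧
        ∀ p ∈ S, φ (σ - s) (h p) ≤ max (β / 2) (C - τ * s) := by
    rintro σ hσm C hC ⟨h, hhc, hhb, hhS⟩ s hs hσs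
    have hσs' : σ - s ∈ Icc σ₀ σ₁ := ⟨hσs, by linarith [hs.1, hσm.2]⟩
    set κ : E → ℝ := fun u => (max 0 (min 1 ((‖g σ u‖ - ν / 2) / (ν / 2)))) *
      (max 0 (min 1 (φ σ u / (β / 2)))) with hκ
    have gc := hgc σ hσm
    have fc := hφc σ hσm
    have hκ0 : ∀ u, 0 ≤ κ u := fun u => mul_nonneg (le_max_left _ _) (le_max_left _ _)
    have hκ1 : ∀ u, κ u ≤ 1 := fun u => mul_le_one₀ (max_le zero_le_one (min_le_left _ _))
      (le_max_left _ _) (max_le zero_le_one (min_le_left _ _))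
    set c : E → ℝ := fun u => a * κ u / (1 + ‖g σ u‖) with hc
    have hc0 : ∀ u, 0 ≤ c u := fun u => by have := hκ0 u; simp only [hc]; positivity
    have hcc : Continuous c := by
      refine Continuous.div (by fun_prop) (by fun_prop) fun u => ?_
      have := norm_nonneg (g σ u); linarith
    set η : E → E := fun u => u + (-(c u)) • g σ u with hη
    have hηc : Continuous η := by fun_prop
    have hv : ∀ u, ‖(-(c u)) • g σ u‖ = c u * ‖g σ u‖ := fun u => by
      rw [norm_smul, norm_neg, Real.norm_of_nonneg (hc0 u)]
    have hva : ∀ u, ‖(-(c u)) • g σ u‖ ≤ a := fun u => by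
      rw [hv]
      simp only [hc]
      rw [div_mul_eq_mul_div, div_le_iff₀ (by positivity)]
      have := mul_le_mul_of_nonneg_left (hκ1 u) (mul_nonneg ha.le (norm_nonneg (g σ u)))
      nlinarith [norm_nonneg (g σ u)]
    have hdec : ∀ u, φ σ (η u) ≤ φ σ u - c u * ‖g σ u‖ ^ 2 / 2 := by
      intro u
      rcases le_or_gt (ν / 2) ‖g σ u‖ with hg | hg
      · have h1 := hstep σ hσm u _ (hva u)
        rw [hv, inner_smul_right, real_inner_self_eq_norm_sq] at h1
        have h2 := mul_le_mul_of_nonneg_left hg (mul_nonneg (hc0 u) (norm_nonneg (g σ u)))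
        simp only [hη]
        nlinarith
      · have : κ u = 0 := by
          have : (‖g σ u‖ - ν / 2) / (ν / 2) ≤ 0 :=
            div_nonpos_of_nonpos_of_nonneg (by linarith) (by linarith)
          simp only [hκ]
          rw [max_eq_left ((min_le_right _ _).trans this), zero_mul]
        have hc' : c u = 0 := by simp [hc, this]
        simp [hη, hc']
    have hdec' : ∀ u, φ σ (η u) ≤ φ σ u := fun u => (hdec u).trans (by
      have := hc0 u
      have : 0 ≤ c u * ‖g σ u‖ ^ 2 / 2 := by positivity
      linarith)
    refine ⟨η ∘ h, hηc.comp hhc, fun p hp => ?_, fun p hp => ?_⟩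
    · have h1 : κ (i p) = 0 := by
        have : φ σ (i p) / (β / 2) ≤ 0 :=
          div_nonpos_of_nonpos_of_nonneg (hbd p hp σ hσm) (by linarith)
        simp only [hκ]
        rw [max_eq_left (a := (0:ℝ)) (b := min 1 (φ σ (i p) / (β / 2)))
          ((min_le_right _ _).trans this), mul_zero]
      have h2 : c (i p) = 0 := by simp [hc, h1]
      simp [hη, hhb p hp, h2]
    · set u := h p with hu
      have huC := hhS p hp
      change φ (σ - s) (η u) ≤ _
      have hm : φ (σ - s) (η u) ≤ φ σ (η u) :=
        hmono σ hσm _ hσs' (by linarith [hs.1]) _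
      rcases lt_or_ge (φ σ u) (β / 2) with h1 | h1
      · exact le_max_of_le_left (hm.trans ((hdec' u).trans h1.le))
      rcases le_or_gt ν ‖g σ u‖ with h2 | h2
      · refine le_max_of_le_right (hm.trans ((hdec u).trans ?_))
        have hk : κ u = 1 := by
          have e1 : 1 ≤ (‖g σ u‖ - ν / 2) / (ν / 2) := by
            rw [le_div_iff₀ (by linarith)]; linarith
          have e2 : 1 ≤ φ σ u / (β / 2) := by
            rw [le_div_iff₀ (by linarith)]; linarith
          simp only [hκ]
          rw [min_eq_left e1, min_eq_left e2]; norm_num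
        have e3 : δ ≤ c u * ‖g σ u‖ ^ 2 / 2 := by
          simp only [hc, hk, hδ]
          rw [div_le_iff₀ (by positivity)]
          have : a * 1 / (1 + ‖g σ u‖) * ‖g σ u‖ ^ 2 / 2 * (2 * (1 + ν)) =
            a * (‖g σ u‖ ^ 2 * (1 + ν) / (1 + ‖g σ u‖)) := by field_simp
          rw [this]
          gcongr
          rw [le_div_iff₀ (by positivity)]
          nlinarith [mul_nonneg (mul_nonneg hν.le (norm_nonneg (g σ u))) (sub_nonneg.2 h2)]
        have := hs₂δ s hs.2 hs.1
        linarith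
      · rcases lt_or_ge (φ σ (η u)) (β / 2) with h3 | h3
        · exact le_max_of_le_left (hm.trans h3.le)
        · refine le_max_of_le_right ?_
          have h4 := hcrit σ hσm (η u)
            ((hgrad σ hσm u _ (hva u)).trans (by linarith))
            ⟨h3, (hdec' u).trans (huC.trans hC)⟩ s ⟨hs.1, hs.2.trans (min_le_left _ _)⟩ hσs
          linarith [hdec' u]
  obtain ⟨N, hN⟩ := exists_nat_gt ((σ₁ - σ₀) / s₂)
  have hN0 : (0 : ℝ) < N := lt_of_le_of_lt (div_nonneg (by linarith) hs₂0.le) hN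
  set s := (σ₁ - σ₀) / N with hsdef
  have hs0 : 0 ≤ s := div_nonneg (by linarith) hN0.le
  have hss : s ≤ s₂ := by
    rw [hsdef, div_le_iff₀ hN0]
    rw [div_lt_iff₀ hs₂0] at hN
    linarith
  have hNs : N * s = σ₁ - σ₀ := by rw [hsdef]; field_simp
  have iter : ∀ k : ℕ, k ≤ N → ∃ h : P → E, Continuous h ∧ (∀ p ∈ bd, h p = i p) ∧
      ∀ p ∈ S, φ (σ₁ - k * s) (h p) ≤ max (β / 2) (C₀ - τ * (k * s)) := by
    intro k
    induction k with
    | zero =>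
      intro _
      refine ⟨i, hi, fun _ _ => rfl, fun p hp => ?_⟩
      simpa using Or.inr (hS p hp)
    | succ k ih =>
      intro hk
      have hk' : (k + 1 : ℝ) ≤ N := by exact_mod_cast hk
      have h1 : (k + 1) * s ≤ σ₁ - σ₀ := hNs ▸ mul_le_mul_of_nonneg_right hk' hs0
      have h2 : 0 ≤ k * s := by positivity
      obtain ⟨h, hh⟩ := main (σ₁ - k * s) ⟨by linarith, by linarith⟩ _
        (max_le (by linarith) (by nlinarith)) (ih (by omega)) s ⟨hs0, hss⟩ (by linarith)
      refine ⟨h, hh.1, hh.2.1, fun p hp => ?_⟩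
      have h3 := hh.2.2 p hp
      have e : σ₁ - ((k + 1 : ℕ) : ℝ) * s = σ₁ - k * s - s := by push_cast; ring
      rw [e]
      refine h3.trans (max_le (le_max_left _ _) ?_)
      have h4 : 0 ≤ τ * s := by positivity
      rw [sub_le_iff_le_add]
      refine max_le ((le_max_left _ _).trans (le_add_of_nonneg_right h4)) ?_
      calc C₀ - τ * (k * s) = (C₀ - τ * (((k + 1 : ℕ) : ℝ) * s)) + τ * s := by push_cast; ring
        _ ≤ _ := by gcongr; exact le_max_right _ _
  obtain ⟨h, hc, hb, hS'⟩ := iter N le_rfl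
  obtain ⟨p, hp, hpβ⟩ := link h hc hb
  have h0 := hS' p hp
  rw [hNs, sub_sub_cancel] at h0
  rcases le_max_iff.1 (hpβ.trans h0) with h1 | h1 <;> linarith

section Rotations

/-- The standard complex structure on `ℝ⁴`. -/
def J4 : R4 →L[ℝ] R4 :=
  LinearMap.toContinuousLinearMap
    { toFun := fun x => !₂[-x 1, x 0, -x 3, x 2]
      map_add' := fun x y => by ext i; fin_cases i <;> simp <;> ring
      map_smul' := fun c x => by ext i; fin_cases i <;> simp }

@[simp] lemma J4_apply (x : R4) : J4 x = !₂[-x 1, x 0, -x 3, x 2] := rfl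

lemma inner_R4 (x y : R4) : inner ℝ x y = x 0 * y 0 + x 1 * y 1 + x 2 * y 2 + x 3 * y 3 := by
  simp [PiLp.inner_apply, Fin.sum_univ_four]
  ring

lemma norm_sq_R4 (x : R4) : ‖x‖ ^ 2 = x 0 ^ 2 + x 1 ^ 2 + x 2 ^ 2 + x 3 ^ 2 := by
  rw [← real_inner_self_eq_norm_sq, inner_R4]; ring

lemma inner_J4_left (u v : R4) : inner ℝ (J4 u) v = omegaSt u v := by
  rw [inner_R4]; simp [omegaSt]; ring

lemma J4_J4 (x : R4) : J4 (J4 x) = -x := by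
  ext i; fin_cases i <;> simp

lemma inner_J4_J4 (u v : R4) : inner ℝ (J4 u) (J4 v) = inner ℝ u v := by
  simp only [inner_R4]; simp; ring

/-- Rotation by the angle `θ` in both complex coordinates of `ℝ⁴`. -/
def rot4 (θ : ℝ) : R4 →L[ℝ] R4 := Real.cos θ • ContinuousLinearMap.id ℝ R4 + Real.sin θ • J4

lemma rot4_apply (θ : ℝ) (x : R4) : rot4 θ x = Real.cos θ • x + Real.sin θ • J4 x := rfl

lemma rot4_zero (x : R4) : rot4 0 x = x := by simp [rot4]

lemma rot4_add (θ ψ : ℝ) (x : R4) : rot4 (θ + ψ) x = rot4 θ (rot4 ψ x) := by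
  simp only [rot4_apply, map_add, map_smul, J4_J4, Real.cos_add, Real.sin_add]
  module

lemma inner_rot4_rot4 (θ : ℝ) (x y : R4) : inner ℝ (rot4 θ x) (rot4 θ y) = inner ℝ x y := by
  simp only [rot4_apply, inner_R4]
  simp
  linear_combination (x 0 * y 0 + x 1 * y 1 + x 2 * y 2 + x 3 * y 3) * Real.cos_sq_add_sin_sq θ

lemma inner_rot4_left (θ : ℝ) (x y : R4) : inner ℝ (rot4 θ x) y = inner ℝ x (rot4 (-θ) y) := by
  rw [← inner_rot4_rot4 θ x, ← rot4_add, add_neg_cancel, rot4_zero]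

lemma norm_rot4 (θ : ℝ) (x : R4) : ‖rot4 θ x‖ = ‖x‖ := by
  rw [← sq_eq_sq₀ (norm_nonneg _) (norm_nonneg _), ← real_inner_self_eq_norm_sq,
    inner_rot4_rot4, real_inner_self_eq_norm_sq]

lemma hasDerivAt_rot4 (θ : ℝ) (x : R4) : HasDerivAt (fun θ => rot4 θ x) (J4 (rot4 θ x)) θ := by
  have := ((Real.hasDerivAt_cos θ).smul_const x).add ((Real.hasDerivAt_sin θ).smul_const (J4 x))
  refine HasDerivAt.congr_deriv this ?_
  rw [rot4_apply, map_add, map_smul, map_smul, J4_J4]; module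

@[fun_prop] lemma continuous_rot4 : Continuous rot4 := by
  unfold rot4; fun_prop

lemma continuous_rot4_apply {X : Type*} [TopologicalSpace X] {θ : X → ℝ} {x : X → R4}
    (hθ : Continuous θ) (hx : Continuous x) : Continuous fun s => rot4 (θ s) (x s) :=
  (continuous_rot4.comp hθ).clm_apply hx

end Rotations

lemma integral_cos_int {m : ℤ} (hm : m ≠ 0) : ∫ t in (0:ℝ)..1, Real.cos (2 * π * m * t) = 0 := by
  have hc : (2 * π * m) ≠ 0 := by have := Real.pi_ne_zero; positivity
  rw [intervalIntegral.integral_comp_mul_left (fun t => Real.cos t) hc]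
  have : Real.sin (2 * π * m) = 0 := by
    rw [show 2 * π * (m : ℝ) = ((2 * m : ℤ) : ℝ) * π by push_cast; ring]
    exact Real.sin_int_mul_pi _
  simp [this]

lemma integral_sin_int (m : ℤ) : ∫ t in (0:ℝ)..1, Real.sin (2 * π * m * t) = 0 := by
  rcases eq_or_ne m 0 with rfl | hm
  · simp
  have hc : (2 * π * m) ≠ 0 := by have := Real.pi_ne_zero; positivity
  rw [intervalIntegral.integral_comp_mul_left (fun t => Real.sin t) hc]
  have : Real.cos (2 * π * m) = 1 := by
    rw [mul_comm]; exact Real.cos_int_mul_two_pi m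
  simp [this]

lemma integral_rot4 {m : ℤ} (hm : m ≠ 0) (x : R4) :
    ∫ t in (0:ℝ)..1, rot4 (2 * π * m * t) x = 0 := by
  simp_rw [rot4_apply]
  rw [intervalIntegral.integral_add (by apply Continuous.intervalIntegrable; fun_prop)
    (by apply Continuous.intervalIntegrable; fun_prop), intervalIntegral.integral_smul_const,
    intervalIntegral.integral_smul_const, integral_cos_int hm, integral_sin_int]
  simp

/-- Frequencies of trigonometric polynomials of degree at most `n`. -/
abbrev Freq (n : ℕ) : Type := ↥(Finset.Icc (-(n : ℤ)) n)

/-- Coefficients of `ℝ⁴`-valued trigonometric polynomials of degree at most `n`. -/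
abbrev TrigCoeff (n : ℕ) : Type := PiLp 2 (fun _ : Freq n => R4)

/-- The `1`-periodic loop with the given Fourier coefficients. -/
def trigLoop {n : ℕ} (a : TrigCoeff n) (t : ℝ) : R4 := ∑ k : Freq n, rot4 (2 * π * (k : ℤ) * t) (a k)

section TrigLoop

variable {n : ℕ}

lemma trigLoop_add (a b : TrigCoeff n) (t : ℝ) :
    trigLoop (a + b) t = trigLoop a t + trigLoop b t := by
  simp [trigLoop, Finset.sum_add_distrib]

lemma continuous_trigLoop_uncurry : Continuous fun p : TrigCoeff n × ℝ => trigLoop p.1 p.2 := by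
  unfold trigLoop
  refine continuous_finsetSum _ fun k _ => continuous_rot4_apply (by fun_prop) (by fun_prop)

lemma continuous_trigLoop (a : TrigCoeff n) : Continuous (trigLoop a) :=
  continuous_finsetSum _ fun _ _ => continuous_rot4_apply (by fun_prop) continuous_const

lemma integral_inner_trigLoop (w : ℝ → R4) (hw : Continuous w) (a : TrigCoeff n) :
    ∫ t in (0:ℝ)..1, inner ℝ (w t) (trigLoop a t) =
      ∑ k : Freq n, inner ℝ (∫ t in (0:ℝ)..1, rot4 (-(2 * π * (k : ℤ) * t)) (w t)) (a k) := by
  have hk : ∀ k : Freq n, Continuous fun t => rot4 (-(2 * π * (k : ℤ) * t)) (w t) := fun k =>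
    continuous_rot4_apply (by fun_prop) hw
  have h1 : ∀ k : Freq n, inner ℝ (∫ t in (0:ℝ)..1, rot4 (-(2 * π * (k : ℤ) * t)) (w t)) (a k) =
      ∫ t in (0:ℝ)..1, inner ℝ (w t) (rot4 (2 * π * (k : ℤ) * t) (a k)) := by
    intro k
    rw [real_inner_comm, ← innerSL_apply_apply ℝ, ← ContinuousLinearMap.intervalIntegral_comp_comm _
      ((hk k).intervalIntegrable _ _)]
    congr 1; ext t
    rw [innerSL_apply_apply, real_inner_comm, inner_rot4_left, neg_neg]
  simp_rw [h1, trigLoop, inner_sum]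
  rw [intervalIntegral.integral_finsetSum]
  intro k _
  apply Continuous.intervalIntegrable
  exact hw.inner (continuous_rot4_apply (by fun_prop) continuous_const)

lemma trigLoop_coeff (a : TrigCoeff n) (m : ℤ) :
    ∫ t in (0:ℝ)..1, rot4 (-(2 * π * m * t)) (trigLoop a t) =
      if h : m ∈ Finset.Icc (-(n:ℤ)) n then a ⟨m, h⟩ else 0 := by
  have h1 : ∀ k : Freq n, ∫ t in (0:ℝ)..1, rot4 (2 * π * ((k - m : ℤ)) * t) (a k) =
      if (k : ℤ) = m then a k else 0 := by
    intro k
    split_ifs with h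
    · simp [h, rot4_zero]
    · exact integral_rot4 (sub_ne_zero.2 h) _
  have h2 : ∀ t : ℝ, rot4 (-(2 * π * m * t)) (trigLoop a t) =
      ∑ k : Freq n, rot4 (2 * π * ((k - m : ℤ)) * t) (a k) := by
    intro t
    rw [trigLoop, map_sum]
    refine Finset.sum_congr rfl fun k _ => ?_
    rw [← rot4_add]
    congr 2; push_cast; ring
  simp_rw [h2]
  rw [intervalIntegral.integral_finsetSum (fun k _ => by
    apply Continuous.intervalIntegrable
    exact continuous_rot4_apply (by fun_prop) continuous_const)]
  simp_rw [h1]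
  split_ifs with h
  · rw [Finset.sum_eq_single ⟨m, h⟩]
    · simp
    · intro k _ hk
      rw [if_neg]
      intro h'
      exact hk (Subtype.ext h')
    · simp
  · refine Finset.sum_eq_zero fun k _ => if_neg ?_
    rintro rfl
    exact h k.2

lemma integral_inner_trigLoop_trigLoop (a b : TrigCoeff n) :
    ∫ t in (0:ℝ)..1, inner ℝ (trigLoop a t) (trigLoop b t) = inner ℝ a b := by
  rw [integral_inner_trigLoop _ (continuous_trigLoop a), PiLp.inner_apply]
  refine Finset.sum_congr rfl fun k _ => ?_
  rw [trigLoop_coeff, dif_pos k.2]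

lemma integral_norm_sq_trigLoop (a : TrigCoeff n) :
    ∫ t in (0:ℝ)..1, ‖trigLoop a t‖ ^ 2 = ‖a‖ ^ 2 := by
  rw [← real_inner_self_eq_norm_sq, ← integral_inner_trigLoop_trigLoop]
  simp_rw [real_inner_self_eq_norm_sq]

lemma norm_trigLoop_le (a : TrigCoeff n) (t : ℝ) : ‖trigLoop a t‖ ≤ (2 * n + 1) * ‖a‖ := by
  unfold trigLoop
  refine (norm_sum_le _ _).trans ?_
  have : ∀ k ∈ (Finset.univ : Finset (Freq n)), ‖rot4 (2 * π * (k : ℤ) * t) (a k)‖ ≤ ‖a‖ :=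
    fun k _ => by rw [norm_rot4]; exact PiLp.norm_apply_le a k
  refine (Finset.sum_le_card_nsmul _ _ _ this).trans (le_of_eq ?_)
  rw [nsmul_eq_mul, Finset.card_univ, Fintype.card_coe, Int.card_Icc]
  congr 1
  have : ((n:ℤ) + 1 - -n).toNat = 2 * n + 1 := by omega
  rw [this]; push_cast; ring

lemma integral_le_sqrt_integral_sq {f : ℝ → ℝ} (hf : Continuous f) :
    (∫ t in (0:ℝ)..1, f t) ^ 2 ≤ ∫ t in (0:ℝ)..1, f t ^ 2 := by
  set m := ∫ t in (0:ℝ)..1, f t with hm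
  have h : 0 ≤ ∫ t in (0:ℝ)..1, (f t - m) ^ 2 :=
    intervalIntegral.integral_nonneg zero_le_one fun _ _ => sq_nonneg _
  have e : ∀ t, (f t - m) ^ 2 = f t ^ 2 - 2 * m * f t + m ^ 2 := fun t => by ring
  simp_rw [e] at h
  rw [intervalIntegral.integral_add (by apply Continuous.intervalIntegrable; fun_prop)
    (by apply Continuous.intervalIntegrable; fun_prop),
    intervalIntegral.integral_sub (by apply Continuous.intervalIntegrable; fun_prop)
    (by apply Continuous.intervalIntegrable; fun_prop), intervalIntegral.integral_const_mul,
    ← hm] at h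
  simp at h
  nlinarith

/-- Bessel's inequality for bounded functions. -/
lemma norm_fourier_le {w : ℝ → R4} (hw : Continuous w) {B : ℝ} (hB : ∀ t, ‖w t‖ ≤ B)
    (c : TrigCoeff n) (hc : ∀ k : Freq n,
      c k = ∫ t in (0:ℝ)..1, rot4 (-(2 * π * (k : ℤ) * t)) (w t)) : ‖c‖ ≤ B := by
  have h1 : ‖c‖ ^ 2 = ∫ t in (0:ℝ)..1, inner ℝ (w t) (trigLoop c t) := by
    rw [integral_inner_trigLoop _ hw, PiLp.norm_sq_eq_of_L2]
    refine Finset.sum_congr rfl fun k _ => ?_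
    rw [← hc, real_inner_self_eq_norm_sq]
  have hB0 : 0 ≤ B := (norm_nonneg _).trans (hB 0)
  have hcc := continuous_trigLoop c
  have h2 : ∫ t in (0:ℝ)..1, inner ℝ (w t) (trigLoop c t) ≤ ∫ t in (0:ℝ)..1, B * ‖trigLoop c t‖ := by
    apply intervalIntegral.integral_mono_on zero_le_one
      (by apply Continuous.intervalIntegrable; fun_prop)
      (by apply Continuous.intervalIntegrable; fun_prop)
    intro t _
    exact (real_inner_le_norm _ _).trans (by gcongr; exact hB t)
  rw [intervalIntegral.integral_const_mul] at h2
  have h3 := integral_le_sqrt_integral_sq hcc.norm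
  rw [integral_norm_sq_trigLoop] at h3
  have h4 := abs_le_of_sq_le_sq' h3 (norm_nonneg c) |>.2
  have h5 : ‖c‖ ^ 2 ≤ B * ‖c‖ := h1.le.trans (h2.trans (by gcongr))
  rcases (norm_nonneg c).eq_or_lt with h | h
  · rw [← h]; exact hB0
  · nlinarith

end TrigLoop

section Hardy

lemma circleAverage_norm_eval_pow_four_le (P : Polynomial ℂ) :
    circleAverage (fun z => ‖P.eval z‖ ^ 4) 0 1 ≤
      (∑ i ∈ Finset.range (P.natDegree + 1), ((i:ℝ) + 1) * ‖P.coeff i‖ ^ 2) ^ 2 := by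
  set N := P.natDegree + 1 with hN
  set Q : Polynomial ℝ := ∑ i ∈ Finset.range N, Polynomial.monomial i (((i:ℝ) + 1) * ‖P.coeff i‖ ^ 2) with hQ
  have hQc : ∀ i, Q.coeff i = ((i:ℝ) + 1) * ‖P.coeff i‖ ^ 2 := by
    intro i
    simp only [hQ, Polynomial.finsetSum_coeff, Polynomial.coeff_monomial]
    rw [Finset.sum_ite_eq']
    split_ifs with h
    · rfl
    · rw [Polynomial.coeff_eq_zero_of_natDegree_lt (by simp [hN] at h; omega)]; simp
  have hQ1 : Q.eval 1 = ∑ i ∈ Finset.range N, ((i:ℝ) + 1) * ‖P.coeff i‖ ^ 2 := by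
    simp [hQ, Polynomial.eval_finsetSum]
  have hPP : circleAverage (fun z => ‖P.eval z‖ ^ 4) 0 1 =
      ∑ m ∈ (P * P).support, ‖(P * P).coeff m‖ ^ 2 := by
    rw [Polynomial.sum_sq_norm_coeff_eq_circleAverage]
    congr 1; ext z; rw [Polynomial.eval_mul, norm_mul]; ring
  rw [hPP, ← hQ1]
  have hc : ∀ m, ‖(P * P).coeff m‖ ^ 2 ≤ (Q * Q).coeff m := by
    intro m
    rw [Polynomial.coeff_mul, Polynomial.coeff_mul]
    have h1 : ‖∑ x ∈ Finset.HasAntidiagonal.antidiagonal m, P.coeff x.1 * P.coeff x.2‖ ≤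
        ∑ x ∈ Finset.HasAntidiagonal.antidiagonal m, ‖P.coeff x.1‖ * ‖P.coeff x.2‖ :=
      (norm_sum_le _ _).trans (by simp_rw [norm_mul]; rfl)
    have h2 := sq_sum_le_card_mul_sum_sq (s := Finset.HasAntidiagonal.antidiagonal m)
      (f := fun x => ‖P.coeff x.1‖ * ‖P.coeff x.2‖)
    rw [Finset.Nat.card_antidiagonal] at h2
    refine (pow_le_pow_left₀ (norm_nonneg _) h1 2).trans (h2.trans ?_)
    rw [Finset.mul_sum]
    refine Finset.sum_le_sum fun x hx => ?_
    rw [hQc, hQc]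
    have hx' : (m:ℝ) = x.1 + x.2 := by exact_mod_cast (Finset.HasAntidiagonal.mem_antidiagonal.1 hx).symm
    push_cast
    have : (m:ℝ) + 1 ≤ ((x.1:ℝ) + 1) * (x.2 + 1) := by
      rw [hx']; nlinarith [mul_nonneg (Nat.cast_nonneg (α := ℝ) x.1) (Nat.cast_nonneg (α := ℝ) x.2)]
    nlinarith [mul_le_mul_of_nonneg_right this (sq_nonneg (‖P.coeff x.1‖ * ‖P.coeff x.2‖))]
  have hQQ : ∀ m, 0 ≤ (Q * Q).coeff m := fun m => (sq_nonneg _).trans (hc m)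
  set K := max (P * P).natDegree (Q * Q).natDegree + 1
  calc _ ≤ ∑ m ∈ (P * P).support, (Q * Q).coeff m := Finset.sum_le_sum fun m _ => hc m
    _ ≤ ∑ m ∈ Finset.range K, (Q * Q).coeff m := by
        refine Finset.sum_le_sum_of_subset_of_nonneg ?_ fun m _ _ => hQQ m
        intro m hm
        have := Polynomial.le_natDegree_of_mem_supp m hm
        simp [K]; omega
    _ = (Q * Q).eval 1 := by rw [Polynomial.eval_eq_sum_range' (n := K) (by simp [K])]; simp
    _ = _ := by rw [Polynomial.eval_mul]; ring

/-- The two complex coordinates of `ℝ⁴`. -/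
def cplx₁ (x : R4) : ℂ := ⟨x 0, x 1⟩

/-- The two complex coordinates of `ℝ⁴`. -/
def cplx₂ (x : R4) : ℂ := ⟨x 2, x 3⟩

lemma norm_sq_cplx (x : R4) : ‖x‖ ^ 2 = ‖cplx₁ x‖ ^ 2 + ‖cplx₂ x‖ ^ 2 := by
  rw [norm_sq_R4, ← Complex.normSq_eq_norm_sq, ← Complex.normSq_eq_norm_sq]
  simp [cplx₁, cplx₂, Complex.normSq_apply]; ring

lemma cplx₁_rot4 (θ : ℝ) (x : R4) : cplx₁ (rot4 θ x) = Complex.exp (θ * Complex.I) * cplx₁ x := by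
  apply Complex.ext <;>
    simp [cplx₁, rot4_apply, Complex.exp_ofReal_mul_I_re, Complex.exp_ofReal_mul_I_im]; ring

lemma cplx₂_rot4 (θ : ℝ) (x : R4) : cplx₂ (rot4 θ x) = Complex.exp (θ * Complex.I) * cplx₂ x := by
  apply Complex.ext <;>
    simp [cplx₂, rot4_apply, Complex.exp_ofReal_mul_I_re, Complex.exp_ofReal_mul_I_im]; ring

lemma cplx₁_add (x y : R4) : cplx₁ (x + y) = cplx₁ x + cplx₁ y := by
  apply Complex.ext <;> simp [cplx₁]

lemma cplx₂_add (x y : R4) : cplx₂ (x + y) = cplx₂ x + cplx₂ y := by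
  apply Complex.ext <;> simp [cplx₂]

lemma cplx₁_zero : cplx₁ 0 = 0 := by apply Complex.ext <;> simp [cplx₁]

lemma cplx₂_zero : cplx₂ 0 = 0 := by apply Complex.ext <;> simp [cplx₂]

lemma cplx_ext {x y : R4} (h₁ : cplx₁ x = cplx₁ y) (h₂ : cplx₂ x = cplx₂ y) : x = y := by
  simp only [cplx₁, cplx₂, Complex.mk.injEq] at h₁ h₂
  ext i; fin_cases i
  exacts [h₁.1, h₁.2, h₂.1, h₂.2]

lemma cplx₁_sum {ι : Type*} (s : Finset ι) (f : ι → R4) :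
    cplx₁ (∑ i ∈ s, f i) = ∑ i ∈ s, cplx₁ (f i) :=
  map_sum (⟨⟨cplx₁, cplx₁_zero⟩, cplx₁_add⟩ : R4 →+ ℂ) f s

lemma continuous_cplx₁ : Continuous cplx₁ := by
  have : cplx₁ = fun x : R4 => (x 0 : ℂ) + x 1 * Complex.I := by
    ext x; apply Complex.ext <;> simp [cplx₁]
  rw [this]; fun_prop

lemma cplx₂_sum {ι : Type*} (s : Finset ι) (f : ι → R4) :
    cplx₂ (∑ i ∈ s, f i) = ∑ i ∈ s, cplx₂ (f i) :=
  map_sum (⟨⟨cplx₂, cplx₂_zero⟩, cplx₂_add⟩ : R4 →+ ℂ) f s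

lemma continuous_cplx₂ : Continuous cplx₂ := by
  have : cplx₂ = fun x : R4 => (x 2 : ℂ) + x 3 * Complex.I := by
    ext x; apply Complex.ext <;> simp [cplx₂]
  rw [this]; fun_prop

/-- The critical Sobolev embedding in `L⁴` for complex trigonometric polynomials with positive
frequencies. -/
lemma integral_norm_pow_four_le (n : ℕ) (c : ℕ → ℂ) :
    ∫ t in (0:ℝ)..1, ‖∑ i ∈ Finset.range n, Complex.exp ((2 * π * (i + 1) * t : ℝ) * Complex.I) * c i‖ ^ 4
      ≤ (∑ i ∈ Finset.range n, ((i:ℝ) + 1) * ‖c i‖ ^ 2) ^ 2 := by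
  set P : Polynomial ℂ := ∑ i ∈ Finset.range n, Polynomial.monomial i (c i) with hP
  have hPc : ∀ i, P.coeff i = if i < n then c i else 0 := by
    intro i
    simp only [hP, Polynomial.finsetSum_coeff, Polynomial.coeff_monomial]
    rw [Finset.sum_ite_eq']; simp
  have h := circleAverage_norm_eval_pow_four_le P
  have h1 : ∑ i ∈ Finset.range (P.natDegree + 1), ((i:ℝ) + 1) * ‖P.coeff i‖ ^ 2 ≤
      ∑ i ∈ Finset.range n, ((i:ℝ) + 1) * ‖c i‖ ^ 2 := by
    have e1 : ∑ i ∈ Finset.range n, ((i:ℝ) + 1) * ‖c i‖ ^ 2 =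
        ∑ i ∈ Finset.range (n + (P.natDegree + 1)), ((i:ℝ) + 1) * ‖P.coeff i‖ ^ 2 := by
      symm
      rw [← Finset.sum_subset (Finset.range_mono (Nat.le_add_right n (P.natDegree + 1)))]
      · refine Finset.sum_congr rfl fun i hi => ?_
        rw [hPc, if_pos (Finset.mem_range.1 hi)]
      · intro i _ hi
        rw [hPc, if_neg (by simpa using hi)]; simp
    rw [e1]
    exact Finset.sum_le_sum_of_subset_of_nonneg (Finset.range_mono (by omega))
      fun i _ _ => by positivity
  have h2 : circleAverage (fun z => ‖P.eval z‖ ^ 4) 0 1 = ∫ t in (0:ℝ)..1,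
      ‖∑ i ∈ Finset.range n, Complex.exp ((2 * π * (i + 1) * t : ℝ) * Complex.I) * c i‖ ^ 4 := by
    have hpi : (2 * π) ≠ 0 := by positivity
    rw [circleAverage_def]
    have := intervalIntegral.integral_comp_mul_left
      (a := 0) (b := 1) (fun θ => ‖P.eval (circleMap 0 1 θ)‖ ^ 4) hpi
    rw [mul_zero, mul_one] at this
    rw [← this]
    congr 1; ext t
    congr 1
    have : ∑ i ∈ Finset.range n, Complex.exp ((2 * π * (i + 1) * t : ℝ) * Complex.I) * c i =
        Complex.exp ((2 * π * t : ℝ) * Complex.I) * P.eval (circleMap 0 1 (2 * π * t)) := by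
      rw [hP, Polynomial.eval_finsetSum, Finset.mul_sum]
      refine Finset.sum_congr rfl fun i _ => ?_
      simp only [circleMap, Polynomial.eval_monomial]
      rw [zero_add, Complex.ofReal_one, one_mul, ← Complex.exp_nat_mul, mul_left_comm,
        ← Complex.exp_add, mul_comm (c i)]
      congr 2; push_cast; ring
    rw [this, norm_mul, Complex.norm_exp_ofReal_mul_I, one_mul]
  rw [← h2]
  refine h.trans (pow_le_pow_left₀ (Finset.sum_nonneg fun _ _ => by positivity) h1 2)

lemma sum_freq_of_pos {n : ℕ} {N : Type*} [AddCommMonoid N] (F : ℤ → N) (hF : ∀ k ≤ 0, F k = 0) :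
    ∑ k : Freq n, F k = ∑ i ∈ Finset.range n, F (i + 1) := by
  rw [Finset.sum_coe_sort (Finset.Icc (-(n:ℤ)) n) F]
  symm
  rw [← Finset.sum_image (s := Finset.range n) (g := fun i : ℕ => ((i : ℤ) + 1)) (f := F)
    (by intro i _ j _ h; simpa using h)]
  refine Finset.sum_subset ?_ ?_
  · intro k hk
    obtain ⟨i, hi, rfl⟩ := Finset.mem_image.1 hk
    simp at hi ⊢; omega
  · intro k hk hk'
    apply hF
    by_contra h
    apply hk'
    simp at hk h ⊢
    exact ⟨(k - 1).toNat, by omega, by omega⟩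

/-- The critical Sobolev embedding in `L⁴` for loops with positive frequencies. -/
lemma integral_trigLoop_pow_four_le {n : ℕ} (a : TrigCoeff n) (ha : ∀ k : Freq n, (k : ℤ) ≤ 0 → a k = 0) :
    ∫ t in (0:ℝ)..1, ‖trigLoop a t‖ ^ 4 ≤ 4 * (∑ k : Freq n, (k : ℤ) * ‖a k‖ ^ 2) ^ 2 := by
  set b : ℤ → R4 := fun m => if h : m ∈ Finset.Icc (-(n:ℤ)) n then a ⟨m, h⟩ else 0 with hb
  have hba : ∀ k : Freq n, a k = b k := fun k => by simp only [hb]; rw [dif_pos k.2]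
  have hb0 : ∀ k ≤ 0, b k = 0 := by
    intro k hk
    simp only [hb]
    split_ifs with h
    · exact ha ⟨k, h⟩ hk
    · rfl
  set S := ∑ i ∈ Finset.range n, ((i:ℝ) + 1) * ‖b (i + 1)‖ ^ 2 with hS
  have e0 : ∑ k : Freq n, ((k : ℤ) : ℝ) * ‖a k‖ ^ 2 = S := by
    simp_rw [hba]
    rw [sum_freq_of_pos (fun k : ℤ => (k : ℝ) * ‖b k‖ ^ 2)
      (fun k hk => by simp [hb0 k hk])]
    simp [hS]
  have e1 : ∀ t, cplx₁ (trigLoop a t) = ∑ i ∈ Finset.range n,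
      Complex.exp ((2 * π * (i + 1) * t : ℝ) * Complex.I) * cplx₁ (b (i + 1)) := by
    intro t
    have : cplx₁ (trigLoop a t) = ∑ k : Freq n,
        Complex.exp ((2 * π * (k : ℤ) * t : ℝ) * Complex.I) * cplx₁ (b k) := by
      rw [trigLoop, cplx₁_sum]
      refine Finset.sum_congr rfl fun k _ => ?_
      rw [cplx₁_rot4, hba]
    rw [this, sum_freq_of_pos (fun k : ℤ =>
      Complex.exp ((2 * π * (k : ℤ) * t : ℝ) * Complex.I) * cplx₁ (b k))
      (fun k hk => by simp [hb0 k hk, cplx₁_zero])]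
    simp
  have e2 : ∀ t, cplx₂ (trigLoop a t) = ∑ i ∈ Finset.range n,
      Complex.exp ((2 * π * (i + 1) * t : ℝ) * Complex.I) * cplx₂ (b (i + 1)) := by
    intro t
    have : cplx₂ (trigLoop a t) = ∑ k : Freq n,
        Complex.exp ((2 * π * (k : ℤ) * t : ℝ) * Complex.I) * cplx₂ (b k) := by
      rw [trigLoop, cplx₂_sum]
      refine Finset.sum_congr rfl fun k _ => ?_
      rw [cplx₂_rot4, hba]
    rw [this, sum_freq_of_pos (fun k : ℤ =>
      Complex.exp ((2 * π * (k : ℤ) * t : ℝ) * Complex.I) * cplx₂ (b k))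
      (fun k hk => by simp [hb0 k hk, cplx₂_zero])]
    simp
  have i1 := integral_norm_pow_four_le n fun i => cplx₁ (b (i + 1))
  have i2 := integral_norm_pow_four_le n fun i => cplx₂ (b (i + 1))
  have c1 : Continuous fun t => ‖cplx₁ (trigLoop a t)‖ ^ 4 :=
    (continuous_cplx₁.comp (continuous_trigLoop a)).norm.pow 4
  have c2 : Continuous fun t => ‖cplx₂ (trigLoop a t)‖ ^ 4 :=
    (continuous_cplx₂.comp (continuous_trigLoop a)).norm.pow 4
  simp only [← e1] at i1
  simp only [← e2] at i2
  have s1 : ∑ i ∈ Finset.range n, ((i:ℝ) + 1) * ‖cplx₁ (b (i + 1))‖ ^ 2 ≤ S :=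
    Finset.sum_le_sum fun i _ => by
      rw [norm_sq_cplx (b (i + 1))]; gcongr; nlinarith [sq_nonneg ‖cplx₂ (b (i + 1))‖]
  have s2 : ∑ i ∈ Finset.range n, ((i:ℝ) + 1) * ‖cplx₂ (b (i + 1))‖ ^ 2 ≤ S :=
    Finset.sum_le_sum fun i _ => by
      rw [norm_sq_cplx (b (i + 1))]; gcongr; nlinarith [sq_nonneg ‖cplx₁ (b (i + 1))‖]
  have q1 := pow_le_pow_left₀ (Finset.sum_nonneg fun i _ => by positivity) s1 2
  have q2 := pow_le_pow_left₀ (Finset.sum_nonneg fun i _ => by positivity) s2 2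
  rw [e0]
  have h : ∫ t in (0:ℝ)..1, ‖trigLoop a t‖ ^ 4 ≤
      ∫ t in (0:ℝ)..1, (2 * ‖cplx₁ (trigLoop a t)‖ ^ 4 + 2 * ‖cplx₂ (trigLoop a t)‖ ^ 4) := by
    apply intervalIntegral.integral_mono_on zero_le_one
      (((continuous_trigLoop a).norm.pow 4).intervalIntegrable _ _)
      (((c1.const_mul 2).add (c2.const_mul 2)).intervalIntegrable _ _)
    intro t _
    change ‖trigLoop a t‖ ^ 4 ≤ 2 * ‖cplx₁ (trigLoop a t)‖ ^ 4 + 2 * ‖cplx₂ (trigLoop a t)‖ ^ 4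
    have := norm_sq_cplx (trigLoop a t)
    have h4 : ‖trigLoop a t‖ ^ 4 = (‖trigLoop a t‖ ^ 2) ^ 2 := by ring
    rw [h4, this]
    nlinarith [sq_nonneg (‖cplx₁ (trigLoop a t)‖ ^ 2 - ‖cplx₂ (trigLoop a t)‖ ^ 2)]
  rw [intervalIntegral.integral_add ((c1.const_mul 2).intervalIntegrable _ _)
    ((c2.const_mul 2).intervalIntegrable _ _), intervalIntegral.integral_const_mul,
    intervalIntegral.integral_const_mul] at h
  linarith

end Hardy

section FourierUniqueness

/-- A complex coordinate of `ℝ⁴` as a continuous real-linear map. -/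
def cplx₁L : R4 →L[ℝ] ℂ :=
  LinearMap.toContinuousLinearMap
    { toFun := cplx₁
      map_add' := cplx₁_add
      map_smul' := fun c x => by apply Complex.ext <;> simp [cplx₁] }

lemma cplx₁L_apply (x : R4) : cplx₁L x = cplx₁ x := rfl

/-- A complex coordinate of `ℝ⁴` as a continuous real-linear map. -/
def cplx₂L : R4 →L[ℝ] ℂ :=
  LinearMap.toContinuousLinearMap
    { toFun := cplx₂
      map_add' := cplx₂_add
      map_smul' := fun c x => by apply Complex.ext <;> simp [cplx₂] }

lemma cplx₂L_apply (x : R4) : cplx₂L x = cplx₂ x := rfl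

lemma eq_of_fourier_eq_zero_complex {f : ℝ → ℂ} (hf : Continuous f) (h01 : f 0 = f 1)
    (h : ∀ m : ℤ, m ≠ 0 → ∫ t in (0:ℝ)..1, Complex.exp ((-(2 * π * m * t) : ℝ) * Complex.I) * f t = 0)
    {t : ℝ} (ht : t ∈ Icc (0:ℝ) 1) : f t = f 0 := by
  have : Fact ((0:ℝ) < 1) := ⟨one_pos⟩
  have hc : Continuous (AddCircle.liftIco 1 0 f) :=
    AddCircle.liftIco_continuous (by simpa using h01) hf.continuousOn
  set F : C(AddCircle (1:ℝ), ℂ) := ⟨_, hc⟩ with hF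
  have hcoef : ∀ m : ℤ, m ≠ 0 → fourierCoeff F m = 0 := by
    intro m hm
    change fourierCoeff (AddCircle.liftIco 1 0 f) m = 0
    rw [fourierCoeff_liftIco_eq, fourierCoeffOn_eq_integral]
    have := h m hm
    simp only [zero_add, sub_zero, div_one, one_smul]
    rw [← this]
    congr 1; ext x
    rw [fourier_coe_apply, smul_eq_mul]
    congr 2
    push_cast; ring
  have hs : HasSum (fun i => fourierCoeff F i • fourier i) F := by
    apply hasSum_fourier_series_of_summable
    exact summable_of_ne_finset_zero (s := {0}) fun m hm => hcoef m (by simpa using hm)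
  have hF0 : F = fourierCoeff F 0 • fourier 0 := by
    refine hs.unique (hasSum_single 0 fun m hm => ?_)
    rw [hcoef m hm, zero_smul]
  have hconst : ∀ s ∈ Ico (0:ℝ) 1, f s = fourierCoeff F 0 := by
    intro s hs
    have h1 : F (s : AddCircle (1:ℝ)) = f s :=
      AddCircle.liftIco_coe_apply (by simpa using hs)
    rw [← h1]; exact (DFunLike.congr_fun hF0 _).trans (by simp)
  rcases ht.2.eq_or_lt with rfl | h1
  · exact h01.symm
  · rw [hconst t ⟨ht.1, h1⟩, hconst 0 (by simp)]

lemma eq_of_fourier_eq_zero {w : ℝ → R4} (hw : Continuous w) (h01 : w 0 = w 1)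
    (h : ∀ m : ℤ, m ≠ 0 → ∫ t in (0:ℝ)..1, rot4 (-(2 * π * m * t)) (w t) = 0)
    {t : ℝ} (ht : t ∈ Icc (0:ℝ) 1) : w t = w 0 := by
  have hInteg : ∀ m : ℤ, IntervalIntegrable (fun t => rot4 (-(2 * π * m * t)) (w t)) volume 0 1 :=
    fun m => (continuous_rot4_apply (by fun_prop) hw).intervalIntegrable _ _
  apply cplx_ext
  · refine eq_of_fourier_eq_zero_complex (continuous_cplx₁.comp hw) (congrArg cplx₁ h01) ?_ ht
    intro m hm
    have := ContinuousLinearMap.intervalIntegral_comp_comm cplx₁L (hInteg m)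
    rw [h m hm, map_zero] at this
    rw [← this]
    congr 1; ext t
    rw [cplx₁L_apply, cplx₁_rot4]; rfl
  · refine eq_of_fourier_eq_zero_complex (continuous_cplx₂.comp hw) (congrArg cplx₂ h01) ?_ ht
    intro m hm
    have := ContinuousLinearMap.intervalIntegral_comp_comm cplx₂L (hInteg m)
    rw [h m hm, map_zero] at this
    rw [← this]
    congr 1; ext t
    rw [cplx₂L_apply, cplx₂_rot4]; rfl

end FourierUniqueness

section Galerkin

/-- The quadratic form `μ₁ |z₁|² + μ₂ |z₂|²` on `ℝ⁴ = ℂ²`. -/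
def quadForm (μ₁ μ₂ : ℝ) (x : R4) : ℝ := μ₁ * (x 0 ^ 2 + x 1 ^ 2) + μ₂ * (x 2 ^ 2 + x 3 ^ 2)

/-- The gradient of `quadForm`. -/
def quadGrad (μ₁ μ₂ : ℝ) : R4 →L[ℝ] R4 :=
  LinearMap.toContinuousLinearMap
    { toFun := fun x => !₂[2 * μ₁ * x 0, 2 * μ₁ * x 1, 2 * μ₂ * x 2, 2 * μ₂ * x 3]
      map_add' := fun x y => by ext i; fin_cases i <;> simp <;> ring
      map_smul' := fun c x => by ext i; fin_cases i <;> simp <;> ring }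

lemma quadGrad_apply (μ₁ μ₂ : ℝ) (x : R4) :
    quadGrad μ₁ μ₂ x = !₂[2 * μ₁ * x 0, 2 * μ₁ * x 1, 2 * μ₂ * x 2, 2 * μ₂ * x 3] := rfl

lemma quadGrad_rot4 (μ₁ μ₂ θ : ℝ) (x : R4) :
    quadGrad μ₁ μ₂ (rot4 θ x) = rot4 θ (quadGrad μ₁ μ₂ x) := by
  ext i; fin_cases i <;> simp [quadGrad_apply, rot4_apply] <;> ring

lemma exists_spectral_gap {μ₁ μ₂ : ℝ} (h₁ : π < μ₁) (h₁' : μ₁ < 2 * π) (h₂ : 0 < μ₂) (h₂' : μ₂ < π) :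
    ∃ δ > 0, ∀ (k : ℤ) (x : R4), δ * ‖x‖ ≤ ‖(2 * π * k) • x - quadGrad μ₁ μ₂ x‖ := by
  have gap : ∀ (j : ℤ) (μ : ℝ), π * j < μ → μ < π * (j + 1) →
      ∃ δ > 0, ∀ k : ℤ, δ ^ 2 ≤ (2 * π * k - 2 * μ) ^ 2 := by
    intro j μ h h'
    refine ⟨min (2 * μ - 2 * π * j) (2 * π * (j + 1) - 2 * μ), lt_min (by linarith) (by linarith),
      fun k => ?_⟩
    have hpi := Real.pi_pos
    set d := min (2 * μ - 2 * π * j) (2 * π * (j + 1) - 2 * μ)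
    have hd : 0 < d := lt_min (by linarith) (by linarith)
    have d1 : d ≤ 2 * μ - 2 * π * j := min_le_left _ _
    have d2 : d ≤ 2 * π * (j + 1) - 2 * μ := min_le_right _ _
    rcases le_or_gt k j with hk | hk
    · have : (k:ℝ) ≤ j := by exact_mod_cast hk
      have : 2 * π * k ≤ 2 * π * j := by gcongr
      nlinarith
    · have : (j:ℝ) + 1 ≤ k := by exact_mod_cast hk
      have : 2 * π * (j + 1) ≤ 2 * π * k := by gcongr
      nlinarith
  obtain ⟨d₁, hd₁, g₁⟩ := gap 1 μ₁ (by simpa using h₁) (by push_cast; linarith)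
  obtain ⟨d₂, hd₂, g₂⟩ := gap 0 μ₂ (by simpa using h₂) (by push_cast; linarith)
  refine ⟨min d₁ d₂, lt_min hd₁ hd₂, fun k x => ?_⟩
  have hm : 0 < min d₁ d₂ := lt_min hd₁ hd₂
  have m1 : (min d₁ d₂) ^ 2 ≤ (2 * π * k - 2 * μ₁) ^ 2 :=
    (pow_le_pow_left₀ hm.le (min_le_left _ _) 2).trans (g₁ k)
  have m2 : (min d₁ d₂) ^ 2 ≤ (2 * π * k - 2 * μ₂) ^ 2 :=
    (pow_le_pow_left₀ hm.le (min_le_right _ _) 2).trans (g₂ k)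
  rw [← sq_le_sq₀ (by positivity) (norm_nonneg _), mul_pow, norm_sq_R4, norm_sq_R4]
  simp [quadGrad_apply]
  nlinarith [mul_le_mul_of_nonneg_right m1 (sq_nonneg (x 0)),
    mul_le_mul_of_nonneg_right m1 (sq_nonneg (x 1)),
    mul_le_mul_of_nonneg_right m2 (sq_nonneg (x 2)),
    mul_le_mul_of_nonneg_right m2 (sq_nonneg (x 3))]

variable {n : ℕ}

/-- The action functional of a Hamiltonian on trigonometric loops. -/
def galAction (H : R4 → ℝ) (a : TrigCoeff n) : ℝ :=
  ∑ k : Freq n, π * (k : ℤ) * ‖a k‖ ^ 2 - ∫ t in (0:ℝ)..1, H (trigLoop a t)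

/-- The gradient of the action functional on trigonometric loops, where `G` is the gradient of the
Hamiltonian. -/
def galGrad (G : R4 → R4) (a : TrigCoeff n) : TrigCoeff n :=
  WithLp.toLp 2 fun k => (2 * π * (k : ℤ)) • a k -
    ∫ t in (0:ℝ)..1, rot4 (-(2 * π * (k : ℤ) * t)) (G (trigLoop a t))

lemma continuous_integral_trigLoop {F : ℝ → R4 → ℝ} (hF : Continuous fun p : ℝ × R4 => F p.1 p.2) :
    Continuous fun p : ℝ × TrigCoeff n => ∫ t in (0:ℝ)..1, F p.1 (trigLoop p.2 t) := by
  apply intervalIntegral.continuous_parametric_intervalIntegral_of_continuous'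
  exact hF.comp ((continuous_fst.comp continuous_fst).prodMk
    (continuous_trigLoop_uncurry.comp ((continuous_snd.comp continuous_fst).prodMk continuous_snd)))

lemma continuous_galAction {H : ℝ → R4 → ℝ} (hH : Continuous fun p : ℝ × R4 => H p.1 p.2) :
    Continuous fun p : ℝ × TrigCoeff n => galAction (H p.1) p.2 := by
  unfold galAction
  refine Continuous.sub ?_ (continuous_integral_trigLoop hH)
  fun_prop

lemma continuous_galGrad {G : ℝ → R4 → R4} (hG : Continuous fun p : ℝ × R4 => G p.1 p.2) :
    Continuous fun p : ℝ × TrigCoeff n => galGrad (G p.1) p.2 := by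
  unfold galGrad
  refine (PiLp.continuous_toLp 2 _).comp (continuous_pi fun k => Continuous.sub (by fun_prop) ?_)
  apply intervalIntegral.continuous_parametric_intervalIntegral_of_continuous'
  exact continuous_rot4_apply (by fun_prop) (hG.comp ((continuous_fst.comp continuous_fst).prodMk
    (continuous_trigLoop_uncurry.comp ((continuous_snd.comp continuous_fst).prodMk continuous_snd))))

lemma abs_freq_le (k : Freq n) : |((k : ℤ) : ℝ)| ≤ n := by
  have := Finset.mem_Icc.1 k.2
  rw [abs_le]; exact ⟨by exact_mod_cast this.1, by exact_mod_cast this.2⟩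

lemma norm_sq_trigCoeff (a : TrigCoeff n) : ‖a‖ ^ 2 = ∑ k, ‖a k‖ ^ 2 := PiLp.norm_sq_eq_of_L2 _ a

lemma inner_trigCoeff (a b : TrigCoeff n) : inner ℝ a b = ∑ k, inner ℝ (a k) (b k) :=
  PiLp.inner_apply a b

lemma galAction_add_le {H : R4 → ℝ} {G : R4 → R4} (hHG : ∀ x, HasGradientAt H (G x) x)
    (hG : Continuous G) {ε η : ℝ} (hε : ∀ x y, ‖x - y‖ ≤ η → ‖G x - G y‖ ≤ ε) (hε0 : 0 ≤ ε)
    (u v : TrigCoeff n) (hv : (2 * n + 1) * ‖v‖ ≤ η) :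
    galAction H (u + v) ≤ galAction H u + inner ℝ (galGrad G u) v + π * n * ‖v‖ ^ 2 +
      ε * ((2 * n + 1) * ‖v‖) := by
  have hH : Continuous H := continuous_iff_continuousAt.2 fun x => (hHG x).differentiableAt.continuousAt
  have hw : ∀ t, ‖trigLoop v t‖ ≤ η := fun t => (norm_trigLoop_le v t).trans hv
  have e1 : ∀ t, H (trigLoop u t) + inner ℝ (G (trigLoop u t)) (trigLoop v t) -
      ε * ((2 * n + 1) * ‖v‖) ≤ H (trigLoop (u + v) t) := by
    intro t
    set x := trigLoop u t
    set w := trigLoop v t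
    have := (convex_closedBall x η).norm_image_sub_le_of_norm_hasFDerivWithin_le'
      (f := H) (f' := fun y => InnerProductSpace.toDual ℝ R4 (G y)) (C := ε)
      (φ := InnerProductSpace.toDual ℝ R4 (G x)) (x := x) (y := x + w)
      (fun y _ => (hHG y).hasFDerivAt.hasFDerivWithinAt)
      (fun y hy => by
        rw [← map_sub, LinearIsometryEquiv.norm_map]
        exact hε y x (by simpa [dist_eq_norm] using hy))
      (mem_closedBall_self ((norm_nonneg _).trans (hw t)))
      (by simpa [dist_eq_norm] using hw t)
    rw [add_sub_cancel_left, InnerProductSpace.toDual_apply_apply] at this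
    have h2 : ε * ‖w‖ ≤ ε * ((2 * n + 1) * ‖v‖) :=
      mul_le_mul_of_nonneg_left (norm_trigLoop_le v t) hε0
    have h3 := (abs_le.1 this).1
    rw [trigLoop_add]
    linarith
  have cu := continuous_trigLoop u
  have cv := continuous_trigLoop v
  have cuv := continuous_trigLoop (u + v)
  have e2 : ∫ t in (0:ℝ)..1, (H (trigLoop u t) + inner ℝ (G (trigLoop u t)) (trigLoop v t) -
      ε * ((2 * n + 1) * ‖v‖)) ≤ ∫ t in (0:ℝ)..1, H (trigLoop (u + v) t) :=
    intervalIntegral.integral_mono_on zero_le_one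
      (Continuous.intervalIntegrable (by fun_prop) _ _)
      (Continuous.intervalIntegrable (by fun_prop) _ _) fun t _ => e1 t
  rw [intervalIntegral.integral_sub (Continuous.intervalIntegrable (by fun_prop) _ _)
    (Continuous.intervalIntegrable (by fun_prop) _ _),
    intervalIntegral.integral_add (Continuous.intervalIntegrable (by fun_prop) _ _)
    (Continuous.intervalIntegrable (by fun_prop) _ _),
    integral_inner_trigLoop (fun t => G (trigLoop u t)) (hG.comp cu)] at e2
  simp only [intervalIntegral.integral_const, sub_zero, one_smul] at e2
  have e3 : ∑ k : Freq n, π * (k : ℤ) * ‖(u + v) k‖ ^ 2 = ∑ k : Freq n, π * (k : ℤ) * ‖u k‖ ^ 2 +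
      ∑ k : Freq n, inner ℝ ((2 * π * (k : ℤ)) • u k) (v k) +
      ∑ k : Freq n, π * (k : ℤ) * ‖v k‖ ^ 2 := by
    rw [← Finset.sum_add_distrib, ← Finset.sum_add_distrib]
    refine Finset.sum_congr rfl fun k _ => ?_
    rw [PiLp.add_apply, norm_add_sq_real, real_inner_smul_left]; ring
  have e4 : inner ℝ (galGrad G u) v = ∑ k : Freq n, inner ℝ ((2 * π * (k : ℤ)) • u k) (v k) -
      ∑ k : Freq n, inner ℝ (∫ t in (0:ℝ)..1, rot4 (-(2 * π * (k : ℤ) * t)) (G (trigLoop u t))) (v k) := by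
    rw [inner_trigCoeff, ← Finset.sum_sub_distrib]
    refine Finset.sum_congr rfl fun k _ => ?_
    rw [galGrad, PiLp.toLp_apply, inner_sub_left]
  have e5 : ∑ k : Freq n, π * (k : ℤ) * ‖v k‖ ^ 2 ≤ π * n * ‖v‖ ^ 2 := by
    rw [norm_sq_trigCoeff, Finset.mul_sum]
    refine Finset.sum_le_sum fun k _ => ?_
    have := (le_abs_self _).trans (abs_freq_le k)
    gcongr
  rw [galAction, galAction, e3, e4]
  linarith

lemma norm_galGrad_add_le {G : R4 → R4} (hG : Continuous G) {ε η : ℝ}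
    (hε : ∀ x y, ‖x - y‖ ≤ η → ‖G x - G y‖ ≤ ε)
    (u v : TrigCoeff n) (hv : (2 * n + 1) * ‖v‖ ≤ η) :
    ‖galGrad G (u + v)‖ ≤ ‖galGrad G u‖ + 2 * π * n * ‖v‖ + ε := by
  set p : TrigCoeff n := WithLp.toLp 2 fun k => (2 * π * (k : ℤ)) • v k with hp
  set c : TrigCoeff n := WithLp.toLp 2 fun k : Freq n => ∫ t in (0:ℝ)..1,
    rot4 (-(2 * π * (k : ℤ) * t)) (G (trigLoop (u + v) t) - G (trigLoop u t)) with hc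
  have cu := continuous_trigLoop u
  have cuv := continuous_trigLoop (u + v)
  have e : galGrad G (u + v) = galGrad G u + p - c := by
    ext1 k
    simp only [galGrad, hp, hc, PiLp.add_apply, PiLp.sub_apply, PiLp.toLp_apply, map_sub]
    rw [intervalIntegral.integral_sub
      ((continuous_rot4_apply (by fun_prop) (by fun_prop)).intervalIntegrable _ _)
      ((continuous_rot4_apply (by fun_prop) (by fun_prop)).intervalIntegrable _ _), smul_add]
    abel
  have hpn : ‖p‖ ≤ 2 * π * n * ‖v‖ := by
    rw [← sq_le_sq₀ (norm_nonneg _) (by positivity), mul_pow, norm_sq_trigCoeff, norm_sq_trigCoeff,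
      Finset.mul_sum]
    refine Finset.sum_le_sum fun k _ => ?_
    rw [hp, PiLp.toLp_apply, norm_smul, mul_pow]
    gcongr
    rw [norm_mul, Real.norm_eq_abs, abs_of_pos (by positivity)]
    gcongr
    exact abs_freq_le k
  have hcn : ‖c‖ ≤ ε := by
    refine norm_fourier_le (w := fun t => G (trigLoop (u + v) t) - G (trigLoop u t)) (by fun_prop)
      (fun t => hε _ _ ?_) c fun k => rfl
    rw [trigLoop_add, add_sub_cancel_left]
    exact (norm_trigLoop_le v t).trans hv
  rw [e]
  calc _ ≤ ‖galGrad G u + p‖ + ‖c‖ := norm_sub_le _ _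
    _ ≤ ‖galGrad G u‖ + ‖p‖ + ‖c‖ := by gcongr; exact norm_add_le _ _
    _ ≤ _ := by gcongr

lemma galGrad_coercive {G : R4 → R4} (hG : Continuous G) {μ₁ μ₂ δ B : ℝ} (hδ : 0 ≤ δ)
    (hgap : ∀ (k : ℤ) (x : R4), δ * ‖x‖ ≤ ‖(2 * π * k) • x - quadGrad μ₁ μ₂ x‖)
    (hB : ∀ x, ‖G x - quadGrad μ₁ μ₂ x‖ ≤ B) (u : TrigCoeff n) :
    δ * ‖u‖ ≤ ‖galGrad G u‖ + B := by
  set Q := quadGrad μ₁ μ₂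
  set p : TrigCoeff n := WithLp.toLp 2 fun k => (2 * π * (k : ℤ)) • u k - Q (u k) with hp
  set c : TrigCoeff n := WithLp.toLp 2 fun k : Freq n => ∫ t in (0:ℝ)..1,
    rot4 (-(2 * π * (k : ℤ) * t)) (G (trigLoop u t) - Q (trigLoop u t)) with hc
  have cu := continuous_trigLoop u
  have hQ : ∀ k : Freq n, ∫ t in (0:ℝ)..1, rot4 (-(2 * π * (k : ℤ) * t)) (Q (trigLoop u t)) =
      Q (u k) := by
    intro k
    have := trigLoop_coeff u k
    rw [dif_pos k.2] at this
    conv_rhs => rw [← this]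
    rw [← ContinuousLinearMap.intervalIntegral_comp_comm _
      ((continuous_rot4_apply (by fun_prop) (by fun_prop)).intervalIntegrable _ _)]
    simp_rw [Q, quadGrad_rot4]
  have e : p = galGrad G u + c := by
    ext1 k
    simp only [galGrad, hp, hc, PiLp.add_apply, PiLp.toLp_apply, map_sub]
    rw [intervalIntegral.integral_sub
      ((continuous_rot4_apply (by fun_prop) (by fun_prop)).intervalIntegrable _ _)
      ((continuous_rot4_apply (by fun_prop) (by fun_prop)).intervalIntegrable _ _), hQ]
    abel
  have hcn : ‖c‖ ≤ B :=
    norm_fourier_le (w := fun t => G (trigLoop u t) - Q (trigLoop u t)) (by fun_prop)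
      (fun t => hB _) c fun k => rfl
  have hpn : δ * ‖u‖ ≤ ‖p‖ := by
    rw [← sq_le_sq₀ (by positivity) (norm_nonneg _), mul_pow, norm_sq_trigCoeff, norm_sq_trigCoeff,
      Finset.mul_sum]
    refine Finset.sum_le_sum fun k _ => ?_
    rw [← mul_pow, hp, PiLp.toLp_apply]
    gcongr
    exact hgap _ _
  rw [e] at hpn
  linarith [norm_add_le (galGrad G u) c]

lemma galAction_of_galGrad_eq_zero {H : R4 → ℝ} {G : R4 → R4} (hH : Continuous H)
    (hG : Continuous G) {u : TrigCoeff n} (hu : galGrad G u = 0) :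
    galAction H u = ∫ t in (0:ℝ)..1,
      (1 / 2 * inner ℝ (G (trigLoop u t)) (trigLoop u t) - H (trigLoop u t)) := by
  have cu := continuous_trigLoop u
  rw [intervalIntegral.integral_sub (Continuous.intervalIntegrable (by fun_prop) _ _)
    (Continuous.intervalIntegrable (by fun_prop) _ _), intervalIntegral.integral_const_mul,
    integral_inner_trigLoop (fun t => G (trigLoop u t)) (hG.comp cu), galAction, Finset.mul_sum]
  congr 1
  refine Finset.sum_congr rfl fun k _ => ?_
  have : galGrad G u k = 0 := by rw [hu]; rfl
  rw [galGrad, PiLp.toLp_apply, sub_eq_zero] at this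
  rw [← this, real_inner_smul_left, real_inner_self_eq_norm_sq]
  ring

end Galerkin

section CriticalCompactness

variable {n : ℕ}

lemma hasDerivAt_trigLoop (u : TrigCoeff n) (t : ℝ) :
    HasDerivAt (trigLoop u)
      (J4 (trigLoop (WithLp.toLp 2 fun k : Freq n => (2 * π * (k : ℤ)) • u k) t)) t := by
  have h : ∀ k : Freq n, HasDerivAt (fun t : ℝ => rot4 (2 * π * (k : ℤ) * t) (u k))
      ((2 * π * (k : ℤ)) • J4 (rot4 (2 * π * (k : ℤ) * t) (u k))) t := by
    intro k
    have h1 : HasDerivAt (fun t : ℝ => 2 * π * (k : ℤ) * t) (2 * π * (k : ℤ)) t := by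
      simpa using (hasDerivAt_id t).const_mul (2 * π * ((k : ℤ) : ℝ))
    exact (hasDerivAt_rot4 _ (u k)).scomp t h1
  refine (HasDerivAt.fun_sum (u := Finset.univ) fun k _ => h k).congr_deriv ?_
  rw [trigLoop, map_sum]
  refine Finset.sum_congr rfl fun k _ => ?_
  rw [PiLp.toLp_apply, map_smul, map_smul]

lemma norm_J4 (x : R4) : ‖J4 x‖ = ‖x‖ := by
  rw [← sq_eq_sq₀ (norm_nonneg _) (norm_nonneg _), ← real_inner_self_eq_norm_sq,
    inner_J4_J4, real_inner_self_eq_norm_sq]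

lemma norm_trigLoop_sub_le (u : TrigCoeff n) {K ε s t : ℝ} (hε : 0 < ε)
    (hK : ‖(WithLp.toLp 2 fun k : Freq n => (2 * π * (k : ℤ)) • u k : TrigCoeff n)‖ ≤ K)
    (hs : s ∈ Icc (0:ℝ) 1) (ht : t ∈ Icc (0:ℝ) 1) :
    ‖trigLoop u t - trigLoop u s‖ ≤ ε * K ^ 2 + |t - s| / ε := by
  wlog hst : s ≤ t generalizing s t
  · rw [norm_sub_rev, abs_sub_comm]
    exact this ht hs (le_of_not_ge hst)
  set p : TrigCoeff n := WithLp.toLp 2 fun k : Freq n => (2 * π * (k : ℤ)) • u k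
  have cp := continuous_trigLoop p
  have h1 : trigLoop u t - trigLoop u s = ∫ r in s..t, J4 (trigLoop p r) :=
    (intervalIntegral.integral_eq_sub_of_hasDerivAt (fun r _ => hasDerivAt_trigLoop u r)
      (Continuous.intervalIntegrable (by fun_prop) _ _)).symm
  rw [h1]
  have h2 : ‖∫ r in s..t, J4 (trigLoop p r)‖ ≤ ∫ r in s..t, (ε * ‖trigLoop p r‖ ^ 2 + 1 / ε) := by
    refine intervalIntegral.norm_integral_le_of_norm_le hst ?_
      (Continuous.intervalIntegrable (by fun_prop) _ _)
    refine ae_of_all _ fun r _ => ?_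
    rw [norm_J4]
    set y := ‖trigLoop p r‖
    have : 0 ≤ (2 * ε * y - 1) ^ 2 + 3 := by positivity
    have e : ε * y ^ 2 + 1 / ε - y = ((2 * ε * y - 1) ^ 2 + 3) / (4 * ε) := by field_simp; ring
    have : 0 ≤ ε * y ^ 2 + 1 / ε - y := by rw [e]; positivity
    linarith
  refine h2.trans ?_
  rw [intervalIntegral.integral_add (Continuous.intervalIntegrable (by fun_prop) _ _)
    (Continuous.intervalIntegrable (by fun_prop) _ _), intervalIntegral.integral_const_mul,
    intervalIntegral.integral_const, abs_of_nonneg (sub_nonneg.2 hst)]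
  have h3 : ∫ r in s..t, ‖trigLoop p r‖ ^ 2 ≤ ∫ r in (0:ℝ)..1, ‖trigLoop p r‖ ^ 2 :=
    intervalIntegral.integral_mono_interval hs.1 hst ht.2 (ae_of_all _ fun r => by positivity)
      (Continuous.intervalIntegrable (by fun_prop) _ _)
  rw [integral_norm_sq_trigLoop] at h3
  have h4 : ‖p‖ ^ 2 ≤ K ^ 2 := by gcongr
  have : ε * ∫ r in s..t, ‖trigLoop p r‖ ^ 2 ≤ ε * K ^ 2 := by gcongr; exact h3.trans h4
  rw [smul_eq_mul]
  have e : (t - s) * (1 / ε) = (t - s) / ε := by ring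
  linarith

lemma norm_trigLoop_le_of_deriv (u : TrigCoeff n) {K t : ℝ}
    (hK : ‖(WithLp.toLp 2 fun k : Freq n => (2 * π * (k : ℤ)) • u k : TrigCoeff n)‖ ≤ K)
    (ht : t ∈ Icc (0:ℝ) 1) : ‖trigLoop u t‖ ≤ ‖u‖ + (K ^ 2 + 1) := by
  have cu := continuous_trigLoop u
  have h0 := trigLoop_coeff u 0
  rw [dif_pos (by simp)] at h0
  simp only [Int.cast_zero, mul_zero, zero_mul, neg_zero, rot4_zero] at h0
  have h1 : trigLoop u t - u ⟨0, by simp⟩ = ∫ s in (0:ℝ)..1, (trigLoop u t - trigLoop u s) := by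
    rw [intervalIntegral.integral_sub (Continuous.intervalIntegrable (by fun_prop) _ _)
      (Continuous.intervalIntegrable (by fun_prop) _ _), h0]
    simp
  have h2 : ‖∫ s in (0:ℝ)..1, (trigLoop u t - trigLoop u s)‖ ≤ (K ^ 2 + 1) * |1 - 0| := by
    apply intervalIntegral.norm_integral_le_of_norm_le_const
    intro s hs
    rw [uIoc_of_le zero_le_one] at hs
    have := norm_trigLoop_sub_le u one_pos hK (Ioc_subset_Icc_self hs) ht
    have h3 : |t - s| ≤ 1 := abs_le.2 ⟨by linarith [ht.1, hs.2], by linarith [ht.2, hs.1]⟩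
    rw [one_mul, div_one] at this
    linarith
  rw [← h1] at h2
  have h3 : ‖u ⟨0, by simp⟩‖ ≤ ‖u‖ := PiLp.norm_apply_le u _
  have := norm_add_le (trigLoop u t - u ⟨0, by simp⟩) (u ⟨0, by simp⟩)
  rw [sub_add_cancel] at this
  simp at h2
  linarith

lemma norm_deriv_coeff_le {G : R4 → R4} (hG : Continuous G) {μ₁ μ₂ B : ℝ}
    (hB : ∀ x, ‖G x - quadGrad μ₁ μ₂ x‖ ≤ B) {u : TrigCoeff n} (hu : galGrad G u = 0) :
    ‖(WithLp.toLp 2 fun k : Freq n => (2 * π * (k : ℤ)) • u k : TrigCoeff n)‖ ≤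
      ‖quadGrad μ₁ μ₂‖ * ‖u‖ + B := by
  set Q := quadGrad μ₁ μ₂
  set c : TrigCoeff n := WithLp.toLp 2 fun k : Freq n => ∫ t in (0:ℝ)..1,
    rot4 (-(2 * π * (k : ℤ) * t)) (G (trigLoop u t) - Q (trigLoop u t)) with hc
  set q : TrigCoeff n := WithLp.toLp 2 fun k : Freq n => Q (u k) with hq
  have cu := continuous_trigLoop u
  have hQ : ∀ k : Freq n, ∫ t in (0:ℝ)..1, rot4 (-(2 * π * (k : ℤ) * t)) (Q (trigLoop u t)) =
      Q (u k) := by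
    intro k
    have := trigLoop_coeff u k
    rw [dif_pos k.2] at this
    conv_rhs => rw [← this]
    rw [← ContinuousLinearMap.intervalIntegral_comp_comm _
      ((continuous_rot4_apply (by fun_prop) (by fun_prop)).intervalIntegrable _ _)]
    simp_rw [Q, quadGrad_rot4]
  have e : (WithLp.toLp 2 fun k : Freq n => (2 * π * (k : ℤ)) • u k : TrigCoeff n) = q + c := by
    ext1 k
    have hk : galGrad G u k = 0 := by rw [hu]; rfl
    rw [galGrad, PiLp.toLp_apply, sub_eq_zero] at hk
    simp only [hq, hc, PiLp.add_apply, map_sub]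
    rw [intervalIntegral.integral_sub
      ((continuous_rot4_apply (by fun_prop) (by fun_prop)).intervalIntegrable _ _)
      ((continuous_rot4_apply (by fun_prop) (by fun_prop)).intervalIntegrable _ _), hQ, hk]
    abel
  have hcn : ‖c‖ ≤ B :=
    norm_fourier_le (w := fun t => G (trigLoop u t) - Q (trigLoop u t)) (by fun_prop)
      (fun t => hB _) c fun k => rfl
  have hqn : ‖q‖ ≤ ‖Q‖ * ‖u‖ := by
    rw [← sq_le_sq₀ (norm_nonneg _) (by positivity), mul_pow, norm_sq_trigCoeff, norm_sq_trigCoeff,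
      Finset.mul_sum]
    refine Finset.sum_le_sum fun k _ => ?_
    rw [← mul_pow, hq, PiLp.toLp_apply]
    gcongr
    exact Q.le_opNorm _
  rw [e]
  linarith [norm_add_le q c]

lemma tendsto_integral_of_pointwise {E : Type*} [NormedAddCommGroup E] [NormedSpace ℝ E]
    {Φ : ℝ × ℝ × R4 → E} (hΦ : Continuous Φ) {σ : ℕ → ℝ} {σ' : ℝ} (hσ : Tendsto σ atTop (𝓝 σ'))
    {x : ℕ → ℝ → R4} {x' : ℝ → R4} (hx : ∀ j, Continuous (x j)) {K a b : ℝ}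
    (hσI : ∀ j, σ j ∈ Icc a b)
    (hK : ∀ j, ∀ t ∈ Icc (0:ℝ) 1, ‖x j t‖ ≤ K)
    (hxx : ∀ t ∈ Icc (0:ℝ) 1, Tendsto (fun j => x j t) atTop (𝓝 (x' t))) :
    Tendsto (fun j => ∫ t in (0:ℝ)..1, Φ (t, σ j, x j t)) atTop
      (𝓝 (∫ t in (0:ℝ)..1, Φ (t, σ', x' t))) := by
  obtain ⟨C, hC⟩ := ((isCompact_Icc (a := (0:ℝ)) (b := 1)).prod ((isCompact_Icc (a := a) (b := b)).prod
    (isCompact_closedBall (0 : R4) K))).exists_bound_of_continuousOn hΦ.continuousOn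
  have hI : ∀ t ∈ Set.uIoc (0:ℝ) 1, t ∈ Icc (0:ℝ) 1 := fun t ht => by
    rw [uIoc_of_le zero_le_one] at ht; exact Ioc_subset_Icc_self ht
  refine intervalIntegral.tendsto_integral_filter_of_dominated_convergence (fun _ => C) ?_ ?_ ?_ ?_
  · refine Eventually.of_forall fun j => Continuous.aestronglyMeasurable ?_
    have := hx j
    exact hΦ.comp (by fun_prop)
  · refine Eventually.of_forall fun j => ae_of_all _ fun t ht => ?_
    exact hC _ ⟨hI t ht, hσI j, by simpa using hK j t (hI t ht)⟩
  · simp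
  · refine ae_of_all _ fun t ht => ?_
    exact (hΦ.tendsto _).comp (tendsto_const_nhds.prodMk_nhds (hσ.prodMk_nhds (hxx t (hI t ht))))

end CriticalCompactness

section CriticalLimit

lemma exists_subseq_tendsto_of_equicontinuous {x : ℕ → ℝ → R4} (hx : ∀ j, Continuous (x j)) {K : ℝ}
    (hK : ∀ j, ∀ t ∈ Icc (0:ℝ) 1, ‖x j t‖ ≤ K)
    (heq : ∀ ε > 0, ∃ δ > 0, ∀ j, ∀ s ∈ Icc (0:ℝ) 1, ∀ t ∈ Icc (0:ℝ) 1, |t - s| < δ →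
      ‖x j t - x j s‖ < ε) :
    ∃ φ : ℕ → ℕ, StrictMono φ ∧ ∃ y : ℝ → R4, Continuous y ∧
      ∀ t ∈ Icc (0:ℝ) 1, Tendsto (fun j => x (φ j) t) atTop (𝓝 (y t)) := by
  let f : ℕ → BoundedContinuousFunction (Icc (0:ℝ) 1) R4 := fun j =>
    BoundedContinuousFunction.mkOfCompact ⟨fun t => x j t, (hx j).comp continuous_subtype_val⟩
  have hf : ∀ j t, f j t = x j t := fun j t => rfl
  have hcomp : IsCompact (closure (Set.range f)) := by
    refine BoundedContinuousFunction.arzela_ascoli (closedBall 0 K) (isCompact_closedBall _ _) _ ?_ ?_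
    · rintro _ t ⟨j, rfl⟩
      rw [mem_closedBall_zero_iff, hf]
      exact hK j t t.2
    · intro t₀
      rw [Metric.equicontinuousAt_iff]
      intro ε hε
      obtain ⟨δ, hδ, h⟩ := heq ε hε
      refine ⟨δ, hδ, ?_⟩
      rintro t ht ⟨_, j, rfl⟩
      change dist (f j t₀) (f j t) < ε
      rw [hf, hf, dist_eq_norm]
      refine h j t t.2 t₀ t₀.2 ?_
      rw [abs_sub_comm]
      simpa [Subtype.dist_eq, Real.dist_eq] using ht
  obtain ⟨a, -, φ, hφ, ha⟩ := hcomp.tendsto_subseq fun j => subset_closure (mem_range_self j)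
  refine ⟨φ, hφ, IccExtend zero_le_one a, a.continuous.Icc_extend', fun t ht => ?_⟩
  rw [IccExtend_of_mem _ _ ht]
  exact ((continuous_eval_const (⟨t, ht⟩ : Icc (0:ℝ) 1)).tendsto a).comp ha

/-- A continuous loop whose Fourier coefficients satisfy the Hamilton equation is a periodic
solution of it. -/
lemma hasDerivAt_of_fourier {x : ℝ → R4} (hx : Continuous x) {w : ℝ → R4} (hw : Continuous w)
    (h01 : x 0 = x 1)
    (h : ∀ m : ℤ, (2 * π * m) • ∫ t in (0:ℝ)..1, rot4 (-(2 * π * m * t)) (x t) =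
      ∫ t in (0:ℝ)..1, rot4 (-(2 * π * m * t)) (w t)) {t : ℝ} (ht : t ∈ Icc (0:ℝ) 1) :
    x t = x 0 + ∫ s in (0:ℝ)..t, J4 (w s) := by
  have hJw : Continuous fun s => J4 (w s) := by fun_prop
  set X : ℝ → R4 := fun t => ∫ s in (0:ℝ)..t, J4 (w s) with hX
  have hXd : ∀ t, HasDerivAt X (J4 (w t)) t := fun t =>
    intervalIntegral.integral_hasDerivAt_right (hJw.intervalIntegrable _ _)
      hJw.aestronglyMeasurable.stronglyMeasurableAtFilter hJw.continuousAt
  have hXc : Continuous X := continuous_iff_continuousAt.2 fun t => (hXd t).continuousAt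
  have hX0 : X 0 = 0 := by simp [hX]
  have hX1 : X 1 = 0 := by
    have h0 := h 0
    simp only [Int.cast_zero, mul_zero, zero_mul, neg_zero, rot4_zero, zero_smul] at h0
    rw [hX]
    change ∫ s in (0:ℝ)..1, J4 (w s) = 0
    rw [ContinuousLinearMap.intervalIntegral_comp_comm _ (hw.intervalIntegrable _ _), ← h0, map_zero]
  have key : (fun t => x t - X t) t = (fun t => x t - X t) 0 := by
    refine eq_of_fourier_eq_zero (w := fun t => x t - X t) (hx.sub hXc)
      (by simp only [hX0, hX1, h01]) (fun m hm => ?_) ht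
    have hr : ∀ {v : ℝ → R4}, Continuous v → Continuous fun t => rot4 (-(2 * π * m * t)) (v t) :=
      fun hv => continuous_rot4_apply (by fun_prop) hv
    have hd : ∀ t, HasDerivAt (fun t => rot4 (-(2 * π * m * t)) (X t))
        (-(2 * π * m) • J4 (rot4 (-(2 * π * m * t)) (X t)) + J4 (rot4 (-(2 * π * m * t)) (w t))) t := by
      intro t
      have e : (fun t => rot4 (-(2 * π * m * t)) (X t)) = fun t =>
          Real.cos (-(2 * π * m * t)) • X t + Real.sin (-(2 * π * m * t)) • J4 (X t) := rfl
      have h1 : HasDerivAt (fun t : ℝ => -(2 * π * m * t)) (-(2 * π * m)) t := by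
        simpa using ((hasDerivAt_id t).const_mul (2 * π * (m : ℝ))).fun_neg
      rw [e]
      refine ((h1.cos.smul (hXd t)).add (h1.sin.smul
        ((J4.hasFDerivAt.comp_hasDerivAt t (hXd t))))).congr_deriv ?_
      simp only [rot4_apply, map_add, map_smul, J4_J4, Function.comp_apply]
      module
    have e1 : Continuous fun t => -(2 * π * m) • J4 (rot4 (-(2 * π * m * t)) (X t)) :=
      (J4.continuous.comp (hr hXc)).const_smul (-(2 * π * (m : ℝ)))
    have e2 : Continuous fun t => J4 (rot4 (-(2 * π * m * t)) (w t)) := J4.continuous.comp (hr hw)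
    have hInteg := intervalIntegral.integral_eq_sub_of_hasDerivAt (fun t _ => hd t)
      ((e1.add e2).intervalIntegrable 0 1)
    rw [hX0, hX1, map_zero, map_zero, sub_zero, intervalIntegral.integral_add
      (e1.intervalIntegrable _ _) (e2.intervalIntegrable _ _), intervalIntegral.integral_smul,
      ContinuousLinearMap.intervalIntegral_comp_comm _ ((hr hXc).intervalIntegrable _ _),
      ContinuousLinearMap.intervalIntegral_comp_comm _ ((hr hw).intervalIntegrable _ _), ← h m,
      map_smul, neg_smul, neg_add_eq_zero] at hInteg
    have hm' : (2 * π * (m:ℝ)) ≠ 0 := by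
      have := Real.pi_ne_zero
      have : (m : ℝ) ≠ 0 := by exact_mod_cast hm
      positivity
    have h3 := smul_right_injective R4 hm' hInteg
    have h4 := congrArg J4 h3
    rw [J4_J4, J4_J4, neg_inj] at h4
    simp only [map_sub]
    rw [intervalIntegral.integral_sub ((hr hx).intervalIntegrable _ _)
      ((hr hXc).intervalIntegrable _ _), h4, sub_self]
  simp only [hX0, sub_zero] at key
  rw [← key]; simp only [hX]; abel

end CriticalLimit

/-- A one-parameter family of Hamiltonians `H σ` on `ℝ⁴` with gradients `G σ`, antitone in `σ` with
`-∂H/∂σ = D`, which agree up to constants with a fixed quadratic form outside a ball and vanish to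
fourth order at some point at `σ = σ₀`. -/
structure IsHamiltonianFamily (μ₁ μ₂ C₀ σ₀ σ₁ R : ℝ) (H D : ℝ → R4 → ℝ) (G : ℝ → R4 → R4) : Prop where
  pi_lt : π < μ₁
  lt_two_pi : μ₁ < 2 * π
  pos : 0 < μ₂
  lt_pi : μ₂ < π
  le : σ₀ ≤ σ₁
  continuous_H : Continuous fun p : ℝ × R4 => H p.1 p.2
  continuous_D : Continuous fun p : ℝ × R4 => D p.1 p.2
  continuous_G : Continuous fun p : ℝ × R4 => G p.1 p.2
  hasGradientAt : ∀ σ x, HasGradientAt (H σ) (G σ x) x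
  eq_quadGrad : ∀ σ ∈ Icc σ₀ σ₁, ∀ x, R ≤ ‖x‖ → G σ x = quadGrad μ₁ μ₂ x
  nonneg : ∀ σ ∈ Icc σ₀ σ₁, ∀ x, 0 ≤ H σ x
  quadForm_sub_le : ∀ σ ∈ Icc σ₀ σ₁, ∀ x, quadForm μ₁ μ₂ x - C₀ ≤ H σ x
  le_pow_four : ∃ C, ∃ p : R4, ∀ x, H σ₀ x ≤ C * ‖x - p‖ ^ 4
  antitone : ∀ σ ∈ Icc σ₀ σ₁, ∀ σ' ∈ Icc σ₀ σ₁, σ' ≤ σ → ∀ x, H σ x ≤ H σ' x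
  drop : ∀ ε > 0, ∃ δ > 0, ∀ σ ∈ Icc σ₀ σ₁, ∀ s ∈ Icc 0 δ, σ₀ ≤ σ - s →
    ∀ x, H σ x + s * (D σ x - ε) ≤ H (σ - s) x

namespace IsHamiltonianFamily

variable {μ₁ μ₂ C₀ σ₀ σ₁ R : ℝ} {H D : ℝ → R4 → ℝ} {G : ℝ → R4 → R4}

lemma continuous_H' (h : IsHamiltonianFamily μ₁ μ₂ C₀ σ₀ σ₁ R H D G) (σ : ℝ) : Continuous (H σ) :=
  h.continuous_H.comp (Continuous.prodMk_right σ)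

lemma continuous_G' (h : IsHamiltonianFamily μ₁ μ₂ C₀ σ₀ σ₁ R H D G) (σ : ℝ) : Continuous (G σ) :=
  h.continuous_G.comp (Continuous.prodMk_right σ)

lemma continuous_D' (h : IsHamiltonianFamily μ₁ μ₂ C₀ σ₀ σ₁ R H D G) (σ : ℝ) : Continuous (D σ) :=
  h.continuous_D.comp (Continuous.prodMk_right σ)

lemma exists_bound (h : IsHamiltonianFamily μ₁ μ₂ C₀ σ₀ σ₁ R H D G) :
    ∃ B, 0 ≤ B ∧ ∀ σ ∈ Icc σ₀ σ₁, ∀ x, ‖G σ x - quadGrad μ₁ μ₂ x‖ ≤ B := by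
  have hc : Continuous fun p : ℝ × R4 => G p.1 p.2 - quadGrad μ₁ μ₂ p.2 :=
    h.continuous_G.sub (by fun_prop)
  obtain ⟨B, hB⟩ := ((isCompact_Icc (a := σ₀) (b := σ₁)).prod
    (isCompact_closedBall (0 : R4) R)).exists_bound_of_continuousOn hc.continuousOn
  refine ⟨max B 0, le_max_right _ _, fun σ hσ x => ?_⟩
  rcases le_total ‖x‖ R with hx | hx
  · exact (hB (σ, x) ⟨hσ, by simpa using hx⟩).trans (le_max_left _ _)
  · rw [h.eq_quadGrad σ hσ x hx, sub_self, norm_zero]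
    exact le_max_right _ _

lemma exists_modulus (h : IsHamiltonianFamily μ₁ μ₂ C₀ σ₀ σ₁ R H D G) {ε : ℝ} (hε : 0 < ε) :
    ∃ η > 0, ∀ σ ∈ Icc σ₀ σ₁, ∀ x y, ‖x - y‖ ≤ η → ‖G σ x - G σ y‖ ≤ ε := by
  set Q := quadGrad μ₁ μ₂
  have hc : Continuous fun p : ℝ × R4 => G p.1 p.2 - Q p.2 := h.continuous_G.sub (by fun_prop)
  have huc := ((isCompact_Icc (a := σ₀) (b := σ₁)).prod
    (isCompact_closedBall (0 : R4) (R + 1))).uniformContinuousOn_of_continuous hc.continuousOn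
  obtain ⟨δ, hδ, hu⟩ := Metric.uniformContinuousOn_iff.1 huc (ε / 2) (by positivity)
  refine ⟨min (min (δ / 2) 1) (ε / (2 * (‖Q‖ + 1))), by positivity, fun σ hσ x y hxy => ?_⟩
  have h1 : ‖x - y‖ ≤ δ / 2 := hxy.trans ((min_le_left _ _).trans (min_le_left _ _))
  have h2 : ‖x - y‖ ≤ 1 := hxy.trans ((min_le_left _ _).trans (min_le_right _ _))
  have h3 : ‖x - y‖ ≤ ε / (2 * (‖Q‖ + 1)) := hxy.trans (min_le_right _ _)
  have h4 : ‖Q x - Q y‖ ≤ ε / 2 := by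
    rw [← map_sub]
    calc ‖Q (x - y)‖ ≤ ‖Q‖ * ‖x - y‖ := Q.le_opNorm _
      _ ≤ (‖Q‖ + 1) * (ε / (2 * (‖Q‖ + 1))) := by gcongr; linarith
      _ = ε / 2 := by field_simp
  have h5 : ‖(G σ x - Q x) - (G σ y - Q y)‖ ≤ ε / 2 := by
    by_cases hR : ‖x‖ ≤ R ∨ ‖y‖ ≤ R
    · have hx : ‖x‖ ≤ R + 1 := by
        rcases hR with hR | hR
        · linarith
        · linarith [norm_le_insert' x y]
      have hy : ‖y‖ ≤ R + 1 := by
        rcases hR with hR | hR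
        · linarith [norm_le_insert x y]
        · linarith
      have := hu (σ, x) ⟨hσ, by simpa using hx⟩ (σ, y) ⟨hσ, by simpa using hy⟩ (by
        rw [Prod.dist_eq, dist_self, dist_eq_norm, max_eq_right (norm_nonneg _)]; linarith)
      rw [dist_eq_norm] at this
      exact this.le
    · push Not at hR
      rw [h.eq_quadGrad σ hσ x hR.1.le, h.eq_quadGrad σ hσ y hR.2.le]
      simp only [Q, sub_self, norm_zero]; positivity
  calc ‖G σ x - G σ y‖ = ‖((G σ x - Q x) - (G σ y - Q y)) + (Q x - Q y)‖ := by congr 1; abel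
    _ ≤ ε := by linarith [norm_add_le ((G σ x - Q x) - (G σ y - Q y)) (Q x - Q y)]

/-- Critical points of the Galerkin approximations subconverge to periodic orbits. -/
lemma exists_loop_of_seq (h : IsHamiltonianFamily μ₁ μ₂ C₀ σ₀ σ₁ R H D G) {β τ : ℝ}
    {N : ℕ → ℕ} (hN : ∀ j, j ≤ N j) {s : ℕ → ℝ} (hs : ∀ j, s j ∈ Icc σ₀ σ₁)
    {u : ∀ j, TrigCoeff (N j)} (hu : ∀ j, galGrad (G (s j)) (u j) = 0)
    (hβ : ∀ j, β ≤ galAction (H (s j)) (u j))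
    (hτ : ∀ j, ∫ t in (0:ℝ)..1, D (s j) (trigLoop (u j) t) ≤ τ) :
    ∃ σ ∈ Icc σ₀ σ₁, ∃ x : ℝ → R4, Continuous x ∧ x 0 = x 1 ∧
      (∀ t ∈ Icc (0:ℝ) 1, x t = x 0 + ∫ s in (0:ℝ)..t, J4 (G σ (x s))) ∧
      β ≤ (∫ t in (0:ℝ)..1, (1 / 2 * inner ℝ (G σ (x t)) (x t) - H σ (x t))) ∧
      ∫ t in (0:ℝ)..1, D σ (x t) ≤ τ := by
  obtain ⟨B, hB0, hB⟩ := h.exists_bound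
  obtain ⟨δ, hδ, hgap⟩ := exists_spectral_gap h.pi_lt h.lt_two_pi h.pos h.lt_pi
  have hun : ∀ j, ‖u j‖ ≤ B / δ := fun j => by
    have := galGrad_coercive (h.continuous_G' (s j)) hδ.le hgap (hB _ (hs j)) (u j)
    rw [hu, norm_zero, zero_add] at this
    rwa [le_div_iff₀ hδ, mul_comm]
  set K := ‖quadGrad μ₁ μ₂‖ * (B / δ) + B
  have hK0 : 0 ≤ K := by positivity
  have hK : ∀ j, ‖(WithLp.toLp 2 fun k : Freq (N j) => (2 * π * (k : ℤ)) • u j k :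
      TrigCoeff (N j))‖ ≤ K := fun j =>
    (norm_deriv_coeff_le (h.continuous_G' (s j)) (hB _ (hs j)) (hu j)).trans (by
      simp only [K]; gcongr; exact hun j)
  have hxb : ∀ j, ∀ t ∈ Icc (0:ℝ) 1, ‖trigLoop (u j) t‖ ≤ B / δ + (K ^ 2 + 1) := fun j t ht =>
    (norm_trigLoop_le_of_deriv (u j) (hK j) ht).trans (by gcongr; exact hun j)
  obtain ⟨σ, hσ, φ₁, hφ₁, hsσ⟩ := isCompact_Icc.tendsto_subseq hs
  obtain ⟨φ₂, hφ₂, x, hx, hlim⟩ := exists_subseq_tendsto_of_equicontinuous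
    (x := fun j => trigLoop (u (φ₁ j))) (fun j => continuous_trigLoop _) (fun j => hxb (φ₁ j)) (by
      intro ε hε
      set e := ε / (2 * (K ^ 2 + 1)) with he
      have he0 : 0 < e := by positivity
      refine ⟨e * (ε / 2), by positivity, fun j s hs t ht hst => ?_⟩
      refine (norm_trigLoop_sub_le _ he0 (hK (φ₁ j)) hs ht).trans_lt ?_
      have h1 : e * K ^ 2 ≤ ε / 2 := by
        have : e * (K ^ 2 + 1) = ε / 2 := by rw [he]; field_simp
        nlinarith
      have h2 : |t - s| / e < ε / 2 := by rw [div_lt_iff₀ he0]; linarith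
      linarith)
  set φ := fun j => φ₁ (φ₂ j) with hφ
  have hφj : ∀ j, j ≤ N (φ j) := fun j => ((hφ₁.comp hφ₂).id_le j).trans (hN _)
  have hsφ : Tendsto (fun j => s (φ j)) atTop (𝓝 σ) := hsσ.comp hφ₂.tendsto_atTop
  have lim : ∀ {E : Type} [NormedAddCommGroup E] [NormedSpace ℝ E] {Φ : ℝ × ℝ × R4 → E},
      Continuous Φ → Tendsto (fun j => ∫ t in (0:ℝ)..1, Φ (t, s (φ j), trigLoop (u (φ j)) t)) atTop
        (𝓝 (∫ t in (0:ℝ)..1, Φ (t, σ, x t))) := fun hΦ =>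
    tendsto_integral_of_pointwise hΦ hsφ (fun j => continuous_trigLoop _) (fun j => hs _)
      (fun j => hxb _) hlim
  have cG : Continuous fun p : ℝ × ℝ × R4 => G p.2.1 p.2.2 := h.continuous_G.comp continuous_snd
  have cH : Continuous fun p : ℝ × ℝ × R4 => H p.2.1 p.2.2 := h.continuous_H.comp continuous_snd
  have cD : Continuous fun p : ℝ × ℝ × R4 => D p.2.1 p.2.2 := h.continuous_D.comp continuous_snd
  have h01 : x 0 = x 1 := by
    refine tendsto_nhds_unique (hlim 0 (by simp)) ((hlim 1 (by simp)).congr fun j => ?_)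
    simp only [trigLoop]
    refine Finset.sum_congr rfl fun k _ => ?_
    rw [rot4_apply, rot4_apply]
    have e1 : Real.cos (2 * π * (k : ℤ) * 1) = 1 := by
      rw [show 2 * π * ((k : ℤ) : ℝ) * 1 = ((k : ℤ) : ℝ) * (2 * π) by ring, Real.cos_int_mul_two_pi]
    have e2 : Real.sin (2 * π * (k : ℤ) * 1) = 0 := by
      rw [show 2 * π * ((k : ℤ) : ℝ) * 1 = ((2 * (k : ℤ) : ℤ) : ℝ) * π by push_cast; ring,
        Real.sin_int_mul_pi]
    rw [e1, e2]; simp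
  have hfour : ∀ m : ℤ, (2 * π * m) • ∫ t in (0:ℝ)..1, rot4 (-(2 * π * m * t)) (x t) =
      ∫ t in (0:ℝ)..1, rot4 (-(2 * π * m * t)) (G σ (x t)) := by
    intro m
    have l1 := (lim (Φ := fun p => rot4 (-(2 * π * m * p.1)) p.2.2)
      (continuous_rot4_apply (by fun_prop) (by fun_prop))).const_smul (2 * π * (m:ℝ))
    have l2 := lim (Φ := fun p => rot4 (-(2 * π * m * p.1)) (G p.2.1 p.2.2))
      (continuous_rot4_apply (by fun_prop) cG)
    refine tendsto_nhds_unique (l1.congr' ?_) l2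
    filter_upwards [eventually_ge_atTop m.natAbs] with j hj
    have hm : m ∈ Finset.Icc (-(N (φ j) : ℤ)) (N (φ j)) := by
      have := hφj j
      rw [Finset.mem_Icc]; omega
    have h0 : galGrad (G (s (φ j))) (u (φ j)) ⟨m, hm⟩ = 0 := by rw [hu]; rfl
    rw [galGrad, PiLp.toLp_apply, sub_eq_zero] at h0
    have h1 := trigLoop_coeff (u (φ j)) m
    rw [dif_pos hm] at h1
    rw [h1]
    exact h0
  refine ⟨σ, hσ, x, hx, h01, fun t ht => hasDerivAt_of_fourier hx
    ((h.continuous_G' σ).comp hx) h01 hfour ht, ?_, ?_⟩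
  · refine ge_of_tendsto' (lim (Φ := fun p => 1 / 2 * inner ℝ (G p.2.1 p.2.2) p.2.2 - H p.2.1 p.2.2)
      ((continuous_const.mul (cG.inner (by fun_prop))).sub cH)) fun j => ?_
    have := hβ (φ j)
    rwa [galAction_of_galGrad_eq_zero (h.continuous_H' _) (h.continuous_G' _) (hu _)] at this
  · exact le_of_tendsto' (lim (Φ := fun p => D p.2.1 p.2.2) cD) fun j => hτ (φ j)

end IsHamiltonianFamily

section Linking

variable {n : ℕ}

lemma quadForm_eq_inner (μ₁ μ₂ : ℝ) (x : R4) :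
    quadForm μ₁ μ₂ x = 1 / 2 * inner ℝ (quadGrad μ₁ μ₂ x) x := by
  rw [inner_R4, quadGrad_apply, quadForm]; simp; ring

lemma integral_quadForm_trigLoop (μ₁ μ₂ : ℝ) (a : TrigCoeff n) :
    ∫ t in (0:ℝ)..1, quadForm μ₁ μ₂ (trigLoop a t) = ∑ k, quadForm μ₁ μ₂ (a k) := by
  set b : TrigCoeff n := WithLp.toLp 2 fun k => quadGrad μ₁ μ₂ (a k)
  have hb : ∀ t, quadGrad μ₁ μ₂ (trigLoop a t) = trigLoop b t := fun t => by
    rw [trigLoop, map_sum, trigLoop]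
    exact Finset.sum_congr rfl fun k _ => quadGrad_rot4 _ _ _ _
  simp_rw [quadForm_eq_inner, hb]
  rw [intervalIntegral.integral_const_mul, integral_inner_trigLoop_trigLoop, inner_trigCoeff,
    Finset.mul_sum]

lemma quadForm_ge {μ₁ μ₂ c : ℝ} (h₁ : c ≤ μ₁) (h₂ : c ≤ μ₂) (x : R4) :
    c * ‖x‖ ^ 2 ≤ quadForm μ₁ μ₂ x := by
  rw [norm_sq_R4, quadForm]
  nlinarith [mul_nonneg (sub_nonneg.2 h₁) (add_nonneg (sq_nonneg (x 0)) (sq_nonneg (x 1))),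
    mul_nonneg (sub_nonneg.2 h₂) (add_nonneg (sq_nonneg (x 2)) (sq_nonneg (x 3)))]

/-- The coordinates of the linking disc: all coordinates of nonpositive frequency and one
coordinate of frequency one. -/
def IsLinkIndex (p : Freq n × Fin 4) : Prop := (p.1 : ℤ) ≤ 0 ∨ ((p.1 : ℤ) = 1 ∧ p.2 = 0)

instance (p : Freq n × Fin 4) : Decidable (IsLinkIndex p) := by unfold IsLinkIndex; infer_instance

/-- The inclusion of the linking disc. -/
def linkMap (u : Freq n × Fin 4 → ℝ) : TrigCoeff n :=
  WithLp.toLp 2 fun k => WithLp.toLp 2 fun j => if IsLinkIndex (k, j) then u (k, j) else 0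

/-- The lower corner of the linking box. -/
def linkLo (n : ℕ) (L : ℝ) (p : Freq n × Fin 4) : ℝ := if (p.1 : ℤ) = 1 ∧ p.2 = 0 then 0 else -L

/-- The linking box. -/
def linkBox (n : ℕ) (L : ℝ) : Set (Freq n × Fin 4 → ℝ) := Icc (linkLo n L) fun _ => L

/-- The boundary of the linking box in the relevant coordinates. -/
def linkBdry (n : ℕ) (L : ℝ) : Set (Freq n × Fin 4 → ℝ) :=
  {u | u ∈ linkBox n L ∧ ∃ p, IsLinkIndex p ∧ (u p = linkLo n L p ∨ u p = L)}

lemma continuous_linkMap : Continuous (linkMap (n := n)) := by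
  refine (PiLp.continuous_toLp 2 _).comp (continuous_pi fun k =>
    (PiLp.continuous_toLp 2 _).comp (continuous_pi fun j => ?_))
  split_ifs <;> fun_prop

lemma linkMap_apply (u : Freq n × Fin 4 → ℝ) (k : Freq n) (j : Fin 4) :
    linkMap u k j = if IsLinkIndex (k, j) then u (k, j) else 0 := rfl

lemma linkMap_of_index (u : Freq n × Fin 4 → ℝ) {k : Freq n} {j : Fin 4} (h : IsLinkIndex (k, j)) :
    linkMap u k j = u (k, j) := if_pos h

lemma linkMap_of_one_lt (u : Freq n × Fin 4 → ℝ) {k : Freq n} (hk : 1 < (k : ℤ)) :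
    linkMap u k = 0 := by
  ext j
  rw [linkMap_apply, if_neg]
  · rfl
  · rintro (h | h)
    · exact absurd h (by simp only; omega)
    · exact absurd h.1 (by simp only; omega)

lemma norm_sq_linkMap_of_eq_one (u : Freq n × Fin 4 → ℝ) {k : Freq n} (hk : (k : ℤ) = 1) :
    ‖linkMap u k‖ ^ 2 = u (k, 0) ^ 2 ∧ ∀ j ≠ 0, linkMap u k j = 0 := by
  have h0 : linkMap u k 0 = u (k, 0) := linkMap_of_index _ (Or.inr ⟨hk, rfl⟩)
  have hj : ∀ j ≠ 0, linkMap u k j = 0 := fun j hj => by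
    rw [linkMap_apply, if_neg]
    rintro (h | h)
    · exact absurd h (by simp only; omega)
    · exact hj h.2
  refine ⟨?_, hj⟩
  rw [norm_sq_R4, h0, hj 1 (by decide), hj 2 (by decide), hj 3 (by decide)]; ring

lemma sum_mul_norm_sq_linkMap_le {μ₁ μ₂ c : ℝ} (h₁ : c ≤ μ₁ - π) (h₂ : c ≤ μ₂)
    (u : Freq n × Fin 4 → ℝ) :
    ∑ k : Freq n, π * (k : ℤ) * ‖linkMap u k‖ ^ 2 - ∑ k, quadForm μ₁ μ₂ (linkMap u k) ≤
      -c * ∑ k, ‖linkMap u k‖ ^ 2 := by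
  have hpi := Real.pi_pos
  rw [← Finset.sum_sub_distrib, Finset.mul_sum]
  refine Finset.sum_le_sum fun k _ => ?_
  rcases lt_trichotomy (k : ℤ) 1 with hk | hk | hk
  · have := quadForm_ge (h₁.trans (by linarith) : c ≤ μ₁) h₂ (linkMap u k)
    have hk' : ((k : ℤ) : ℝ) ≤ 0 := by exact_mod_cast (by omega : (k : ℤ) ≤ 0)
    have : π * ((k : ℤ) : ℝ) * ‖linkMap u k‖ ^ 2 ≤ 0 :=
      mul_nonpos_of_nonpos_of_nonneg (mul_nonpos_of_nonneg_of_nonpos hpi.le hk') (by positivity)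
    linarith
  · obtain ⟨e, hj⟩ := norm_sq_linkMap_of_eq_one u hk
    have : quadForm μ₁ μ₂ (linkMap u k) = μ₁ * ‖linkMap u k‖ ^ 2 := by
      rw [quadForm, norm_sq_R4, hj 1 (by decide), hj 2 (by decide), hj 3 (by decide)]; ring
    rw [this, hk]
    push_cast
    nlinarith [mul_nonneg (sub_nonneg.2 h₁) (sq_nonneg ‖linkMap u k‖)]
  · rw [linkMap_of_one_lt u hk]; simp [quadForm]

lemma galAction_linkMap_le {H : R4 → ℝ} (hH : Continuous H) {μ₁ μ₂ c C₀ : ℝ}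
    (h₁ : c ≤ μ₁ - π) (h₂ : c ≤ μ₂) (hq : ∀ x, quadForm μ₁ μ₂ x - C₀ ≤ H x)
    (u : Freq n × Fin 4 → ℝ) :
    galAction H (linkMap u) ≤ C₀ - c * ∑ k, ‖linkMap u k‖ ^ 2 := by
  have hc := continuous_trigLoop (linkMap u)
  have cq : Continuous (quadForm μ₁ μ₂) := by unfold quadForm; fun_prop
  have : ∫ t in (0:ℝ)..1, (quadForm μ₁ μ₂ (trigLoop (linkMap u) t) - C₀) ≤
      ∫ t in (0:ℝ)..1, H (trigLoop (linkMap u) t) :=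
    intervalIntegral.integral_mono_on zero_le_one
      (Continuous.intervalIntegrable (by fun_prop) _ _)
      (Continuous.intervalIntegrable (by fun_prop) _ _) fun t _ => hq _
  rw [intervalIntegral.integral_sub (Continuous.intervalIntegrable (by fun_prop) _ _)
    (Continuous.intervalIntegrable (by fun_prop) _ _), integral_quadForm_trigLoop] at this
  have h3 := sum_mul_norm_sq_linkMap_le h₁ h₂ u
  simp only [intervalIntegral.integral_const, sub_zero, one_smul] at this
  rw [galAction]
  linarith

lemma galAction_linkMap_le_zero {H : R4 → ℝ} (hH : Continuous H) {μ₁ μ₂ c C₀ L : ℝ} (hc : 0 ≤ c)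
    (h₁ : c ≤ μ₁ - π) (h₂ : c ≤ μ₂) (hq : ∀ x, quadForm μ₁ μ₂ x - C₀ ≤ H x) (hH0 : ∀ x, 0 ≤ H x)
    (hL : C₀ ≤ c * L ^ 2) {u : Freq n × Fin 4 → ℝ} (hu : u ∈ linkBdry n L) :
    galAction H (linkMap u) ≤ 0 := by
  have hpi := Real.pi_pos
  obtain ⟨hbox, ⟨k, j⟩, hp, hface⟩ := hu
  by_cases hz : ((k : ℤ) = 1 ∧ j = 0) ∧ u (k, j) = 0
  · obtain ⟨⟨hk, rfl⟩, hz⟩ := hz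
    have h0 : 0 ≤ ∫ t in (0:ℝ)..1, H (trigLoop (linkMap u) t) :=
      intervalIntegral.integral_nonneg zero_le_one fun t _ => hH0 _
    have : ∑ k : Freq n, π * (k : ℤ) * ‖linkMap u k‖ ^ 2 ≤ 0 := by
      refine Finset.sum_nonpos fun i _ => ?_
      rcases lt_trichotomy (i : ℤ) 1 with hi | hi | hi
      · have hk' : ((i : ℤ) : ℝ) ≤ 0 := by exact_mod_cast (by omega : (i : ℤ) ≤ 0)
        exact mul_nonpos_of_nonpos_of_nonneg (mul_nonpos_of_nonneg_of_nonpos hpi.le hk')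
          (by positivity)
      · obtain rfl : i = k := Subtype.ext (hi.trans hk.symm)
        rw [(norm_sq_linkMap_of_eq_one u hi).1, hz]; simp
      · rw [linkMap_of_one_lt u hi]; simp
    rw [galAction]; linarith
  · have habs : L ^ 2 ≤ u (k, j) ^ 2 := by
      rcases hface with h | h
      · rw [linkLo] at h
        split_ifs at h with h'
        · exact absurd ⟨h', h⟩ hz
        · rw [h]; simp
      · rw [h]
    have h3 : u (k, j) ^ 2 ≤ ‖linkMap u k‖ ^ 2 := by
      have e : linkMap u k j = u (k, j) := linkMap_of_index _ hp
      rw [← e, ← sq_abs, ← Real.norm_eq_abs]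
      gcongr
      exact PiLp.norm_apply_le _ _
    have h4 : ‖linkMap u k‖ ^ 2 ≤ ∑ k, ‖linkMap u k‖ ^ 2 :=
      Finset.single_le_sum (f := fun k => ‖linkMap u k‖ ^ 2) (fun _ _ => by positivity)
        (Finset.mem_univ k)
    have h5 := galAction_linkMap_le hH h₁ h₂ hq u
    have h6 : c * L ^ 2 ≤ c * ∑ k, ‖linkMap u k‖ ^ 2 := by
      gcongr; exact habs.trans (h3.trans h4)
    linarith

/-- The linking disc meets every translate of the boundary of a neighbourhood of zero in the
space of loops with positive frequencies. -/
lemma exists_link (hn : 1 ≤ n) {L α : ℝ} (hL0 : 0 < L) (p : R4) (hL : ‖p‖ ≤ L) (hα0 : 0 ≤ α)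
    (hα : α ≤ π * L ^ 2) (h : (Freq n × Fin 4 → ℝ) → TrigCoeff n) (hc : Continuous h)
    (hbd : ∀ u ∈ linkBdry n L, h u = linkMap u) :
    ∃ u ∈ linkBox n L, (∀ k : Freq n, (k : ℤ) < 0 → h u k = 0) ∧
      (∀ k : Freq n, (k : ℤ) = 0 → h u k = p) ∧
      ∑ k : Freq n, π * max ((k : ℤ) : ℝ) 0 * ‖h u k‖ ^ 2 = α := by
  have hpi := Real.pi_pos
  set F : (Freq n × Fin 4 → ℝ) → Freq n × Fin 4 → ℝ := fun u q =>
    if (q.1 : ℤ) ≤ 0 then h u q.1 q.2 - (if (q.1 : ℤ) = 0 then p q.2 else 0)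
    else if (q.1 : ℤ) = 1 ∧ q.2 = 0 then
      ∑ k : Freq n, π * max ((k : ℤ) : ℝ) 0 * ‖h u k‖ ^ 2 - α
    else u q with hF
  have hFc : Continuous F := by
    refine continuous_pi fun q => ?_
    simp only [hF]
    have h1 : ∀ k, Continuous fun u => h u k := fun k => (PiLp.continuous_apply 2 _ k).comp hc
    split_ifs
    · exact ((PiLp.continuous_apply 2 _ q.2).comp (h1 q.1)).sub continuous_const
    · exact ((PiLp.continuous_apply 2 _ q.2).comp (h1 q.1)).sub continuous_const
    · exact (continuous_finsetSum _ fun k _ => continuous_const.mul ((h1 k).norm.pow 2)).sub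
        continuous_const
    · fun_prop
  have hpj : ∀ j, |p j| ≤ L := fun j => by
    rw [← Real.norm_eq_abs]; exact (PiLp.norm_apply_le p j).trans hL
  have hsum : ∀ (u : Freq n × Fin 4 → ℝ) (k : Freq n), (k : ℤ) = 1 →
      ∑ k : Freq n, π * max ((k : ℤ) : ℝ) 0 * ‖linkMap u k‖ ^ 2 = π * u (k, 0) ^ 2 := by
    intro u k hk
    rw [Finset.sum_eq_single k]
    · rw [(norm_sq_linkMap_of_eq_one u hk).1, hk]; simp
    · intro i _ hik
      rcases lt_trichotomy (i : ℤ) 1 with hi | hi | hi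
      · have hk' : ((i : ℤ) : ℝ) ≤ 0 := by exact_mod_cast (by omega : (i : ℤ) ≤ 0)
        rw [max_eq_right hk']; simp
      · exact absurd (Subtype.ext (hi.trans hk.symm)) hik
      · rw [linkMap_of_one_lt u hi]; simp
    · simp
  obtain ⟨u, hu, hzero⟩ := poincare_miranda (linkLo n L) (fun _ => L) (fun q => by
      rw [linkLo]; split_ifs <;> linarith) F hFc (by
      rintro u hu ⟨k, j⟩ huk
      simp only [hF]
      split_ifs with h1 h2 h3
      · rw [hbd u ⟨hu, _, Or.inl h1, Or.inl huk⟩, linkMap_of_index _ (Or.inl h1), huk, linkLo,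
          if_neg (by simp only; omega)]
        linarith [neg_le_of_abs_le (hpj j)]
      · rw [hbd u ⟨hu, _, Or.inl h1, Or.inl huk⟩, linkMap_of_index _ (Or.inl h1), huk, linkLo,
          if_neg (by simp only; omega)]
        linarith
      · obtain ⟨h3, rfl⟩ : (k : ℤ) = 1 ∧ j = 0 := h3
        rw [hbd u ⟨hu, _, Or.inr ⟨h3, rfl⟩, Or.inl huk⟩, hsum u k h3, huk, linkLo,
          if_pos ⟨h3, rfl⟩]
        simpa using hα0
      · rw [huk, linkLo, if_neg h3]; linarith) (by
      rintro u hu ⟨k, j⟩ huk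
      simp only [hF]
      split_ifs with h1 h2 h3
      · rw [hbd u ⟨hu, _, Or.inl h1, Or.inr huk⟩, linkMap_of_index _ (Or.inl h1), huk]
        linarith [le_of_abs_le (hpj j)]
      · rw [hbd u ⟨hu, _, Or.inl h1, Or.inr huk⟩, linkMap_of_index _ (Or.inl h1), huk]
        linarith
      · obtain ⟨h3, rfl⟩ : (k : ℤ) = 1 ∧ j = 0 := h3
        rw [hbd u ⟨hu, _, Or.inr ⟨h3, rfl⟩, Or.inr huk⟩, hsum u k h3, huk]
        linarith
      · rw [huk]; exact hL0.le)
  refine ⟨u, hu, fun k hk => ?_, fun k hk => ?_, ?_⟩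
  · ext j
    have := congrFun hzero (k, j)
    simp only [hF, if_pos hk.le, if_neg hk.ne, sub_zero, Pi.zero_apply] at this
    exact this
  · ext j
    have := congrFun hzero (k, j)
    simp only [hF, if_pos hk.le, if_pos hk, Pi.zero_apply] at this
    exact sub_eq_zero.1 this
  · have := congrFun hzero (⟨1, Finset.mem_Icc.2 (by omega)⟩, 0)
    simp only [hF, Pi.zero_apply] at this
    rw [if_neg (by norm_num), if_pos (by simp)] at this
    linarith

lemma le_galAction_of_link {H : R4 → ℝ} (hH : Continuous H) {C α : ℝ} (hC : 0 ≤ C) {p : R4}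
    (hHp : ∀ x, H x ≤ C * ‖x - p‖ ^ 4) {b : TrigCoeff n}
    (hneg : ∀ k : Freq n, (k : ℤ) < 0 → b k = 0) (hzero : ∀ k : Freq n, (k : ℤ) = 0 → b k = p)
    (hpos : ∑ k : Freq n, π * max ((k : ℤ) : ℝ) 0 * ‖b k‖ ^ 2 = α) :
    α - C * (4 * (α / π) ^ 2) ≤ galAction H b := by
  have hpi := Real.pi_pos
  set c : TrigCoeff n := WithLp.toLp 2 fun k => if (k : ℤ) ≤ 0 then 0 else b k with hc
  have hck : ∀ k, c k = if (k : ℤ) ≤ 0 then 0 else b k := fun k => rfl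
  have hbc : ∀ t, trigLoop b t - p = trigLoop c t := by
    intro t
    have h1 : ∀ k : Freq n, rot4 (2 * π * (k : ℤ) * t) (b k) =
        rot4 (2 * π * (k : ℤ) * t) (c k) + if k = ⟨0, by simp⟩ then p else 0 := by
      intro k
      rw [hck]
      rcases lt_trichotomy (k : ℤ) 0 with hk | hk | hk
      · rw [hneg k hk, if_pos hk.le, if_neg]
        · simp
        · rintro rfl; exact lt_irrefl _ hk
      · rw [hzero k hk, if_pos hk.le, if_pos (Subtype.ext hk), hk]
        simp [rot4_zero]
      · rw [if_neg (by omega), if_neg, add_zero]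
        rintro rfl; exact lt_irrefl _ hk
    rw [trigLoop, Finset.sum_congr rfl fun k _ => h1 k, Finset.sum_add_distrib]
    simp [trigLoop]
  have hs : ∑ k : Freq n, ((k : ℤ) : ℝ) * ‖c k‖ ^ 2 = α / π := by
    rw [eq_div_iff hpi.ne', ← hpos, Finset.sum_mul]
    refine Finset.sum_congr rfl fun k _ => ?_
    rw [hck]
    split_ifs with hk
    · rw [max_eq_right (by exact_mod_cast hk)]; simp
    · rw [max_eq_left (by exact_mod_cast (by omega : 0 ≤ (k:ℤ)))]; ring
  have h4 := integral_trigLoop_pow_four_le c fun k hk => by rw [hck, if_pos hk]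
  rw [hs] at h4
  have cb := continuous_trigLoop b
  have cc := continuous_trigLoop c
  have h5 : ∫ t in (0:ℝ)..1, H (trigLoop b t) ≤ ∫ t in (0:ℝ)..1, C * ‖trigLoop c t‖ ^ 4 :=
    intervalIntegral.integral_mono_on zero_le_one
      (Continuous.intervalIntegrable (by fun_prop) _ _)
      (Continuous.intervalIntegrable (by fun_prop) _ _) fun t _ => by rw [← hbc]; exact hHp _
  rw [intervalIntegral.integral_const_mul] at h5
  have h6 : ∑ k : Freq n, π * (k : ℤ) * ‖b k‖ ^ 2 = α := by
    rw [← hpos]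
    refine Finset.sum_congr rfl fun k _ => ?_
    rcases lt_or_ge (k : ℤ) 0 with hk | hk
    · rw [hneg k hk]; simp
    · rw [max_eq_left (by exact_mod_cast hk)]
  have h7 := mul_le_mul_of_nonneg_left h4 hC
  rw [galAction, h6]
  linarith

end Linking

lemma continuous_of_continuous_uncurry {X Y Z : Type*} [TopologicalSpace X] [TopologicalSpace Y]
    [TopologicalSpace Z] {F : X → Y → Z} (hF : Continuous fun p : X × Y => F p.1 p.2) (x : X) :
    Continuous fun y => F x y :=
  hF.comp (Continuous.prodMk_right x)

/-- A continuous function positive on a compact set has a positive lower bound there. -/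
lemma exists_pos_forall_le_of_isCompact {X : Type*} [TopologicalSpace X] {S : Set X}
    (hS : IsCompact S) {f : X → ℝ} (hf : ContinuousOn f S) (hpos : ∀ x ∈ S, 0 < f x) :
    ∃ c > 0, ∀ x ∈ S, c ≤ f x := by
  rcases S.eq_empty_or_nonempty with he | hne
  · exact ⟨1, one_pos, fun x hx => by rw [he] at hx; exact hx.elim⟩
  · obtain ⟨q, hq, hmin⟩ := hS.exists_isMinOn hne hf
    exact ⟨f q, hpos q hq, fun x hx => isMinOn_iff.1 hmin x hx⟩

namespace IsHamiltonianFamily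

variable {μ₁ μ₂ C₀ σ₀ σ₁ R : ℝ} {H D : ℝ → R4 → ℝ} {G : ℝ → R4 → R4}

lemma exists_forall_lt_integral (h : IsHamiltonianFamily μ₁ μ₂ C₀ σ₀ σ₁ R H D G) {β τ : ℝ}
    (hβ : 0 < β)
    (hloop : ∀ σ ∈ Icc σ₀ σ₁, ∀ x : ℝ → R4, Continuous x → x 0 = x 1 →
      (∀ t ∈ Icc (0:ℝ) 1, HasDerivAt x (J4 (G σ (x t))) t) →
      0 < (∫ t in (0:ℝ)..1, (1 / 2 * inner ℝ (G σ (x t)) (x t) - H σ (x t))) →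
      τ < ∫ t in (0:ℝ)..1, D σ (x t)) :
    ∃ n₀ : ℕ, ∀ n ≥ n₀, ∀ σ ∈ Icc σ₀ σ₁, ∀ u : TrigCoeff n, galGrad (G σ) u = 0 →
      β ≤ galAction (H σ) u → τ < ∫ t in (0:ℝ)..1, D σ (trigLoop u t) := by
  by_contra! hcon
  choose N hN s hs u hu hβu hτu using hcon
  obtain ⟨σ, hσ, x, hx, h01, hsol, hpos, hD⟩ := h.exists_loop_of_seq hN hs hu hβu hτu
  have hJ : Continuous fun s => J4 (G σ (x s)) := J4.continuous.comp ((h.continuous_G' σ).comp hx)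
  set y : ℝ → R4 := fun t => x 0 + ∫ s in (0:ℝ)..t, J4 (G σ (x s)) with hy
  have hyd : ∀ t, HasDerivAt y (J4 (G σ (x t))) t := fun t =>
    (intervalIntegral.integral_hasDerivAt_right (hJ.intervalIntegrable _ _)
      hJ.aestronglyMeasurable.stronglyMeasurableAtFilter hJ.continuousAt).const_add _
  have hxy : ∀ t ∈ Icc (0:ℝ) 1, x t = y t := hsol
  have hInteg : ∀ F : R4 → ℝ, ∫ t in (0:ℝ)..1, F (y t) = ∫ t in (0:ℝ)..1, F (x t) := fun F =>
    intervalIntegral.integral_congr fun t ht => by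
      rw [uIcc_of_le zero_le_one] at ht
      simp only [hxy t ht]
  refine absurd (hloop σ hσ y (continuous_iff_continuousAt.2 fun t => (hyd t).continuousAt)
    (by rw [← hxy 0 (by simp), ← hxy 1 (by simp), h01]) (fun t ht => by
      rw [← hxy t ht]; exact hyd t) ?_) ?_
  · rw [hInteg fun y => 1 / 2 * inner ℝ (G σ y) y - H σ y]; linarith
  · rw [hInteg (D σ)]; exact not_lt.2 hD

set_option maxHeartbeats 400000 in
/-- If all periodic orbits of positive action of a Hamiltonian family satisfy a lower bound on
`∫ D`, then this bounds the length of the parameter interval. -/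
theorem mul_sub_lt (h : IsHamiltonianFamily μ₁ μ₂ C₀ σ₀ σ₁ R H D G) {τ : ℝ} (hτ : 0 ≤ τ)
    (hloop : ∀ σ ∈ Icc σ₀ σ₁, ∀ x : ℝ → R4, Continuous x → x 0 = x 1 →
      (∀ t ∈ Icc (0:ℝ) 1, HasDerivAt x (J4 (G σ (x t))) t) →
      0 < (∫ t in (0:ℝ)..1, (1 / 2 * inner ℝ (G σ (x t)) (x t) - H σ (x t))) →
      τ < ∫ t in (0:ℝ)..1, D σ (x t)) :
    τ * (σ₁ - σ₀) < C₀ := by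
  have hpi := Real.pi_pos
  obtain ⟨C', p, hCp'⟩ := h.le_pow_four
  set C := max C' 1
  have hC1 : 1 ≤ C := le_max_right _ _
  have hCp : ∀ x, H σ₀ x ≤ C * ‖x - p‖ ^ 4 := fun x => (hCp' x).trans (by
    gcongr; exact le_max_left _ _)
  obtain ⟨α, hα⟩ : ∃ α, α = π ^ 2 / (8 * C) := ⟨_, rfl⟩
  have hα0 : 0 < α := by rw [hα]; positivity
  have hαβ : α - C * (4 * (α / π) ^ 2) = α / 2 := by rw [hα]; field_simp; ring
  obtain ⟨n₀, hn₀⟩ := h.exists_forall_lt_integral (β := α / 2 / 2) (by positivity) hloop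
  obtain ⟨B, hB0, hB⟩ := h.exists_bound
  obtain ⟨δ, hδ, hgap⟩ := exists_spectral_gap h.pi_lt h.lt_two_pi h.pos h.lt_pi
  obtain ⟨n, hn0, hn1⟩ : ∃ n, n₀ ≤ n ∧ 1 ≤ n := ⟨max n₀ 1, le_max_left _ _, le_max_right _ _⟩
  have hcA : Continuous fun q : ℝ × TrigCoeff n => galAction (H q.1) q.2 :=
    continuous_galAction h.continuous_H
  have hcG : Continuous fun q : ℝ × TrigCoeff n => galGrad (G q.1) q.2 :=
    continuous_galGrad h.continuous_G
  have hcD : Continuous fun q : ℝ × TrigCoeff n => ∫ t in (0:ℝ)..1, D q.1 (trigLoop q.2 t) :=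
    continuous_integral_trigLoop h.continuous_D
  obtain ⟨c, hc0, hc⟩ : ∃ c > 0, ∀ σ ∈ Icc σ₀ σ₁, ∀ u : TrigCoeff n, ‖galGrad (G σ) u‖ ≤ 1 →
      α / 2 / 2 ≤ galAction (H σ) u →
      c ≤ max ‖galGrad (G σ) u‖ ((∫ t in (0:ℝ)..1, D σ (trigLoop u t)) - τ) := by
    have hS : IsCompact ((Icc σ₀ σ₁ ×ˢ closedBall (0 : TrigCoeff n) ((1 + B) / δ)) ∩
      {q | α / 2 / 2 ≤ galAction (H q.1) q.2}) :=
      (isCompact_Icc.prod (isCompact_closedBall _ _)).inter_right (isClosed_le continuous_const hcA)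
    obtain ⟨c, hc0, hc⟩ := exists_pos_forall_le_of_isCompact hS
      (hcG.norm.max (hcD.sub continuous_const)).continuousOn (by
        rintro ⟨σ, u⟩ ⟨⟨hσ, -⟩, hA⟩
        by_cases hg : galGrad (G σ) u = 0
        · exact lt_max_of_lt_right (sub_pos.2 (hn₀ n hn0 σ hσ u hg hA))
        · exact lt_max_of_lt_left (norm_pos_iff.2 hg))
    refine ⟨c, hc0, fun σ hσ u hu hA => hc (σ, u) ⟨⟨hσ, ?_⟩, hA⟩⟩
    have := galGrad_coercive (h.continuous_G' σ) hδ.le hgap (hB σ hσ) u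
    rw [mem_closedBall_zero_iff, le_div_iff₀ hδ]
    linarith
  set ν := min (c / 4) (1 / 2)
  have hν : 0 < ν := by positivity
  have hνc : ν ≤ c / 4 := min_le_left _ _
  have hν1 : ν ≤ 1 / 2 := min_le_right _ _
  obtain ⟨η, hη, hmod⟩ := h.exists_modulus (ε := ν / (8 * (2 * n + 1))) (by positivity)
  obtain ⟨s₁, hs₁, hdrop⟩ := h.drop c hc0
  set a := min (η / (2 * n + 1)) (ν / (8 * π * (n + 1)))
  have ha : 0 < a := by positivity
  have haη : ∀ v : TrigCoeff n, ‖v‖ ≤ a → (2 * n + 1) * ‖v‖ ≤ η := fun v hv => by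
    have := hv.trans (min_le_left _ _)
    rwa [le_div_iff₀ (by positivity), mul_comm] at this
  have haν : ∀ v : TrigCoeff n, ‖v‖ ≤ a → π * n * ‖v‖ ≤ ν / 8 := fun v hv => by
    have := hv.trans (min_le_right _ _)
    rw [le_div_iff₀ (by positivity)] at this
    nlinarith [mul_nonneg hpi.le (norm_nonneg v)]
  set c₁ := min (μ₁ - π) μ₂
  have hc₁ : 0 < c₁ := lt_min (by linarith [h.pi_lt]) h.pos
  set L := 1 + ‖p‖ + |C₀| / c₁ + α / π
  have hp1 : 0 ≤ |C₀| / c₁ := by positivity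
  have hp2 : 0 ≤ α / π := by positivity
  have hp3 := norm_nonneg p
  have hL1 : 1 ≤ L := by simp only [L]; linarith
  have hLsq : L ≤ L ^ 2 := by nlinarith
  have hLC : C₀ ≤ c₁ * L ^ 2 := by
    have h1 : |C₀| / c₁ ≤ L := by simp only [L]; linarith
    have h2 := h1.trans hLsq
    rw [div_le_iff₀ hc₁] at h2
    linarith [le_abs_self C₀]
  have hLα : α ≤ π * L ^ 2 := by
    have h1 : α / π ≤ L := by simp only [L]; linarith
    have h2 := h1.trans hLsq
    rw [div_le_iff₀ hpi] at h2
    linarith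
  have hσ₁ : σ₁ ∈ Icc σ₀ σ₁ := right_mem_Icc.2 h.le
  have hσ₀ : σ₀ ∈ Icc σ₀ σ₁ := left_mem_Icc.2 h.le
  have intH : ∀ (σ : ℝ) (u : TrigCoeff n), IntervalIntegrable (fun t => H σ (trigLoop u t)) volume 0 1 :=
    fun σ u => ((h.continuous_H' σ).comp (continuous_trigLoop u)).intervalIntegrable _ _
  have hcA' : ∀ σ : ℝ, Continuous fun u : TrigCoeff n => galAction (H σ) u := fun σ =>
    continuous_of_continuous_uncurry (F := fun σ (u : TrigCoeff n) => galAction (H σ) u) hcA σ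
  have hcG' : ∀ σ : ℝ, Continuous fun u : TrigCoeff n => galGrad (G σ) u := fun σ =>
    continuous_of_continuous_uncurry (F := fun σ (u : TrigCoeff n) => galGrad (G σ) u) hcG σ
  refine minimax_monotonicity (E := TrigCoeff n) (P := Freq n × Fin 4 → ℝ)
    (fun σ u => galAction (H σ) u) (fun σ u => galGrad (G σ) u) (σ₀ := σ₀) (σ₁ := σ₁) (τ := τ)
    (β := α / 2) (C₀ := C₀) (ν := ν) (a := a) (s₁ := s₁)
    h.le hτ (half_pos hα0) hν ha hs₁ (fun σ _ => hcA' σ)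
    (fun σ _ => hcG' σ) ?_ ?_ ?_ ?_
    (linkBox n L) (linkBdry n L) linkMap continuous_linkMap ?_ ?_ ?_
  · intro σ hσ u v hv
    have h1 := galAction_add_le (h.hasGradientAt σ) (h.continuous_G' σ) (hmod σ hσ) (by positivity) u v
      (haη v hv)
    have h2 : π * n * ‖v‖ ^ 2 ≤ ν / 8 * ‖v‖ := by
      have := mul_le_mul_of_nonneg_right (haν v hv) (norm_nonneg v)
      linarith [this, (by ring : π * n * ‖v‖ ^ 2 = π * n * ‖v‖ * ‖v‖)]
    have h3 : ν / (8 * (2 * n + 1)) * ((2 * n + 1) * ‖v‖) = ν / 8 * ‖v‖ := by field_simp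
    rw [h3] at h1
    linarith
  · intro σ hσ u v hv
    have h1 := norm_galGrad_add_le (h.continuous_G' σ) (hmod σ hσ) u v (haη v hv)
    have h2 := haν v hv
    have h3 : ν / (8 * (2 * n + 1)) ≤ ν / 8 := by
      gcongr
      have : (0:ℝ) ≤ n := by positivity
      linarith
    linarith
  · intro σ hσ σ' hσ' hle u
    have := intervalIntegral.integral_mono_on zero_le_one (intH σ u) (intH σ' u) fun t _ =>
      h.antitone σ hσ σ' hσ' hle (trigLoop u t)
    simp only [galAction]; linarith
  · intro σ hσ u hg hA s hs hσs
    have h1 := hc σ hσ u (hg.trans (by linarith)) hA.1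
    have h2 : c ≤ (∫ t in (0:ℝ)..1, D σ (trigLoop u t)) - τ := by
      rcases le_max_iff.1 h1 with h1 | h1
      · linarith
      · exact h1
    have cD : Continuous fun t => D σ (trigLoop u t) := (h.continuous_D' σ).comp (continuous_trigLoop u)
    have cD' : Continuous fun t => s * (D σ (trigLoop u t) - c) :=
      continuous_const.mul (cD.sub continuous_const)
    have h3 := intervalIntegral.integral_mono_on zero_le_one
      (((intH σ u).add (cD'.intervalIntegrable 0 1))) (intH (σ - s) u)
      fun t _ => hdrop σ hσ s hs hσs (trigLoop u t)
    have h4 : ∫ t in (0:ℝ)..1, (H σ (trigLoop u t) + s * (D σ (trigLoop u t) - c)) =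
        (∫ t in (0:ℝ)..1, H σ (trigLoop u t)) + s * ((∫ t in (0:ℝ)..1, D σ (trigLoop u t)) - c) := by
      rw [intervalIntegral.integral_add (intH σ u) (cD'.intervalIntegrable _ _),
        intervalIntegral.integral_const_mul, intervalIntegral.integral_sub
        (cD.intervalIntegrable _ _) (by simp)]
      simp
    have h5 : s * τ ≤ s * ((∫ t in (0:ℝ)..1, D σ (trigLoop u t)) - c) :=
      mul_le_mul_of_nonneg_left (by linarith) hs.1
    have h6 := h4.symm.le.trans h3
    simp only [galAction]; linarith
  · intro u hu σ hσ
    exact galAction_linkMap_le_zero (h.continuous_H' σ) hc₁.le (min_le_left _ _) (min_le_right _ _)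
      (h.quadForm_sub_le σ hσ) (h.nonneg σ hσ) hLC hu
  · intro u _
    refine (galAction_linkMap_le (h.continuous_H' σ₁) (min_le_left _ _) (min_le_right _ _)
      (h.quadForm_sub_le σ₁ hσ₁) u).trans ?_
    have : 0 ≤ c₁ * ∑ k, ‖linkMap u k‖ ^ 2 :=
      mul_nonneg hc₁.le (Finset.sum_nonneg fun _ _ => by positivity)
    linarith
  · intro f hf hfb
    obtain ⟨u, hu, hneg, hzero, hpos⟩ := exists_link hn1 (by linarith) p (by simp only [L]; linarith)
      hα0.le hLα f hf hfb
    refine ⟨u, hu, ?_⟩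
    rw [← hαβ]
    exact le_galAction_of_link (h.continuous_H' σ₀) (by linarith) hCp hneg hzero hpos

end IsHamiltonianFamily

/-! ### Flows of bounded time-dependent vector fields on the unit time interval -/

theorem hasDerivWithinAt_Ici_of_Icc {E : Type*} [NormedAddCommGroup E] [NormedSpace ℝ E]
    {w : ℝ → E} {w' : E} {t : ℝ} (ht : t ∈ Ico (0:ℝ) 1)
    (h : HasDerivWithinAt w w' (Icc 0 1) t) : HasDerivWithinAt w w' (Ici t) t :=
  h.mono_of_mem_nhdsWithin (Icc_mem_nhdsGE_of_mem ht)

theorem norm_le_mul_exp_of_hasDerivWithinAt {E : Type*} [NormedAddCommGroup E] [NormedSpace ℝ E]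
    {w w' : ℝ → E} {K ε : ℝ} (hK : 0 < K) (hε : 0 ≤ ε)
    (hw : ∀ t ∈ Icc (0:ℝ) 1, HasDerivWithinAt w (w' t) (Icc 0 1) t)
    (hb : ∀ t ∈ Icc (0:ℝ) 1, ‖w' t‖ ≤ K * ‖w t‖ + ε) :
    ∀ t ∈ Icc (0:ℝ) 1, ‖w t‖ ≤ (‖w 0‖ + ε) * exp K := by
  intro t ht
  have h1 := norm_le_gronwallBound_of_norm_deriv_right_le (f := w) (f' := w') (δ := ‖w 0‖)
    (K := K) (ε := ε) (a := 0) (b := 1) (fun t ht => (hw t ht).continuousWithinAt)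
    (fun t ht => hasDerivWithinAt_Ici_of_Icc ht (hw t (Ico_subset_Icc_self ht))) le_rfl
    (fun t ht => hb t (Ico_subset_Icc_self ht)) t ht
  rw [gronwallBound_of_K_ne_0 hK.ne', sub_zero] at h1
  have h2 : exp (K * t) ≤ exp K := exp_le_exp.2 (by nlinarith [ht.1, ht.2])
  have h3 : exp (K * t) - 1 ≤ K * exp K := by
    have h4 : 1 - K * t ≤ exp (-(K * t)) := by linarith [add_one_le_exp (-(K * t))]
    have h5 : exp (K * t) * exp (-(K * t)) = 1 := by rw [← exp_add]; simp
    have h6 : exp (K * t) - 1 ≤ K * t * exp (K * t) := by nlinarith [exp_pos (K * t)]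
    have h7 : K * t * exp (K * t) ≤ K * exp K :=
      mul_le_mul (by nlinarith [ht.1, ht.2]) h2 (exp_pos _).le hK.le
    linarith
  calc ‖w t‖ ≤ ‖w 0‖ * exp (K * t) + ε / K * (exp (K * t) - 1) := h1
    _ ≤ ‖w 0‖ * exp K + ε / K * (K * exp K) := by gcongr
    _ = _ := by field_simp

theorem exists_solution_Icc {E : Type*} [NormedAddCommGroup E] [NormedSpace ℝ E] [CompleteSpace E]
    {f : ℝ → E → E} {K L : NNReal} (hc : ∀ x, ContinuousOn (fun t => f t x) (Icc 0 1))
    (hb : ∀ t ∈ Icc (0:ℝ) 1, ∀ x, ‖f t x‖ ≤ L) (hl : ∀ t ∈ Icc (0:ℝ) 1, LipschitzWith K (f t))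
    {t₀ : ℝ} (ht₀ : t₀ ∈ Icc (0:ℝ) 1) (x₀ : E) :
    ∃ y : ℝ → E, y t₀ = x₀ ∧ ∀ t ∈ Icc (0:ℝ) 1, HasDerivWithinAt y (f t (y t)) (Icc 0 1) t := by
  have h : IsPicardLindelof f (⟨t₀, ht₀⟩ : Icc (0:ℝ) 1) x₀ L 0 L K :=
    { lipschitzOnWith := fun t ht => (hl t ht).lipschitzOnWith
      continuousOn := fun x _ => hc x
      norm_le := fun t ht x _ => hb t ht x
      mul_max_le := by
        have : max (1 - t₀) (t₀ - 0) ≤ 1 := max_le (by linarith [ht₀.1]) (by linarith [ht₀.2])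
        have := mul_le_mul_of_nonneg_left this L.2
        simpa using this }
  exact h.exists_eq_forall_mem_Icc_hasDerivWithinAt₀

theorem exists_linear_solution_Icc {F : Type*} [NormedAddCommGroup F] [NormedSpace ℝ F]
    [FiniteDimensional ℝ F] {A : ℝ → F →L[ℝ] F} {K : ℝ} (hA : ContinuousOn A (Icc 0 1))
    (hK : ∀ t ∈ Icc (0:ℝ) 1, ‖A t‖ ≤ K) (hK0 : 0 < K) (w₀ : F) :
    ∃ w : ℝ → F, w 0 = w₀ ∧ ∀ t ∈ Icc (0:ℝ) 1, HasDerivWithinAt w (A t (w t)) (Icc 0 1) t := by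
  have hρ : 0 < ‖w₀‖ * exp K + 1 := by positivity
  let χ : ContDiffBump (0 : F) := ⟨‖w₀‖ * exp K + 1, ‖w₀‖ * exp K + 2, hρ, by linarith⟩
  have hcd : ContDiff ℝ 1 fun w => χ w • w := χ.contDiff.smul contDiff_id
  have hsupp : HasCompactSupport fun w => χ w • w := χ.hasCompactSupport.smul_right
  obtain ⟨C, hC⟩ := hcd.lipschitzWith_of_hasCompactSupport hsupp one_ne_zero
  obtain ⟨b, hb⟩ := hsupp.exists_bound_of_continuous hcd.continuous
  have hb0 : 0 ≤ b := (norm_nonneg _).trans (hb 0)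
  obtain ⟨w, hw0, hw⟩ := exists_solution_Icc (f := fun t w => A t (χ w • w))
    (K := ⟨K, hK0.le⟩ * C) (L := ⟨K * b, by positivity⟩)
    (fun x => hA.clm_apply continuousOn_const)
    (fun t ht x => ((A t).le_opNorm _).trans
      (mul_le_mul (hK t ht) (hb x) (norm_nonneg _) hK0.le))
    (fun t ht => by
      have h1 : LipschitzWith ⟨K, hK0.le⟩ (A t) := (A t).lipschitz.weaken (hK t ht)
      exact h1.comp hC) (left_mem_Icc.2 zero_le_one) w₀
  have hle : ∀ t ∈ Icc (0:ℝ) 1, ‖w t‖ ≤ (‖w 0‖ + 0) * exp K :=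
    norm_le_mul_exp_of_hasDerivWithinAt hK0 le_rfl hw fun t ht => by
      rw [add_zero]
      refine ((A t).le_opNorm _).trans (mul_le_mul (hK t ht) ?_ (norm_nonneg _) hK0.le)
      rw [norm_smul, Real.norm_of_nonneg χ.nonneg]
      exact mul_le_of_le_one_left (norm_nonneg _) χ.le_one
  refine ⟨w, hw0, fun t ht => ?_⟩
  have h1 : χ (w t) = 1 := χ.one_of_mem_closedBall (by
    rw [mem_closedBall_zero_iff]
    have := hle t ht
    rw [hw0, add_zero] at this
    change _ ≤ ‖w₀‖ * exp K + 1
    linarith)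
  simpa [h1] using hw t ht

section Flow

variable {E : Type*} [NormedAddCommGroup E] [NormedSpace ℝ E]

/-- A time-dependent vector field `V` on `[0,1] × E` with spatial derivative `V'`, bounded together
with its derivative, whose derivative is Lipschitz in space. -/
structure IsBoundedField (V : ℝ → E → E) (V' : ℝ → E → E →L[ℝ] E) (B K C : ℝ) : Prop where
  continuous : Continuous fun p : ℝ × E => V p.1 p.2
  continuous_deriv : Continuous fun p : ℝ × E => V' p.1 p.2
  hasFDerivAt : ∀ t ∈ Icc (0:ℝ) 1, ∀ x, HasFDerivAt (V t) (V' t x) x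
  pos : 0 < K
  norm_le : ∀ t ∈ Icc (0:ℝ) 1, ∀ x, ‖V t x‖ ≤ B
  norm_deriv_le : ∀ t ∈ Icc (0:ℝ) 1, ∀ x, ‖V' t x‖ ≤ K
  norm_deriv_sub_le : ∀ t ∈ Icc (0:ℝ) 1, ∀ x z, ‖V' t x - V' t z‖ ≤ C * ‖x - z‖

/-- Trajectories `y p` starting at `p` of the field `V`, with solutions `W p` of the linearised
equation along them. -/
structure IsFlowOf (V : ℝ → E → E) (V' : ℝ → E → E →L[ℝ] E) (y : E → ℝ → E)
    (W : E → ℝ → E →L[ℝ] E) : Prop where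
  zero : ∀ p, y p 0 = p
  hasDerivWithinAt : ∀ p, ∀ t ∈ Icc (0:ℝ) 1, HasDerivWithinAt (y p) (V t (y p t)) (Icc 0 1) t
  linear_zero : ∀ p, W p 0 = ContinuousLinearMap.id ℝ E
  linear_hasDerivWithinAt : ∀ p, ∀ t ∈ Icc (0:ℝ) 1,
    HasDerivWithinAt (W p) ((V' t (y p t)).comp (W p t)) (Icc 0 1) t

namespace IsBoundedField

variable {V : ℝ → E → E} {V' : ℝ → E → E →L[ℝ] E} {B K C : ℝ}

theorem norm_sub_le (h : IsBoundedField V V' B K C) {t : ℝ} (ht : t ∈ Icc (0:ℝ) 1) (x z : E) :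
    ‖V t x - V t z‖ ≤ K * ‖x - z‖ :=
  convex_univ.norm_image_sub_le_of_norm_hasFDerivWithin_le
    (fun w _ => (h.hasFDerivAt t ht w).hasFDerivWithinAt) (fun w _ => h.norm_deriv_le t ht w)
    (mem_univ z) (mem_univ x)

theorem norm_sub_sub_le (h : IsBoundedField V V' B K C) (hC : 0 ≤ C) {t : ℝ}
    (ht : t ∈ Icc (0:ℝ) 1) (x z : E) :
    ‖V t x - V t z - V' t z (x - z)‖ ≤ C * ‖x - z‖ ^ 2 := by
  have h1 := (convex_segment z x).norm_image_sub_le_of_norm_hasFDerivWithin_le'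
    (f := V t) (f' := V' t) (φ := V' t z) (C := C * ‖x - z‖)
    (fun w _ => (h.hasFDerivAt t ht w).hasFDerivWithinAt)
    (fun w hw => (h.norm_deriv_sub_le t ht w z).trans (by
      have : ‖w - z‖ ≤ ‖x - z‖ := by
        rw [← dist_eq_norm, ← dist_eq_norm, dist_comm w, dist_comm x]
        have := dist_add_dist_of_mem_segment hw
        linarith [dist_nonneg (x := w) (y := x)]
      gcongr))
    (left_mem_segment ℝ z x) (right_mem_segment ℝ z x)
  rw [sq, ← mul_assoc]
  exact h1

theorem exists_isFlowOf (h : IsBoundedField V V' B K C) [FiniteDimensional ℝ E] :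
    ∃ y W, IsFlowOf V V' y W := by
  have hB : 0 ≤ B := (norm_nonneg _).trans (h.norm_le 0 (left_mem_Icc.2 zero_le_one) 0)
  have hy : ∀ p, ∃ y : ℝ → E, y 0 = p ∧
      ∀ t ∈ Icc (0:ℝ) 1, HasDerivWithinAt y (V t (y t)) (Icc 0 1) t := fun p =>
    exists_solution_Icc (K := ⟨K, h.pos.le⟩) (L := ⟨B, hB⟩)
      (fun x => (h.continuous.comp (Continuous.prodMk_left x)).continuousOn) h.norm_le
      (fun t ht => LipschitzWith.of_dist_le_mul fun x z => by
        rw [dist_eq_norm, dist_eq_norm]; exact h.norm_sub_le ht x z) (left_mem_Icc.2 zero_le_one) p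
  choose y hy0 hy using hy
  have hW : ∀ p, ∃ w : ℝ → E →L[ℝ] E, w 0 = ContinuousLinearMap.id ℝ E ∧ ∀ t ∈ Icc (0:ℝ) 1,
      HasDerivWithinAt w (ContinuousLinearMap.compL ℝ E E E (V' t (y p t)) (w t)) (Icc 0 1) t := by
    intro p
    refine exists_linear_solution_Icc (A := fun t => ContinuousLinearMap.compL ℝ E E E (V' t (y p t)))
      (K := K) ?_ ?_ h.pos _
    · refine (ContinuousLinearMap.continuous _).comp_continuousOn ?_
      exact h.continuous_deriv.comp_continuousOn
        (continuousOn_id.prodMk fun t ht => (hy p t ht).continuousWithinAt)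
    · intro t ht
      refine ContinuousLinearMap.opNorm_le_bound _ h.pos.le fun w => ?_
      refine (ContinuousLinearMap.opNorm_comp_le _ _).trans ?_
      gcongr
      exact h.norm_deriv_le t ht _
  choose W hW0 hW using hW
  exact ⟨y, W, hy0, hy, hW0, hW⟩

theorem exists_solution (h : IsBoundedField V V' B K C) [FiniteDimensional ℝ E] {t₀ : ℝ}
    (ht₀ : t₀ ∈ Icc (0:ℝ) 1) (q : E) : ∃ y : ℝ → E, y t₀ = q ∧
      ∀ t ∈ Icc (0:ℝ) 1, HasDerivWithinAt y (V t (y t)) (Icc 0 1) t := by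
  have hB : 0 ≤ B := (norm_nonneg _).trans (h.norm_le 0 (left_mem_Icc.2 zero_le_one) 0)
  exact exists_solution_Icc (K := ⟨K, h.pos.le⟩) (L := ⟨B, hB⟩)
      (fun x => (h.continuous.comp (Continuous.prodMk_left x)).continuousOn) h.norm_le
      (fun t ht => LipschitzWith.of_dist_le_mul fun x z => by
        rw [dist_eq_norm, dist_eq_norm]; exact h.norm_sub_le ht x z) ht₀ q

theorem norm_sub_le_of_solution (h : IsBoundedField V V' B K C) {y z : ℝ → E}
    (hy : ∀ t ∈ Icc (0:ℝ) 1, HasDerivWithinAt y (V t (y t)) (Icc 0 1) t)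
    (hz : ∀ t ∈ Icc (0:ℝ) 1, HasDerivWithinAt z (V t (z t)) (Icc 0 1) t) {t : ℝ}
    (ht : t ∈ Icc (0:ℝ) 1) : ‖y t - z t‖ ≤ ‖y 0 - z 0‖ * exp K := by
  have := norm_le_mul_exp_of_hasDerivWithinAt h.pos le_rfl
    (fun t ht => (hy t ht).sub (hz t ht)) (fun t ht => by
      simpa using h.norm_sub_le ht (y t) (z t)) t ht
  simpa using this

end IsBoundedField

namespace IsFlowOf

variable {V : ℝ → E → E} {V' : ℝ → E → E →L[ℝ] E} {B K C : ℝ} {y : E → ℝ → E}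
  {W : E → ℝ → E →L[ℝ] E}

theorem eq_of_solution (hf : IsFlowOf V V' y W) (h : IsBoundedField V V' B K C) {z : ℝ → E}
    (hz : ∀ t ∈ Icc (0:ℝ) 1, HasDerivWithinAt z (V t (z t)) (Icc 0 1) t) {t : ℝ}
    (ht : t ∈ Icc (0:ℝ) 1) : y (z 0) t = z t := by
  have := h.norm_sub_le_of_solution (hf.hasDerivWithinAt (z 0)) hz ht
  rw [hf.zero, sub_self, norm_zero, zero_mul] at this
  exact sub_eq_zero.1 (norm_le_zero_iff.1 this)

theorem surjective (hf : IsFlowOf V V' y W) (h : IsBoundedField V V' B K C)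
    [FiniteDimensional ℝ E] : Function.Surjective fun p => y p 1 := by
  intro q
  obtain ⟨z, hz1, hz⟩ := h.exists_solution (right_mem_Icc.2 zero_le_one) q
  exact ⟨z 0, (hf.eq_of_solution h hz (right_mem_Icc.2 zero_le_one)).trans hz1⟩

theorem norm_sub_le (hf : IsFlowOf V V' y W) (h : IsBoundedField V V' B K C) (p : E) {t : ℝ}
    (ht : t ∈ Icc (0:ℝ) 1) : ‖y p t - p‖ ≤ B := by
  have := (convex_Icc (0:ℝ) 1).norm_image_sub_le_of_norm_hasDerivWithin_le
    (hf.hasDerivWithinAt p) (fun t ht => h.norm_le t ht _) (left_mem_Icc.2 zero_le_one) ht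
  rw [hf.zero] at this
  have hB : 0 ≤ B := (norm_nonneg _).trans (h.norm_le 0 (left_mem_Icc.2 zero_le_one) 0)
  refine this.trans (mul_le_of_le_one_right hB ?_)
  rw [sub_zero, Real.norm_of_nonneg ht.1]
  exact ht.2

theorem norm_linear_le (hf : IsFlowOf V V' y W) (h : IsBoundedField V V' B K C) (p : E) {t : ℝ}
    (ht : t ∈ Icc (0:ℝ) 1) : ‖W p t‖ ≤ exp K := by
  have := norm_le_mul_exp_of_hasDerivWithinAt h.pos le_rfl
    (hf.linear_hasDerivWithinAt p) (fun t ht => by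
      rw [add_zero]
      refine (ContinuousLinearMap.opNorm_comp_le _ _).trans ?_
      gcongr
      exact h.norm_deriv_le t ht _) t ht
  rw [hf.linear_zero, add_zero] at this
  refine this.trans (mul_le_of_le_one_left (exp_pos _).le ContinuousLinearMap.norm_id_le)

theorem norm_flow_sub_le (hf : IsFlowOf V V' y W) (h : IsBoundedField V V' B K C) (p q : E) {t : ℝ}
    (ht : t ∈ Icc (0:ℝ) 1) : ‖y q t - y p t‖ ≤ ‖q - p‖ * exp K := by
  have := h.norm_sub_le_of_solution (hf.hasDerivWithinAt q) (hf.hasDerivWithinAt p) ht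
  rwa [hf.zero, hf.zero] at this

theorem hasFDerivAt (hf : IsFlowOf V V' y W) (h : IsBoundedField V V' B K C) (hC : 0 ≤ C) (p : E)
    {t : ℝ} (ht : t ∈ Icc (0:ℝ) 1) : HasFDerivAt (fun p => y p t) (W p t) p := by
  have key : ∀ q, ‖y q t - y p t - W p t (q - p)‖ ≤
      C * (‖q - p‖ * exp K) ^ 2 * exp K := by
    intro q
    have := norm_le_mul_exp_of_hasDerivWithinAt (ε := C * (‖q - p‖ * exp K) ^ 2) h.pos
      (by positivity)
      (fun t ht => ((hf.hasDerivWithinAt q t ht).sub (hf.hasDerivWithinAt p t ht)).sub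
        ((hf.linear_hasDerivWithinAt p t ht).clm_apply (hasDerivWithinAt_const t _ (q - p))))
      (fun t ht => by
        have e : V t (y q t) - V t (y p t) -
            (((V' t (y p t)).comp (W p t)) (q - p) + W p t 0) =
            (V t (y q t) - V t (y p t) - V' t (y p t) (y q t - y p t)) +
              V' t (y p t) (y q t - y p t - W p t (q - p)) := by
          simp only [map_sub, map_zero, ContinuousLinearMap.comp_apply]; abel
        change ‖V t (y q t) - V t (y p t) -
            (((V' t (y p t)).comp (W p t)) (q - p) + W p t 0)‖ ≤
            K * ‖y q t - y p t - W p t (q - p)‖ + _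
        rw [e, add_comm (K * _)]
        refine (norm_add_le _ _).trans (add_le_add ?_ ?_)
        · refine (h.norm_sub_sub_le hC ht _ _).trans ?_
          gcongr
          exact hf.norm_flow_sub_le h p q ht
        · refine (ContinuousLinearMap.le_opNorm _ _).trans ?_
          gcongr
          exact h.norm_deriv_le t ht _) t ht
    simpa [hf.zero, hf.linear_zero] using this
  rw [hasFDerivAt_iff_isLittleO]
  have h1 : (fun q => y q t - y p t - W p t (q - p)) =O[𝓝 p] fun q => ‖q - p‖ ^ 2 := by
    refine Asymptotics.IsBigO.of_bound (C * exp K ^ 2 * exp K) (Eventually.of_forall fun q => ?_)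
    refine (key q).trans (le_of_eq ?_)
    rw [Real.norm_of_nonneg (by positivity)]
    ring
  refine h1.trans_isLittleO ?_
  rw [Asymptotics.isLittleO_iff]
  intro c hc
  filter_upwards [Metric.ball_mem_nhds p hc] with q hq
  rw [mem_ball, dist_eq_norm] at hq
  rw [Real.norm_of_nonneg (by positivity), sq]
  gcongr

theorem continuous_linear (hf : IsFlowOf V V' y W) (h : IsBoundedField V V' B K C) (hC : 0 ≤ C)
    {t : ℝ} (ht : t ∈ Icc (0:ℝ) 1) : Continuous fun p => W p t := by
  have key : ∀ p q, ‖W q t - W p t‖ ≤ C * exp K * exp K * exp K * ‖q - p‖ := by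
    intro p q
    have := norm_le_mul_exp_of_hasDerivWithinAt (ε := C * (‖q - p‖ * exp K) * exp K) h.pos
      (by positivity)
      (fun t ht => (hf.linear_hasDerivWithinAt q t ht).sub (hf.linear_hasDerivWithinAt p t ht))
      (fun t ht => by
        have e : (V' t (y q t)).comp (W q t) - (V' t (y p t)).comp (W p t) =
            (V' t (y q t)).comp (W q t - W p t) + (V' t (y q t) - V' t (y p t)).comp (W p t) := by
          ext v; simp
        rw [e]
        refine (norm_add_le _ _).trans (add_le_add ?_ ?_)
        · refine (ContinuousLinearMap.opNorm_comp_le _ _).trans ?_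
          gcongr
          · exact h.pos.le
          · exact h.norm_deriv_le t ht _
          · exact le_rfl
        · refine (ContinuousLinearMap.opNorm_comp_le _ _).trans ?_
          gcongr
          · exact (h.norm_deriv_sub_le t ht _ _).trans
              (mul_le_mul_of_nonneg_left (hf.norm_flow_sub_le h p q ht) hC)
          · exact hf.norm_linear_le h p ht) t ht
    have e2 : ‖(W q - W p) 0‖ = 0 := by simp [hf.linear_zero]
    rw [e2] at this
    exact this.trans (le_of_eq (by ring))
  have : LipschitzWith ⟨C * exp K * exp K * exp K, by positivity⟩ fun p => W p t :=
    LipschitzWith.of_dist_le_mul fun q p => by rw [dist_eq_norm, dist_eq_norm]; exact key p q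
  exact this.continuous

end IsFlowOf

end Flow

/-! ### Moser's deformation argument -/

/-- The standard symplectic form as a continuous bilinear map. -/
def omegaL : R4 →L[ℝ] R4 →L[ℝ] ℝ := (innerSL ℝ).comp J4

theorem omegaL_apply (u v : R4) : omegaL u v = omegaSt u v := inner_J4_left u v

theorem omegaSt_swap (u v : R4) : omegaSt v u = -omegaSt u v := by
  unfold omegaSt; ring

theorem omegaSt_add_left (u u' v : R4) : omegaSt (u + u') v = omegaSt u v + omegaSt u' v := by
  simp [← omegaL_apply]

theorem omegaSt_smul_left (c : ℝ) (u v : R4) : omegaSt (c • u) v = c * omegaSt u v := by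
  simp [← omegaL_apply]

theorem omegaSt_add_right (u v v' : R4) : omegaSt u (v + v') = omegaSt u v + omegaSt u v' := by
  simp [← omegaL_apply]

theorem omegaSt_smul_right (c : ℝ) (u v : R4) : omegaSt u (c • v) = c * omegaSt u v := by
  simp [← omegaL_apply]

theorem HasDerivWithinAt.omegaSt {u v : ℝ → R4} {u' v' : R4} {s : Set ℝ} {t : ℝ}
    (hu : HasDerivWithinAt u u' s t) (hv : HasDerivWithinAt v v' s t) :
    HasDerivWithinAt (fun t => omegaSt (u t) (v t)) (omegaSt u' (v t) + omegaSt (u t) v') s t := by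
  simp only [← omegaL_apply]
  exact ((omegaL.hasFDerivAt.comp_hasDerivWithinAt t hu).clm_apply hv)

theorem HasFDerivAt.omegaSt {u v : R4 → R4} {u' v' : R4 →L[ℝ] R4} {x : R4}
    (hu : HasFDerivAt u u' x) (hv : HasFDerivAt v v' x) :
    ∃ L : R4 →L[ℝ] ℝ, HasFDerivAt (fun x => omegaSt (u x) (v x)) L x ∧
      ∀ w, L w = omegaSt (u' w) (v x) + omegaSt (u x) (v' w) := by
  simp only [← omegaL_apply]
  refine ⟨_, ((omegaL.hasFDerivAt.comp x hu).clm_apply hv), fun w => ?_⟩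
  simp [add_comm]

/-- The bilinear form `ω + a dθ`, where `θ = ω(Θ, ·)`. -/
def perturbedForm (Θ : R4 → R4) (a : ℝ) (x u v : R4) : ℝ :=
  omegaSt u v + a * (omegaSt (fderiv ℝ Θ x u) v + omegaSt u (fderiv ℝ Θ x v))

theorem perturbedForm_flow_eq {Θ : R4 → R4} (hΘ : ContDiff ℝ ∞ Θ) {V : ℝ → R4 → R4}
    {A W : ℝ → R4 →L[ℝ] R4} {y : ℝ → R4} {a a' : ℝ → ℝ}
    (hy : ∀ t ∈ Icc (0:ℝ) 1, HasDerivWithinAt y (V t (y t)) (Icc 0 1) t)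
    (hW : ∀ t ∈ Icc (0:ℝ) 1, HasDerivWithinAt W ((A t).comp (W t)) (Icc 0 1) t)
    (ha : ∀ t, HasDerivAt a (a' t) t)
    (hA : ∀ t ∈ Icc (0:ℝ) 1, HasFDerivAt (V t) (A t) (y t))
    (hV : ∀ t ∈ Icc (0:ℝ) 1, ∀ᶠ x in 𝓝 (y t), ∀ v,
      perturbedForm Θ (a t) x (V t x) v = -a' t * omegaSt (Θ x) v) (u v : R4) :
    ∀ t ∈ Icc (0:ℝ) 1, perturbedForm Θ (a t) (y t) (W t u) (W t v) =
      perturbedForm Θ (a 0) (y 0) (W 0 u) (W 0 v) := by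
  have hD : ∀ x, HasFDerivAt (fderiv ℝ Θ) (fderiv ℝ (fderiv ℝ Θ) x) x := fun x =>
    (((hΘ.fderiv_right (m := 1) (by norm_cast)).differentiable one_ne_zero) x).hasFDerivAt
  have hΘ1 : ∀ x, HasFDerivAt Θ (fderiv ℝ Θ x) x := fun x =>
    ((hΘ.differentiable (by simp)) x).hasFDerivAt
  have hsymm : ∀ x u v, fderiv ℝ (fderiv ℝ Θ) x u v = fderiv ℝ (fderiv ℝ Θ) x v u := fun x u v =>
    (second_derivative_symmetric (f := Θ) (f' := fderiv ℝ Θ) hΘ1 (hD x) u v)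
  have hdiff : ∀ t ∈ Icc (0:ℝ) 1, ∀ w₁ w₂, omegaSt (A t w₁) w₂ + a t *
      (omegaSt (fderiv ℝ (fderiv ℝ Θ) (y t) w₁ (V t (y t)) + fderiv ℝ Θ (y t) (A t w₁)) w₂ +
        (omegaSt (A t w₁) (fderiv ℝ Θ (y t) w₂) +
          omegaSt (V t (y t)) (fderiv ℝ (fderiv ℝ Θ) (y t) w₁ w₂))) =
      -a' t * omegaSt (fderiv ℝ Θ (y t) w₁) w₂ := by
    intro t ht w₁ w₂
    obtain ⟨L₁, hL₁, e₁⟩ := (hA t ht).omegaSt (hasFDerivAt_const w₂ (y t))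
    obtain ⟨L₂, hL₂, e₂⟩ := ((hD (y t)).clm_apply (hA t ht)).omegaSt (hasFDerivAt_const w₂ (y t))
    obtain ⟨L₃, hL₃, e₃⟩ := (hA t ht).omegaSt
      ((hD (y t)).clm_apply (hasFDerivAt_const w₂ (y t)))
    obtain ⟨L₄, hL₄, e₄⟩ := (hΘ1 (y t)).omegaSt (hasFDerivAt_const w₂ (y t))
    have h1 := hL₁.add ((hL₂.add hL₃).const_mul (a t))
    have h2 := hL₄.const_mul (-a' t)
    have h3 := h1.congr_of_eventuallyEq (f₁ := fun x => -a' t * omegaSt (Θ x) w₂) (by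
      filter_upwards [hV t ht] with x hx
      exact (hx w₂).symm)
    have h4 := congrArg (fun L : R4 →L[ℝ] ℝ => L w₁) (h3.unique h2)
    simp only [add_apply, smul_apply, smul_eq_mul,
      e₁, e₂, e₃, e₄, ContinuousLinearMap.comp_apply, ContinuousLinearMap.flip_apply,
      zero_apply, map_zero, zero_add, ← omegaL_apply, add_zero] at h4 ⊢
    rw [← h4, add_comm (fderiv ℝ (fderiv ℝ Θ) (y t) w₁ (V t (y t)))]
  have hder : ∀ t ∈ Icc (0:ℝ) 1, HasDerivWithinAt
      (fun t => perturbedForm Θ (a t) (y t) (W t u) (W t v)) 0 (Icc 0 1) t := by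
    intro t ht
    have hu := (hW t ht).clm_apply (hasDerivWithinAt_const t _ u)
    have hv := (hW t ht).clm_apply (hasDerivWithinAt_const t _ v)
    have hDt := (hD (y t)).comp_hasDerivWithinAt t (hy t ht)
    have h1 := (hu.omegaSt hv).add ((ha t).hasDerivWithinAt.mul
      (((hDt.clm_apply hu).omegaSt hv).add (hu.omegaSt (hDt.clm_apply hv))))
    refine h1.congr_deriv ?_
    have k1 := hdiff t ht (W t u) (W t v)
    have k2 := hdiff t ht (W t v) (W t u)
    simp only [Function.comp_apply, ContinuousLinearMap.comp_apply, map_zero, add_zero,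
      Pi.add_apply] at k1 k2 ⊢
    rw [hsymm _ (V t (y t)) (W t u), hsymm _ (V t (y t)) (W t v)]
    rw [hsymm _ (W t v) (W t u)] at k2
    simp only [omegaSt_add_left, omegaSt_add_right] at k1 k2 ⊢
    rw [omegaSt_swap (W t u) (A t (W t v)), omegaSt_swap (W t u),
      omegaSt_swap (fderiv ℝ Θ (y t) (W t u)), omegaSt_swap (W t u) (fderiv ℝ Θ (y t) (W t v)),
      omegaSt_swap (W t u)] at k2
    linear_combination k1 - k2
  exact constant_of_has_deriv_right_zero (fun t ht => (hder t ht).continuousWithinAt)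
    fun t ht => hasDerivWithinAt_Ici_of_Icc ht (hder t (Ico_subset_Icc_self ht))

theorem exists_norm_le_of_continuous_of_eq_zero {E F : Type*} [NormedAddCommGroup E] [ProperSpace E]
    [NormedAddCommGroup F] {f : ℝ × E → F} (hf : Continuous f) {ρ : ℝ}
    (h0 : ∀ p : ℝ × E, ρ ≤ ‖p.2‖ → f p = 0) :
    ∃ b, 0 ≤ b ∧ ∀ t ∈ Icc (0:ℝ) 1, ∀ x, ‖f (t, x)‖ ≤ b := by
  obtain ⟨b, hb⟩ := ((isCompact_Icc (a := (0:ℝ)) (b := 1)).prod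
    (isCompact_closedBall (0 : E) ρ)).exists_bound_of_continuousOn hf.continuousOn
  refine ⟨max b 0, le_max_right _ _, fun t ht x => ?_⟩
  by_cases hx : ρ ≤ ‖x‖
  · rw [h0 _ hx, norm_zero]; exact le_max_right _ _
  · exact (hb (t, x) ⟨ht, by simpa using (not_le.1 hx).le⟩).trans (le_max_left _ _)

theorem fderiv_eq_zero_of_eq_zero {E F : Type*} [NormedAddCommGroup E] [NormedSpace ℝ E]
    [NormedAddCommGroup F] [NormedSpace ℝ F] {f : ℝ × E → F} {ρ : ℝ}
    (h0 : ∀ p : ℝ × E, ρ < ‖p.2‖ → f p = 0) (p : ℝ × E) (hp : ρ < ‖p.2‖) : fderiv ℝ f p = 0 := by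
  have : f =ᶠ[𝓝 p] fun _ => 0 := by
    filter_upwards [(isOpen_lt continuous_const (by fun_prop : Continuous fun p : ℝ × E => ‖p.2‖)).mem_nhds
      hp] with q hq using h0 q hq
  rw [this.fderiv_eq, fderiv_fun_const]; rfl

theorem exists_isBoundedField {V : ℝ × R4 → R4} (hV : ContDiff ℝ ∞ V) {ρ B : ℝ}
    (h0 : ∀ p : ℝ × R4, ρ < ‖p.2‖ → V p = 0) (hB : ∀ t ∈ Icc (0:ℝ) 1, ∀ x, ‖V (t, x)‖ ≤ B) :
    ∃ K C, 0 ≤ C ∧ IsBoundedField (fun t x => V (t, x))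
      (fun t x => (fderiv ℝ V (t, x)).comp (ContinuousLinearMap.inr ℝ ℝ R4)) B K C := by
  set V' : ℝ × R4 → R4 →L[ℝ] R4 := fun p => (fderiv ℝ V p).comp (ContinuousLinearMap.inr ℝ ℝ R4)
    with hV'
  have hV's : ContDiff ℝ ∞ V' := (hV.fderiv_right (m := ∞) (by simp)).clm_comp contDiff_const
  have hV'0 : ∀ p : ℝ × R4, ρ < ‖p.2‖ → V' p = 0 := fun p hp => by
    simp [hV', fderiv_eq_zero_of_eq_zero h0 p hp]
  have hinr : ∀ t x, HasFDerivAt (fun x : R4 => (t, x)) (ContinuousLinearMap.inr ℝ ℝ R4) x :=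
    fun t x => hasFDerivAt_prodMk_right t x
  obtain ⟨k, hk0, hk⟩ := exists_norm_le_of_continuous_of_eq_zero (ρ := ρ + 1) hV's.continuous
    (fun p hp => hV'0 p (by linarith))
  obtain ⟨c, hc0, hc⟩ := exists_norm_le_of_continuous_of_eq_zero (ρ := ρ + 1)
    (f := fun p => (fderiv ℝ V' p).comp (ContinuousLinearMap.inr ℝ ℝ R4))
    ((hV's.continuous_fderiv (by simp)).clm_comp continuous_const)
    (fun p hp => by rw [fderiv_eq_zero_of_eq_zero hV'0 p (by linarith)]; simp)
  refine ⟨k + 1, c, hc0, hV.continuous, hV's.continuous, ?_, by linarith, hB, ?_, ?_⟩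
  · intro t _ x
    exact ((hV.differentiable (by simp)) (t, x)).hasFDerivAt.comp x (hinr t x)
  · exact fun t ht x => (hk t ht x).trans (by linarith)
  · intro t ht x z
    exact convex_univ.norm_image_sub_le_of_norm_hasFDerivWithin_le
      (f := fun x => V' (t, x))
      (fun w _ => (((hV's.differentiable (by simp)) (t, w)).hasFDerivAt.comp w
        (hinr t w)).hasFDerivWithinAt) (fun w _ => hc t ht w) (mem_univ z) (mem_univ x)

/-- The Hamiltonian vector field with `ω(X, ·) = dG`. -/
def hamField (G : R4 → ℝ) (x : R4) : R4 := -J4 ((InnerProductSpace.toDual ℝ R4).symm (fderiv ℝ G x))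

theorem omegaSt_hamField (G : R4 → ℝ) (x v : R4) : omegaSt (hamField G x) v = fderiv ℝ G x v := by
  rw [← inner_J4_left, hamField, map_neg, J4_J4, neg_neg, InnerProductSpace.toDual_symm_apply]

theorem contDiff_hamField {G : R4 → ℝ} (hG : ContDiff ℝ ∞ G) : ContDiff ℝ ∞ (hamField G) := by
  unfold hamField
  exact (J4.contDiff.comp ((InnerProductSpace.toDual ℝ R4).symm.contDiff.comp
    (hG.fderiv_right (m := ∞) (by simp)))).neg

theorem ContDiff.omegaSt {E : Type*} [NormedAddCommGroup E] [NormedSpace ℝ E] {u v : E → R4}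
    (hu : ContDiff ℝ ∞ u) (hv : ContDiff ℝ ∞ v) :
    ContDiff ℝ ∞ fun x => omegaSt (u x) (v x) := by
  simp only [← omegaL_apply]
  exact (omegaL.contDiff.comp hu).clm_apply hv

/-- A primitive `θ = ω(Θ, ·)` of `(G - 1) ω + dG ∧ λ`, with `λ = ω(Y, ·)`, supported over a disc. -/
structure IsStretching (r R : ℝ) (G : R4 → ℝ) (Y Θ : R4 → R4) : Prop where
  contDiff_fun : ContDiff ℝ ∞ G
  contDiff_field : ContDiff ℝ ∞ Y
  contDiff_primitive : ContDiff ℝ ∞ Θ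
  pos : ∀ x, 0 < G x
  eq_one : ∀ x, R ≤ ‖x‖ → G x = 1
  eq_one_of_le : ∀ x : R4, r ^ 2 ≤ x 0 ^ 2 + x 1 ^ 2 → G x = 1
  nonneg : ∀ x, 0 ≤ fderiv ℝ G x (Y x)
  primitive_eq_zero : ∀ x : R4, r ^ 2 ≤ x 0 ^ 2 + x 1 ^ 2 → Θ x = 0
  bounded : ∃ b, ∀ x, ‖Θ x‖ ≤ b
  primitive : ∀ x u v, omegaSt (fderiv ℝ Θ x u) v + omegaSt u (fderiv ℝ Θ x v) =
    (G x - 1) * omegaSt u v + (fderiv ℝ G x u * omegaSt (Y x) v - fderiv ℝ G x v * omegaSt (Y x) u)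

/-- The Moser field of the path of forms `ω + a dθ`, `a = (1 - cos πt)/2`. -/
def moserField (G : R4 → ℝ) (Y Θ : R4 → R4) (p : ℝ × R4) : R4 :=
  let a := (1 - cos (π * p.1)) / 2
  let D := 1 + a * (G p.2 - 1) + a * fderiv ℝ G p.2 (Y p.2)
  (sin (π * p.1) * π / 2) • (1 + a * (G p.2 - 1))⁻¹ •
    (-Θ p.2 + (a * fderiv ℝ G p.2 (Θ p.2) / D) • Y p.2 -
      (a * omegaSt (Y p.2) (Θ p.2) / D) • hamField G p.2)

namespace IsStretching

variable {r R : ℝ} {G : R4 → ℝ} {Y Θ : R4 → R4}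

theorem pos_combination (h : IsStretching r R G Y Θ) (t : ℝ) (x : R4) :
    0 < 1 + (1 - cos t) / 2 * (G x - 1) := by
  have h1 := neg_one_le_cos t
  have h2 := cos_le_one t
  have h3 := h.pos x
  rcases eq_or_lt_of_le h1 with h1 | h1
  · rw [← h1]; linarith
  · nlinarith

theorem pos_denom (h : IsStretching r R G Y Θ) (t : ℝ) (x : R4) :
    0 < 1 + (1 - cos t) / 2 * (G x - 1) + (1 - cos t) / 2 * fderiv ℝ G x (Y x) := by
  have h2 := cos_le_one t
  have h3 := h.pos_combination t x
  have := mul_nonneg (by linarith : 0 ≤ (1 - cos t) / 2) (h.nonneg x)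
  linarith

theorem contDiff_moserField (h : IsStretching r R G Y Θ) :
    ContDiff ℝ ∞ (moserField G Y Θ) := by
  have hcos : ContDiff ℝ ∞ fun p : ℝ × R4 => (1 - cos (π * p.1)) / 2 := by fun_prop
  have hsin : ContDiff ℝ ∞ fun p : ℝ × R4 => sin (π * p.1) * π / 2 := by fun_prop
  have hG : ContDiff ℝ ∞ fun p : ℝ × R4 => G p.2 := h.contDiff_fun.comp contDiff_snd
  have hY : ContDiff ℝ ∞ fun p : ℝ × R4 => Y p.2 := h.contDiff_field.comp contDiff_snd
  have hΘ : ContDiff ℝ ∞ fun p : ℝ × R4 => Θ p.2 := h.contDiff_primitive.comp contDiff_snd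
  have hX : ContDiff ℝ ∞ fun p : ℝ × R4 => hamField G p.2 :=
    (contDiff_hamField h.contDiff_fun).comp contDiff_snd
  have hdG : ContDiff ℝ ∞ fun p : ℝ × R4 => fderiv ℝ G p.2 :=
    (h.contDiff_fun.fderiv_right (m := ∞) (by simp)).comp contDiff_snd
  have hGa := (contDiff_const (c := (1:ℝ))).add (hcos.mul (hG.sub (contDiff_const (c := (1:ℝ)))))
  have hD := hGa.add (hcos.mul (hdG.clm_apply hY))
  unfold moserField
  exact hsin.smul ((hGa.inv fun p => (h.pos_combination _ _).ne').smul
    ((hΘ.neg.add (((hcos.mul (hdG.clm_apply hΘ)).div hD fun p => (h.pos_denom _ _).ne').smul hY)).sub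
      (((hcos.mul (hY.omegaSt hΘ)).div hD fun p => (h.pos_denom _ _).ne').smul hX)))

theorem perturbedForm_eq (h : IsStretching r R G Y Θ) (a : ℝ) (x u v : R4) :
    perturbedForm Θ a x u v = (1 + a * (G x - 1)) * omegaSt u v +
      a * (fderiv ℝ G x u * omegaSt (Y x) v - fderiv ℝ G x v * omegaSt (Y x) u) := by
  rw [perturbedForm, h.primitive]; ring

theorem perturbedForm_moserField (h : IsStretching r R G Y Θ) (t : ℝ) (x v : R4) :
    perturbedForm Θ ((1 - cos (π * t)) / 2) x (moserField G Y Θ (t, x)) v =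
      -(sin (π * t) * π / 2) * omegaSt (Θ x) v := by
  have h1 := h.pos_combination (π * t) x
  have h2 := h.pos_denom (π * t) x
  rw [h.perturbedForm_eq]
  simp only [moserField]
  set a := (1 - cos (π * t)) / 2
  set g := 1 + a * (G x - 1)
  set d := fderiv ℝ G x (Y x) with hd
  set X := hamField G x
  have e1 : fderiv ℝ G x X = 0 := by
    rw [← omegaSt_hamField]; unfold omegaSt; ring
  have e2 : omegaSt (Y x) X = -d := by rw [omegaSt_swap, omegaSt_hamField]
  have e3 : omegaSt X v = fderiv ℝ G x v := omegaSt_hamField _ _ _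
  have e4 : omegaSt (Y x) (Y x) = 0 := by unfold omegaSt; ring
  simp only [sub_eq_add_neg, ← neg_smul, map_add, map_neg, map_smul, omegaSt_add_left,
    omegaSt_add_right, omegaSt_smul_left, omegaSt_smul_right, e1, e2, e3, e4, ← hd, smul_eq_mul,
    mul_zero, add_zero]
  rw [← neg_one_smul ℝ (Θ x), omegaSt_smul_left, omegaSt_smul_right]
  field_simp
  ring

theorem exists_norm_moserField_le (h : IsStretching r R G Y Θ) :
    ∃ b, 0 ≤ b ∧ ∀ t ∈ Icc (0:ℝ) 1, ∀ x, ‖moserField G Y Θ (t, x)‖ ≤ b := by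
  obtain ⟨b₁, hb₁⟩ := ((isCompact_Icc (a := (0:ℝ)) (b := 1)).prod
    (isCompact_closedBall (0 : R4) (R + 1))).exists_bound_of_continuousOn
      h.contDiff_moserField.continuous.continuousOn
  obtain ⟨b₂, hb₂⟩ := h.bounded
  have hb0 : 0 ≤ b₂ := (norm_nonneg _).trans (hb₂ 0)
  refine ⟨max b₁ (π / 2 * b₂), le_max_of_le_right (by positivity), fun t ht x => ?_⟩
  by_cases hx : ‖x‖ ≤ R + 1
  · exact (hb₁ (t, x) ⟨ht, by simpa using hx⟩).trans (le_max_left _ _)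
  · have h1 : G =ᶠ[𝓝 x] fun _ => 1 := by
      filter_upwards [(isOpen_lt continuous_const continuous_norm).mem_nhds
        (by linarith : R < ‖x‖)] with z hz using h.eq_one z (le_of_lt hz)
    have h2 : fderiv ℝ G x = 0 := by rw [h1.fderiv_eq, fderiv_fun_const]; rfl
    have h3 : moserField G Y Θ (t, x) = (sin (π * t) * π / 2) • (-Θ x) := by
      simp [moserField, hamField, h2, h1.self_of_nhds]
    rw [h3, norm_smul, norm_neg]
    refine le_max_of_le_right (mul_le_mul ?_ (hb₂ x) (norm_nonneg _) (by positivity))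
    rw [norm_div, norm_mul, Real.norm_of_nonneg pi_pos.le, Real.norm_ofNat, Real.norm_eq_abs]
    have := abs_sin_le_one (π * t)
    have := mul_le_mul_of_nonneg_right this pi_pos.le
    linarith

/-- Moser's theorem: away from infinity, the stretched form is symplectomorphic to the standard
one, by a map that moves points only over the disc and by a bounded amount. -/
theorem exists_map (h : IsStretching r R G Y Θ) : ∃ b, 0 ≤ b ∧ ∀ L : ℝ,
    ∃ (Ψ : R4 → R4) (Ψ' : R4 → R4 →L[ℝ] R4), (∀ x, HasFDerivAt Ψ (Ψ' x) x) ∧ Continuous Ψ' ∧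
      Function.Surjective Ψ ∧ (∀ x, ‖Ψ x - x‖ ≤ b) ∧
      (∀ x : R4, r ^ 2 ≤ x 0 ^ 2 + x 1 ^ 2 → Ψ x = x) ∧
      ∀ x, ‖x‖ ≤ L → ∀ u v, G (Ψ x) * omegaSt (Ψ' x u) (Ψ' x v) +
        (fderiv ℝ G (Ψ x) (Ψ' x u) * omegaSt (Y (Ψ x)) (Ψ' x v) -
          fderiv ℝ G (Ψ x) (Ψ' x v) * omegaSt (Y (Ψ x)) (Ψ' x u)) = omegaSt u v := by
  obtain ⟨b, hb0, hb⟩ := h.exists_norm_moserField_le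
  refine ⟨b, hb0, fun L => ?_⟩
  have hρ : 0 < |L| + b + 1 := by positivity
  let χ : ContDiffBump (0 : R4) := ⟨|L| + b + 1, |L| + b + 2, hρ, by linarith⟩
  have hs : ContDiff ℝ ∞ fun p : ℝ × R4 => χ p.2 • moserField G Y Θ p :=
    (χ.contDiff.comp contDiff_snd).smul h.contDiff_moserField
  obtain ⟨K, C, hC, hF⟩ := exists_isBoundedField (ρ := |L| + b + 2) (B := b) hs
    (fun p hp => by
      rw [χ.zero_of_le_dist (by rw [dist_zero_right]; exact hp.le), zero_smul])
    (fun t ht x => by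
      rw [norm_smul, Real.norm_of_nonneg χ.nonneg]
      exact (mul_le_of_le_one_left (norm_nonneg _) χ.le_one).trans (hb t ht x))
  obtain ⟨y, W, hf⟩ := hF.exists_isFlowOf
  have h1 : (1:ℝ) ∈ Icc (0:ℝ) 1 := right_mem_Icc.2 zero_le_one
  refine ⟨fun p => y p 1, fun p => W p 1, fun x => hf.hasFDerivAt hF hC x h1,
    hf.continuous_linear hF hC h1, hf.surjective hF, fun x => hf.norm_sub_le hF x h1, ?_, ?_⟩
  · intro x hx
    refine hf.eq_of_solution hF (z := fun _ => x) (fun t _ => ?_) h1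
    have : moserField G Y Θ (t, x) = 0 := by
      have h0 := h.primitive_eq_zero x hx
      simp [moserField, h0, ← omegaL_apply]
    simp only [this, smul_zero]
    exact hasDerivWithinAt_const _ _ _
  · intro x hx u v
    have key := perturbedForm_flow_eq h.contDiff_primitive (a := fun t => (1 - cos (π * t)) / 2)
      (a' := fun t => sin (π * t) * π / 2) (hf.hasDerivWithinAt x) (hf.linear_hasDerivWithinAt x)
      (fun t => by
        have h2 : HasDerivAt (fun t => π * t) π t := by
          simpa using (hasDerivAt_id t).const_mul π
        refine ((((hasDerivAt_cos (π * t)).comp t h2).const_sub 1).div_const 2).congr_deriv ?_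
        ring)
      (fun t ht => hF.hasFDerivAt t ht _) (fun t ht => by
        have h3 : y x t ∈ ball (0 : R4) (|L| + b + 1) := by
          rw [mem_ball_zero_iff]
          have h4 := hf.norm_sub_le hF x ht
          have h5 := norm_add_le (y x t - x) x
          rw [sub_add_cancel] at h5
          have := le_abs_self L
          linarith
        filter_upwards [isOpen_ball.mem_nhds h3] with z hz v
        rw [χ.one_of_mem_closedBall (ball_subset_closedBall hz), one_smul]
        exact h.perturbedForm_moserField t z v) u v 1 h1
    rw [h.perturbedForm_eq, h.perturbedForm_eq, hf.linear_zero, hf.zero] at key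
    simp at key
    linarith

end IsStretching

/-! ### Primitives of closed compactly supported forms by integration along rays -/

/-- The integral of `f` along the ray from `x` in direction `-e`. -/
def rayIntegral {F : Type*} [NormedAddCommGroup F] [NormedSpace ℝ F] (e : R4) (f : R4 → F)
    (x : R4) : F := ∫ τ in Ioi (0:ℝ), f (x - τ • e)

section RayIntegral

variable {F : Type*} [NormedAddCommGroup F] [NormedSpace ℝ F] {e : R4} {f : R4 → F}

theorem integrable_ray {F : Type*} [NormedAddCommGroup F] {f : R4 → F} (he : ‖e‖ = 1) (hf : Continuous f) (hc : HasCompactSupport f) (x : R4) :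
    Integrable fun τ : ℝ => f (x - τ • e) := by
  refine Continuous.integrable_of_hasCompactSupport (by fun_prop) ?_
  obtain ⟨b, hb⟩ := hc.isCompact.isBounded.exists_norm_le
  refine HasCompactSupport.of_support_subset_isCompact
    (isCompact_Icc (a := -(‖x‖ + b)) (b := ‖x‖ + b)) fun τ hτ => ?_
  have h1 := hb _ (subset_tsupport f hτ)
  have h2 : ‖τ • e‖ ≤ ‖x‖ + ‖x - τ • e‖ := by
    simpa using norm_sub_le x (x - τ • e)
  rw [norm_smul, he, mul_one, Real.norm_eq_abs] at h2
  exact abs_le.1 (by linarith)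

theorem hasFDerivAt_rayIntegral (he : ‖e‖ = 1) (hf : ContDiff ℝ ∞ f)
    (hc : HasCompactSupport f) (x : R4) :
    HasFDerivAt (rayIntegral e f) (rayIntegral e (fderiv ℝ f) x) x := by
  have hf' : Continuous (fderiv ℝ f) := hf.continuous_fderiv (by simp)
  obtain ⟨b, hb⟩ := (hc.fderiv ℝ).isCompact.isBounded.exists_norm_le
  obtain ⟨c, hcb⟩ := (hc.fderiv ℝ).exists_bound_of_continuous hf'
  have hcf := hf.continuous
  refine hasFDerivAt_integral_of_dominated_of_fderiv_le (μ := volume.restrict (Ioi (0:ℝ)))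
    (F := fun x τ => f (x - τ • e)) (F' := fun x τ => fderiv ℝ f (x - τ • e))
    (bound := (Icc (-(‖x‖ + 1 + b)) (‖x‖ + 1 + b)).indicator fun _ => c)
    (ball_mem_nhds x one_pos) (Eventually.of_forall fun z => ?_)
    (integrable_ray he hf.continuous hc x).integrableOn ?_ ?_ ?_ ?_
  · exact (by fun_prop : Continuous fun τ : ℝ => f (z - τ • e)).aestronglyMeasurable
  · exact (by fun_prop : Continuous fun τ : ℝ => fderiv ℝ f (x - τ • e)).aestronglyMeasurable
  · refine Eventually.of_forall fun τ z hz => ?_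
    by_cases h : fderiv ℝ f (z - τ • e) = 0
    · rw [h, norm_zero]
      exact indicator_nonneg (fun _ _ => (norm_nonneg _).trans (hcb 0)) _
    · have h1 := hb _ (subset_tsupport (fderiv ℝ f) h)
      have h2 : ‖τ • e‖ ≤ ‖z‖ + ‖z - τ • e‖ := by simpa using norm_sub_le z (z - τ • e)
      have h3 : ‖z‖ ≤ ‖z - x‖ + ‖x‖ := by simpa using norm_add_le (z - x) x
      rw [mem_ball, dist_eq_norm] at hz
      rw [norm_smul, he, mul_one, Real.norm_eq_abs] at h2
      have hmem : τ ∈ Icc (-(‖x‖ + 1 + b)) (‖x‖ + 1 + b) := abs_le.1 (by linarith)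
      rw [indicator_of_mem hmem]
      exact hcb _
  · exact ((integrable_indicator_iff measurableSet_Icc).2 (integrableOn_const (by simp))).integrableOn
  · refine Eventually.of_forall fun τ z _ => ?_
    have := ((hf.differentiable (by simp)) (z - τ • e)).hasFDerivAt.comp z
      ((hasFDerivAt_id z).sub_const (τ • e))
    simpa [Function.comp_def] using this

theorem fderiv_rayIntegral [CompleteSpace F] (he : ‖e‖ = 1) (hf : ContDiff ℝ ∞ f)
    (hc : HasCompactSupport f) (x v : R4) :
    fderiv ℝ (rayIntegral e f) x v = rayIntegral e (fun y => fderiv ℝ f y v) x := by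
  rw [(hasFDerivAt_rayIntegral he hf hc x).fderiv, rayIntegral, rayIntegral,
    ContinuousLinearMap.integral_apply
      (integrable_ray he (hf.continuous_fderiv (by simp)) (hc.fderiv ℝ) x).integrableOn]

theorem contDiff_nat_rayIntegral {F : Type*} [NormedAddCommGroup F] [NormedSpace ℝ F]
    {f : R4 → F} (he : ‖e‖ = 1) (hf : ContDiff ℝ ∞ f)
    (hc : HasCompactSupport f) (n : ℕ) : ContDiff ℝ n (rayIntegral e f) := by
  induction n generalizing F with
  | zero =>
    exact contDiff_zero.2 (continuous_iff_continuousAt.2 fun x =>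
      (hasFDerivAt_rayIntegral he hf hc x).continuousAt)
  | succ n ih =>
    exact contDiff_succ_iff_hasFDerivAt.2 ⟨_, ih (hf.fderiv_right (m := ∞) (by simp)) (hc.fderiv ℝ),
      hasFDerivAt_rayIntegral he hf hc⟩

theorem contDiff_rayIntegral (he : ‖e‖ = 1) (hf : ContDiff ℝ ∞ f)
    (hc : HasCompactSupport f) : ContDiff ℝ ∞ (rayIntegral e f) :=
  contDiff_infty.2 (contDiff_nat_rayIntegral he hf hc)

theorem rayIntegral_fderiv_self {f : R4 → ℝ} (he : ‖e‖ = 1) (hf : ContDiff ℝ ∞ f)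
    (hc : HasCompactSupport f) (x : R4) : rayIntegral e (fun y => fderiv ℝ f y e) x = f x := by
  have hl : ContDiff ℝ ∞ fun τ : ℝ => x - τ • e := by fun_prop
  have hd : ∀ τ : ℝ, HasDerivAt (fun τ : ℝ => f (x - τ • e)) (-(fderiv ℝ f (x - τ • e) e)) τ := by
    intro τ
    have h1 : HasDerivAt (fun τ : ℝ => x - τ • e) (-e) τ := by
      simpa using ((hasDerivAt_id τ).smul_const e).const_sub x
    exact (((hf.differentiable (by simp)) (x - τ • e)).hasFDerivAt.comp_hasDerivAt τ h1).congr_deriv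
      (by simp)
  have hcs : HasCompactSupport fun τ : ℝ => f (x - τ • e) := by
    obtain ⟨b, hb⟩ := hc.isCompact.isBounded.exists_norm_le
    refine HasCompactSupport.of_support_subset_isCompact
      (isCompact_Icc (a := -(‖x‖ + b)) (b := ‖x‖ + b)) fun τ hτ => ?_
    have h1 := hb _ (subset_tsupport f hτ)
    have h2 : ‖τ • e‖ ≤ ‖x‖ + ‖x - τ • e‖ := by
      simpa using norm_sub_le x (x - τ • e)
    rw [norm_smul, he, mul_one, Real.norm_eq_abs] at h2
    exact abs_le.1 (by linarith)
  have hcd : ContDiff ℝ 1 fun τ : ℝ => f (x - τ • e) := (hf.comp hl).of_le (by norm_cast)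
  have := hcs.integral_Ioi_deriv_eq hcd 0
  rw [show deriv (fun τ : ℝ => f (x - τ • e)) = fun τ => -(fderiv ℝ f (x - τ • e) e) from
    funext fun τ => (hd τ).deriv, integral_neg] at this
  rw [rayIntegral]
  simpa using this

theorem rayIntegral_eq_zero {x : R4} (h : ∀ τ : ℝ, f (x - τ • e) = 0) : rayIntegral e f x = 0 := by
  simp [rayIntegral, h]

theorem exists_norm_rayIntegral_le (he : ‖e‖ = 1) (hf : Continuous f) (hc : HasCompactSupport f) :
    ∃ b, ∀ x, ‖rayIntegral e f x‖ ≤ b := by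
  obtain ⟨b, hb⟩ := hc.isCompact.isBounded.exists_norm_le
  obtain ⟨c, hcb⟩ := hc.exists_bound_of_continuous hf
  have hc0 : 0 ≤ c := (norm_nonneg _).trans (hcb 0)
  refine ⟨c * (2 * |b|), fun x => ?_⟩
  set s : ℝ := inner ℝ x e with hs
  have h1 : rayIntegral e f x = ∫ τ in Ioi (0:ℝ) ∩ Icc (s - |b|) (s + |b|), f (x - τ • e) := by
    rw [rayIntegral]
    refine (setIntegral_eq_of_subset_of_forall_sdiff_eq_zero (f := fun τ => f (x - τ • e))
      (s := Ioi (0:ℝ) ∩ Icc (s - |b|) (s + |b|)) (t := Ioi 0) measurableSet_Ioi inter_subset_left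
      fun τ hτ => ?_)
    by_contra h
    refine hτ.2 ⟨hτ.1, ?_⟩
    have h2 := hb _ (subset_tsupport f h)
    have h3 : |inner ℝ (x - τ • e) e| ≤ ‖x - τ • e‖ := by
      simpa [he] using abs_real_inner_le_norm (x - τ • e) e
    rw [inner_sub_left, inner_smul_left, real_inner_self_eq_norm_sq, he] at h3
    simp only [conj_trivial, one_pow, mul_one, ← hs] at h3
    have := abs_le.1 (h3.trans (h2.trans (le_abs_self b)))
    constructor <;> linarith [this.1, this.2]
  rw [h1]
  have hsub : Ioi (0:ℝ) ∩ Icc (s - |b|) (s + |b|) ⊆ Icc (s - |b|) (s + |b|) := inter_subset_right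
  have hfin : volume (Icc (s - |b|) (s + |b|)) < ⊤ := by simp
  refine (norm_setIntegral_le_of_norm_le_const ((measure_mono hsub).trans_lt hfin)
    fun τ _ => hcb _).trans ?_
  gcongr
  refine (measureReal_mono hsub hfin.ne).trans ?_
  rw [measureReal_def, Real.volume_Icc, ENNReal.toReal_ofReal (by linarith [abs_nonneg b])]
  linarith

end RayIntegral

/-- The two-form `df ∧ ω(Z, ·)`. -/
def wedgeForm (f : R4 → ℝ) (Z : R4 → R4) (x u v : R4) : ℝ :=
  fderiv ℝ f x u * omegaSt (Z x) v - fderiv ℝ f x v * omegaSt (Z x) u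

/-- The vector field dual to the contraction of `df ∧ ω(Z, ·)` with `e`. -/
def contractionField (f : R4 → ℝ) (Z : R4 → R4) (e x : R4) : R4 :=
  fderiv ℝ f x e • Z x - omegaSt (Z x) e • hamField f x

theorem omegaSt_sub_left (u u' v : R4) : omegaSt (u - u') v = omegaSt u v - omegaSt u' v := by
  simp [← omegaL_apply]

theorem omegaSt_sub_right (u v v' : R4) : omegaSt u (v - v') = omegaSt u v - omegaSt u v' := by
  simp [← omegaL_apply]

theorem omegaSt_contractionField (f : R4 → ℝ) (Z : R4 → R4) (e x v : R4) :
    omegaSt (contractionField f Z e x) v = wedgeForm f Z x e v := by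
  rw [contractionField, omegaSt_sub_left, omegaSt_smul_left, omegaSt_smul_left, omegaSt_hamField,
    wedgeForm]
  ring

theorem hamField_eq_zero {f : R4 → ℝ} {x : R4} (h : fderiv ℝ f x = 0) : hamField f x = 0 := by
  simp [hamField, h]

section WedgeForm

variable {f : R4 → ℝ} {Z : R4 → R4}

theorem contDiff_wedgeForm (hf : ContDiff ℝ ∞ f) (hZ : ContDiff ℝ ∞ Z) (u v : R4) :
    ContDiff ℝ ∞ fun x => wedgeForm f Z x u v := by
  have hf' : ContDiff ℝ ∞ (fderiv ℝ f) := hf.fderiv_right (m := ∞) (by simp)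
  exact ((hf'.clm_apply contDiff_const).mul (hZ.omegaSt contDiff_const)).sub
    ((hf'.clm_apply contDiff_const).mul (hZ.omegaSt contDiff_const))

theorem hasCompactSupport_wedgeForm (hc : HasCompactSupport (fderiv ℝ f)) (u v : R4) :
    HasCompactSupport fun x => wedgeForm f Z x u v :=
  hc.mono fun x hx h => hx (by simp [wedgeForm, h])

theorem fderiv_wedgeForm (hf : ContDiff ℝ ∞ f) (hZ : ContDiff ℝ ∞ Z) (x u v w : R4) :
    fderiv ℝ (fun x => wedgeForm f Z x u v) x w =
      fderiv ℝ (fderiv ℝ f) x w u * omegaSt (Z x) v + fderiv ℝ f x u * omegaSt (fderiv ℝ Z x w) v -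
      (fderiv ℝ (fderiv ℝ f) x w v * omegaSt (Z x) u +
        fderiv ℝ f x v * omegaSt (fderiv ℝ Z x w) u) := by
  have hf' : ContDiff ℝ ∞ (fderiv ℝ f) := hf.fderiv_right (m := ∞) (by simp)
  have h1 : ∀ u, HasFDerivAt (fun x => fderiv ℝ f x u) ((fderiv ℝ (fderiv ℝ f) x).flip u) x :=
    fun u => by
      simpa using ((hf'.differentiable (by simp)) x).hasFDerivAt.clm_apply
        (hasFDerivAt_const u x)
  have h2 : ∀ v, HasFDerivAt (fun x => omegaSt (Z x) v)
      ((omegaL.flip v).comp (fderiv ℝ Z x)) x := fun v => by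
    simp only [← omegaL_apply]
    exact (omegaL.flip v).hasFDerivAt.comp x ((hZ.differentiable (by simp)) x).hasFDerivAt
  have h3 := ((h1 u).mul (h2 v)).sub ((h1 v).mul (h2 u))
  have h4 : HasFDerivAt (fun x => wedgeForm f Z x u v) _ x := h3
  rw [h4.fderiv]
  simp [omegaL_apply]
  ring

theorem wedgeForm_closed (hf : ContDiff ℝ ∞ f) (hZ : ContDiff ℝ ∞ Z) {x : R4}
    (h : fderiv ℝ f x = 0 ∨
      ∀ u v, omegaSt (fderiv ℝ Z x u) v + omegaSt u (fderiv ℝ Z x v) = 0) (u v w : R4) :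
    fderiv ℝ (fun x => wedgeForm f Z x u v) x w + fderiv ℝ (fun x => wedgeForm f Z x v w) x u +
      fderiv ℝ (fun x => wedgeForm f Z x w u) x v = 0 := by
  rw [fderiv_wedgeForm hf hZ, fderiv_wedgeForm hf hZ, fderiv_wedgeForm hf hZ]
  have hs : ∀ a b, fderiv ℝ (fderiv ℝ f) x a b = fderiv ℝ (fderiv ℝ f) x b a := fun a b =>
    second_derivative_symmetric (fun y => ((hf.differentiable (by simp)) y).hasFDerivAt)
      (((hf.fderiv_right (m := ∞) (by simp)).differentiable (by simp)) x).hasFDerivAt a b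
  rw [hs w u, hs w v, hs u v]
  rcases h with h | h
  · simp [h]
  · have h' : ∀ a b, omegaSt (fderiv ℝ Z x a) b = omegaSt (fderiv ℝ Z x b) a := fun a b => by
      have := h a b
      rw [omegaSt_swap (fderiv ℝ Z x b) a] at this
      linarith
    rw [h' w v, h' u v, h' w u]; ring

theorem contDiff_contractionField (hf : ContDiff ℝ ∞ f) (hZ : ContDiff ℝ ∞ Z) (e : R4) :
    ContDiff ℝ ∞ (contractionField f Z e) :=
  (((hf.fderiv_right (m := ∞) (by simp)).clm_apply contDiff_const).smul hZ).sub
    ((hZ.omegaSt contDiff_const).smul (contDiff_hamField hf))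

theorem contractionField_eq_zero {e x : R4} (h : fderiv ℝ f x = 0) :
    contractionField f Z e x = 0 := by
  simp [contractionField, h, hamField_eq_zero h]

theorem rayIntegral_contractionField (hf : ContDiff ℝ ∞ f) (hZ : ContDiff ℝ ∞ Z)
    (hc : HasCompactSupport (fderiv ℝ f))
    (h : ∀ x, fderiv ℝ f x = 0 ∨
      ∀ u v, omegaSt (fderiv ℝ Z x u) v + omegaSt u (fderiv ℝ Z x v) = 0)
    {e : R4} (he : ‖e‖ = 1) (x u v : R4) :
    omegaSt (fderiv ℝ (rayIntegral e (contractionField f Z e)) x u) v +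
      omegaSt u (fderiv ℝ (rayIntegral e (contractionField f Z e)) x v) = wedgeForm f Z x u v := by
  have hN := contDiff_contractionField hf hZ e
  have hNc : HasCompactSupport (contractionField f Z e) :=
    hc.mono fun x hx h => hx (contractionField_eq_zero h)
  have key : ∀ u v, omegaSt (fderiv ℝ (rayIntegral e (contractionField f Z e)) x u) v =
      rayIntegral e (fun y => fderiv ℝ (fun x => wedgeForm f Z x e v) y u) x := by
    intro u v
    rw [fderiv_rayIntegral he hN hNc, ← omegaL_apply, ← ContinuousLinearMap.flip_apply,
      rayIntegral, rayIntegral, ← ContinuousLinearMap.integral_comp_comm]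
    · congr 1
      ext τ
      have h1 : (fun x => wedgeForm f Z x e v) = (omegaL.flip v) ∘ contractionField f Z e := by
        ext y; simp [omegaL_apply, omegaSt_contractionField]
      rw [h1, ((omegaL.flip v).hasFDerivAt.comp _
        ((hN.differentiable (by simp)) _).hasFDerivAt).fderiv]
      rfl
    · have hN' : ContDiff ℝ ∞ fun y => fderiv ℝ (contractionField f Z e) y u :=
        (hN.fderiv_right (m := ∞) (by simp)).clm_apply contDiff_const
      exact (integrable_ray he hN'.continuous
        ((hNc.fderiv ℝ).mono fun y hy h => hy (by simp [h])) x).integrableOn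
  have hInteg : ∀ a b c, IntegrableOn (fun τ : ℝ =>
      fderiv ℝ (fun x => wedgeForm f Z x a b) (x - τ • e) c) (Ioi 0) := fun a b c =>
    (integrable_ray (f := fun y => fderiv ℝ (fun x => wedgeForm f Z x a b) y c) he
      (((contDiff_wedgeForm hf hZ a b).fderiv_right (m := ∞) (by simp)).clm_apply
        contDiff_const).continuous
      (((hasCompactSupport_wedgeForm (Z := Z) hc a b).fderiv ℝ).mono fun y hy h => hy (by simp [h]))
      x).integrableOn
  rw [omegaSt_swap _ u, key, key, ← rayIntegral_fderiv_self (f := fun x => wedgeForm f Z x u v) he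
    (contDiff_wedgeForm hf hZ u v) (hasCompactSupport_wedgeForm hc u v) x, rayIntegral, rayIntegral,
    rayIntegral, ← sub_eq_add_neg, ← integral_sub (hInteg _ _ _) (hInteg _ _ _)]
  congr 1
  ext τ
  have h1 := wedgeForm_closed hf hZ (h (x - τ • e)) u v e
  have h2 : (fun x => wedgeForm f Z x v e) = fun x => -wedgeForm f Z x e v := by
    ext y; simp [wedgeForm]
  rw [h2, fderiv_fun_neg] at h1
  simp only [neg_apply] at h1
  linarith

end WedgeForm

/-- A potential `ρ` for a closed one-form supported in a shell over a disc on which `Y` is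
Liouville. -/
structure IsShellPotential (r R : ℝ) (ρ : R4 → ℝ) (Y : R4 → R4) : Prop where
  contDiff_fun : ContDiff ℝ ∞ ρ
  contDiff_field : ContDiff ℝ ∞ Y
  eq_zero : ∀ x, R ≤ ‖x‖ → ρ x = 0
  eq_zero_of_le : ∀ x : R4, r ^ 2 ≤ x 0 ^ 2 + x 1 ^ 2 → ρ x = 0
  liouville : ∀ x, fderiv ℝ ρ x = 0 ∨ ∀ u v,
    omegaSt (fderiv ℝ Y x u) v + omegaSt u (fderiv ℝ Y x v) = omegaSt u v
  nonneg : ∀ x, 0 ≤ fderiv ℝ ρ x (Y x)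
  pos : ∃ x, 0 < fderiv ℝ ρ x (Y x)

namespace IsShellPotential

variable {r R : ℝ} {ρ : R4 → ℝ} {Y : R4 → R4}

theorem hasCompactSupport (h : IsShellPotential r R ρ Y) : HasCompactSupport ρ :=
  HasCompactSupport.of_support_subset_isCompact (isCompact_closedBall 0 R) fun x hx => by
    by_contra hn
    exact hx (h.eq_zero x (by simpa using (not_le.1 (by simpa using hn)).le))

theorem fderiv_sub_radial (h : IsShellPotential r R ρ Y) (x : R4) :
    fderiv ℝ (fun x => Y x - (1/2 : ℝ) • x) x =
      fderiv ℝ Y x - (1/2 : ℝ) • ContinuousLinearMap.id ℝ R4 :=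
  (((h.contDiff_field.differentiable (by simp)) x).hasFDerivAt.sub
    ((hasFDerivAt_id x).const_smul (1/2 : ℝ))).fderiv

theorem fderiv_eq_zero_or (h : IsShellPotential r R ρ Y) (x : R4) : fderiv ℝ ρ x = 0 ∨ ∀ u v,
    omegaSt (fderiv ℝ (fun x => Y x - (1/2 : ℝ) • x) x u) v +
      omegaSt u (fderiv ℝ (fun x => Y x - (1/2 : ℝ) • x) x v) = 0 := by
  refine (h.liouville x).imp id fun h1 u v => ?_
  rw [h.fderiv_sub_radial]
  simp only [sub_apply, smul_apply,
    ContinuousLinearMap.id_apply, omegaSt_sub_left, omegaSt_sub_right, omegaSt_smul_left,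
    omegaSt_smul_right]
  linarith [h1 u v]

theorem exists_isStretching (h : IsShellPotential r R ρ Y) {ν : ℝ} (hν : 0 ≤ ν) {r' : ℝ}
    (hr : 0 ≤ r) (hr' : r < r') :
    ∃ Θ, IsStretching r' R (fun x => Real.exp (ν * ρ x)) Y Θ := by
  set G : R4 → ℝ := fun x => Real.exp (ν * ρ x) with hG
  set Z : R4 → R4 := fun x => Y x - (1/2 : ℝ) • x with hZd
  set e : R4 := EuclideanSpace.single 2 1 with he
  have hen : ‖e‖ = 1 := by simp [he]
  have hGs : ContDiff ℝ ∞ G := (contDiff_const.mul h.contDiff_fun).exp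
  have hZs : ContDiff ℝ ∞ Z := h.contDiff_field.sub (contDiff_id.const_smul _)
  have hG' : ∀ x, fderiv ℝ G x = (G x * ν) • fderiv ℝ ρ x := fun x => by
    rw [((((h.contDiff_fun.differentiable (by simp)) x).hasFDerivAt.const_mul ν).exp).fderiv,
      smul_smul]
  have hG1 : HasCompactSupport fun x => G x - 1 :=
    h.hasCompactSupport.mono fun x hx h0 => hx (by simp [hG, h0])
  have hGc : HasCompactSupport (fderiv ℝ G) :=
    (h.hasCompactSupport.fderiv ℝ).mono fun x hx h0 => hx (by simp [hG', h0])
  have hr0 : ∀ x : R4, r' ^ 2 ≤ x 0 ^ 2 + x 1 ^ 2 → fderiv ℝ G x = 0 := by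
    intro x hx
    have h1 : ρ =ᶠ[𝓝 x] fun _ => 0 := by
      filter_upwards [(isOpen_lt (continuous_const (y := r ^ 2))
        (by fun_prop : Continuous fun x : R4 => x 0 ^ 2 + x 1 ^ 2)).mem_nhds
        (by rw [mem_ofPred_eq]; nlinarith)] with y hy using h.eq_zero_of_le y (le_of_lt hy)
    rw [hG', h1.fderiv_eq, fderiv_fun_const]; simp
  have hNs := contDiff_contractionField hGs hZs e
  have hNc : HasCompactSupport (contractionField G Z e) :=
    hGc.mono fun x hx h => hx (contractionField_eq_zero h)
  have hdis : ∀ x, fderiv ℝ G x = 0 ∨ ∀ u v,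
      omegaSt (fderiv ℝ Z x u) v + omegaSt u (fderiv ℝ Z x v) = 0 := fun x =>
    (h.fderiv_eq_zero_or x).imp (fun h0 => by rw [hG', h0, smul_zero]) id
  refine ⟨fun x => (G x - 1) • ((1/2 : ℝ) • x) + rayIntegral e (contractionField G Z e) x, ?_⟩
  have hΘ1 : ContDiff ℝ ∞ fun x => (G x - 1) • ((1/2 : ℝ) • x) :=
    (hGs.sub contDiff_const).smul (contDiff_id.const_smul _)
  have hM := contDiff_rayIntegral hen hNs hNc
  refine ⟨hGs, h.contDiff_field, hΘ1.add hM, fun x => Real.exp_pos _,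
    fun x hx => by simp [hG, h.eq_zero x hx],
    fun x hx => by simp [hG, h.eq_zero_of_le x (by nlinarith)], fun x => ?_, fun x hx => ?_, ?_,
    fun x u v => ?_⟩
  · rw [hG', smul_apply, smul_eq_mul]
    have := h.nonneg x
    have := Real.exp_pos (ν * ρ x)
    positivity
  · rw [rayIntegral_eq_zero, show G x = 1 by simp [hG, h.eq_zero_of_le x (by nlinarith)]]
    · simp
    · intro τ
      refine contractionField_eq_zero (hr0 _ ?_)
      simpa [he] using hx
  · obtain ⟨b₁, hb₁⟩ := (HasCompactSupport.smul_right (f' := fun x : R4 => (1/2 : ℝ) • x)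
      hG1).exists_bound_of_continuous hΘ1.continuous
    obtain ⟨b₂, hb₂⟩ := exists_norm_rayIntegral_le hen hNs.continuous hNc
    exact ⟨b₁ + b₂, fun x => (norm_add_le _ _).trans (add_le_add (hb₁ x) (hb₂ x))⟩
  · have e1 := rayIntegral_contractionField hGs hZs hGc hdis hen x u v
    have e2 : HasFDerivAt (fun x => (G x - 1) • ((1/2 : ℝ) • x)) _ x :=
      (((hGs.differentiable (by simp)) x).hasFDerivAt.sub_const 1).smul
        ((hasFDerivAt_id x).const_smul (1/2 : ℝ))
    have e3 : HasFDerivAt (fun x => (G x - 1) • ((1/2 : ℝ) • x) +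
        rayIntegral e (contractionField G Z e) x) _ x :=
      e2.add ((hM.differentiable (by simp)) x).hasFDerivAt
    rw [e3.fderiv]
    simp only [add_apply, omegaSt_add_left, omegaSt_add_right]
    simp only [wedgeForm, hZd, omegaSt_sub_left] at e1
    simp only [smul_apply, ContinuousLinearMap.smulRight_apply,
      omegaSt_smul_left, omegaSt_smul_right,
      ContinuousLinearMap.id_apply, omegaSt_swap x u] at e1 ⊢
    linarith

end IsShellPotential

/-! ### The potential takes a negative value -/

theorem integral_coord_mul_fderiv {f : R4 → ℝ} (hf : ContDiff ℝ ∞ f) (hc : HasCompactSupport f)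
    (k : Fin 4) (v : R4) : ∫ x : R4, x k * fderiv ℝ f x v = -(v k * ∫ x : R4, f x) := by
  have hk : ∀ x : R4, HasFDerivAt (fun x : R4 => x k) (EuclideanSpace.proj k : R4 →L[ℝ] ℝ) x :=
    fun x => (EuclideanSpace.proj k : R4 →L[ℝ] ℝ).hasFDerivAt
  have hk' : ∀ x : R4, fderiv ℝ (fun x : R4 => x k) x v = v k := fun x => by
    rw [(hk x).fderiv]; rfl
  have hcv : HasCompactSupport fun x => fderiv ℝ f x v :=
    (hc.fderiv ℝ).mono fun y hy h => hy (by simp [h])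
  have hfv : Continuous fun x => fderiv ℝ f x v :=
    ((hf.fderiv_right (m := ∞) (by simp)).clm_apply contDiff_const).continuous
  have hkc : Continuous fun x : R4 => x k := by fun_prop
  rw [integral_mul_fderiv_eq_neg_fderiv_mul_of_integrable]
  · simp only [hk']
    rw [integral_const_mul]
  · simp only [hk']
    exact (hf.continuous.integrable_of_hasCompactSupport hc).const_mul _
  · exact (hkc.mul hfv).integrable_of_hasCompactSupport hcv.mul_left
  · exact (hkc.mul hf.continuous).integrable_of_hasCompactSupport hc.mul_left
  · exact fun x _ => (hk x).differentiableAt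
  · exact fun x _ => hf.differentiable (by simp) x

theorem integral_add_add {f₁ f₂ f₃ : R4 → ℝ} (h₁ : Integrable f₁) (h₂ : Integrable f₂)
    (h₃ : Integrable f₃) :
    ∫ x, (f₁ x + f₂ x + f₃ x) = (∫ x, f₁ x) + (∫ x, f₂ x) + ∫ x, f₃ x := by
  rw [← integral_add h₁ h₂]
  exact integral_add (h₁.add h₂) h₃

theorem integral_wedgeForm_eq_zero {f : R4 → ℝ} {Z : R4 → R4} (hf : ContDiff ℝ ∞ f)
    (hZ : ContDiff ℝ ∞ Z) (hc : HasCompactSupport (fderiv ℝ f))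
    (h : ∀ x, fderiv ℝ f x = 0 ∨
      ∀ u v, omegaSt (fderiv ℝ Z x u) v + omegaSt u (fderiv ℝ Z x v) = 0)
    {u v w : R4} {k : Fin 4} (hw : w k = 1) (hu : u k = 0) (hv : v k = 0) :
    ∫ x, wedgeForm f Z x u v = 0 := by
  have hcd := contDiff_wedgeForm hf hZ
  have hcs := hasCompactSupport_wedgeForm (Z := Z) hc
  have hInteg : ∀ a b c : R4,
      Integrable fun x : R4 => x k * fderiv ℝ (fun x => wedgeForm f Z x a b) x c := fun a b c =>
    ((by fun_prop : Continuous fun x : R4 => x k).mul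
      (((hcd a b).fderiv_right (m := ∞) (by simp)).clm_apply
        contDiff_const).continuous).integrable_of_hasCompactSupport
      (HasCompactSupport.mul_left
        (((hcs a b).fderiv ℝ).mono fun y hy h => hy (by simp [h])))
  have h1 := integral_coord_mul_fderiv (hcd u v) (hcs u v) k w
  have h2 := integral_coord_mul_fderiv (hcd v w) (hcs v w) k u
  have h3 := integral_coord_mul_fderiv (hcd w u) (hcs w u) k v
  rw [hw, one_mul] at h1
  rw [hu, zero_mul, neg_zero] at h2
  rw [hv, zero_mul, neg_zero] at h3
  have h4 : ∫ x : R4, (x k * fderiv ℝ (fun x => wedgeForm f Z x u v) x w +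
      x k * fderiv ℝ (fun x => wedgeForm f Z x v w) x u +
      x k * fderiv ℝ (fun x => wedgeForm f Z x w u) x v) = 0 := by
    rw [← integral_zero R4 ℝ]
    congr 1
    ext x
    rw [← mul_add, ← mul_add, wedgeForm_closed hf hZ (h x), mul_zero]
  rw [integral_add_add (hInteg _ _ _) (hInteg _ _ _) (hInteg _ _ _)] at h4
  linarith

theorem fderiv_apply_eq_sum (f : R4 → ℝ) (x v : R4) :
    fderiv ℝ f x v = ∑ k, v k * fderiv ℝ f x (EuclideanSpace.single k 1) := by
  have : v = ∑ k, v k • (EuclideanSpace.single k 1 : R4) := by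
    ext i
    fin_cases i <;> simp [Fin.sum_univ_four]
  conv_lhs => rw [this]
  simp

theorem integral_fderiv_self {f : R4 → ℝ} (hf : ContDiff ℝ ∞ f) (hc : HasCompactSupport f) :
    ∫ x : R4, fderiv ℝ f x x = -(4 * ∫ x, f x) := by
  have h1 : ∀ x : R4, fderiv ℝ f x x = ∑ k, x k * fderiv ℝ f x (EuclideanSpace.single k 1) :=
    fun x => fderiv_apply_eq_sum f x x
  simp only [h1]
  rw [integral_finsetSum]
  · simp only [integral_coord_mul_fderiv hf hc]
    simp
  · intro k _
    exact ((by fun_prop : Continuous fun x : R4 => x k).mul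
      ((hf.fderiv_right (m := ∞) (by simp)).clm_apply
        contDiff_const).continuous).integrable_of_hasCompactSupport
      (HasCompactSupport.mul_left
        ((hc.fderiv ℝ).mono fun y hy h => hy (by simp [h])))

theorem IsShellPotential.exists_neg {r R : ℝ} {ρ : R4 → ℝ} {Y : R4 → R4}
    (h : IsShellPotential r R ρ Y) : ∃ x, ρ x < 0 := by
  have hf := h.contDiff_fun
  have hc := h.hasCompactSupport
  have hc' : HasCompactSupport (fderiv ℝ ρ) := hc.fderiv ℝ
  have hf' : ContDiff ℝ ∞ (fderiv ℝ ρ) := hf.fderiv_right (m := ∞) (by simp)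
  set Z : R4 → R4 := fun x => Y x - (1/2 : ℝ) • x with hZ
  have hZs : ContDiff ℝ ∞ Z := h.contDiff_field.sub (contDiff_id.const_smul _)
  set e : Fin 4 → R4 := fun k => EuclideanSpace.single k 1 with he
  have h01 : ∫ x, wedgeForm ρ Z x (e 0) (e 1) = 0 :=
    integral_wedgeForm_eq_zero hf hZs hc' h.fderiv_eq_zero_or (w := e 2) (k := 2)
      (by simp [he]) (by simp [he]) (by simp [he])
  have h23 : ∫ x, wedgeForm ρ Z x (e 2) (e 3) = 0 :=
    integral_wedgeForm_eq_zero hf hZs hc' h.fderiv_eq_zero_or (w := e 0) (k := 0)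
      (by simp [he]) (by simp [he]) (by simp [he])
  have hpos : 0 < ∫ x, fderiv ℝ ρ x (Y x) := by
    obtain ⟨x, hx⟩ := h.pos
    exact (hf'.clm_apply h.contDiff_field).continuous.integral_pos_of_hasCompactSupport_nonneg_nonzero
      (hc'.mono fun y hy h => hy (by simp [h])) h.nonneg hx.ne'
  have hInteg : ∀ a b, Integrable fun x => wedgeForm ρ Z x a b := fun a b =>
    (contDiff_wedgeForm hf hZs a b).continuous.integrable_of_hasCompactSupport
      (hasCompactSupport_wedgeForm hc' a b)
  have hInteg' : Integrable fun x => (1/2 : ℝ) * fderiv ℝ ρ x x :=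
    (((hf'.clm_apply contDiff_id).continuous).integrable_of_hasCompactSupport
      (hc'.mono fun y hy h => hy (by simp [h]))).const_mul _
  have hY : ∀ x, fderiv ℝ ρ x (Y x) = wedgeForm ρ Z x (e 0) (e 1) + wedgeForm ρ Z x (e 2) (e 3) +
      (1/2 : ℝ) * fderiv ℝ ρ x x := by
    intro x
    have : Y x = Z x + (1/2 : ℝ) • x := by simp [hZ]
    rw [this, map_add, map_smul, smul_eq_mul, fderiv_apply_eq_sum ρ x (Z x)]
    simp [wedgeForm, omegaSt, he, Fin.sum_univ_four]
    ring
  simp only [hY] at hpos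
  rw [integral_add_add (hInteg _ _) (hInteg _ _) hInteg', integral_const_mul, h01, h23, integral_fderiv_self hf hc] at hpos
  by_contra! hn
  have := integral_nonneg (μ := volume) (f := ρ) hn
  linarith

/-! ### The family of Hamiltonians attached to a stretched function -/

/-- A smooth step from `0` to `m` on `[0, w]`. -/
def stepProfile (m w r : ℝ) : ℝ := m * smoothTransition (r / w)

section StepProfile

variable {m w : ℝ}

theorem contDiff_stepProfile : ContDiff ℝ ∞ (stepProfile m w) :=
  contDiff_const.mul (smoothTransition.contDiff.comp (contDiff_id.div_const w))

theorem hasDerivAt_stepProfile (r : ℝ) :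
    HasDerivAt (stepProfile m w) (deriv (stepProfile m w) r) r :=
  ((contDiff_stepProfile.differentiable (by simp)) r).hasDerivAt

theorem continuous_deriv_stepProfile : Continuous (deriv (stepProfile m w)) :=
  contDiff_stepProfile.continuous_deriv (by simp)

theorem stepProfile_eq_zero (hw : 0 < w) {r : ℝ} (hr : r ≤ 0) : stepProfile m w r = 0 := by
  rw [stepProfile, smoothTransition.zero_of_nonpos (div_nonpos_of_nonpos_of_nonneg hr hw.le),
    mul_zero]

theorem stepProfile_eq (hw : 0 < w) {r : ℝ} (hr : w ≤ r) : stepProfile m w r = m := by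
  rw [stepProfile, smoothTransition.one_of_one_le ((one_le_div hw).2 hr), mul_one]

theorem stepProfile_nonneg (hm : 0 ≤ m) (r : ℝ) : 0 ≤ stepProfile m w r :=
  mul_nonneg hm (smoothTransition.nonneg _)

theorem stepProfile_le (hm : 0 ≤ m) (r : ℝ) : stepProfile m w r ≤ m := by
  exact mul_le_of_le_one_right hm (smoothTransition.le_one (r / w))

theorem monotone_stepProfile (hm : 0 ≤ m) (hw : 0 < w) : Monotone (stepProfile m w) :=
  fun a b h => mul_le_mul_of_nonneg_left (smoothTransition.monotone (by gcongr)) hm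

theorem deriv_stepProfile_nonneg (hm : 0 ≤ m) (hw : 0 < w) (r : ℝ) :
    0 ≤ deriv (stepProfile m w) r := (monotone_stepProfile hm hw).deriv_nonneg

theorem deriv_stepProfile_eq_zero (hm : 0 ≤ m) (hw : 0 < w) {r : ℝ} (hr : w ≤ r) :
    deriv (stepProfile m w) r = 0 := by
  refine IsLocalMax.deriv_eq_zero (Eventually.of_forall fun s => ?_)
  rw [stepProfile_eq hw hr]
  exact stepProfile_le hm s

theorem deriv_stepProfile_eq_zero_of_nonpos (hm : 0 ≤ m) (hw : 0 < w) {r : ℝ} (hr : r ≤ 0) :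
    deriv (stepProfile m w) r = 0 := by
  refine IsLocalMin.deriv_eq_zero (Eventually.of_forall fun s => ?_)
  rw [stepProfile_eq_zero hw hr]
  exact stepProfile_nonneg hm s

theorem exists_le_stepProfile_add (hm : 0 ≤ m) (hw : 0 < w) {ε : ℝ} (hε : 0 < ε) :
    ∃ δ > 0, ∀ s ∈ Icc 0 δ, ∀ r, stepProfile m w r + s * (deriv (stepProfile m w) r - ε) ≤
      stepProfile m w (r + s) := by
  have hs : ContDiff ℝ 1 (deriv (stepProfile m w)) :=
    (contDiff_infty_iff_deriv.1 contDiff_stepProfile).2.of_le (by norm_cast)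
  have hc : HasCompactSupport (deriv (stepProfile m w)) :=
    HasCompactSupport.of_support_subset_isCompact (isCompact_Icc (a := 0) (b := w)) fun r hr => by
      by_contra hn
      rw [mem_Icc, not_and_or, not_le, not_le] at hn
      exact hr (hn.elim (fun h => deriv_stepProfile_eq_zero_of_nonpos hm hw h.le)
        fun h => deriv_stepProfile_eq_zero hm hw h.le)
  obtain ⟨K, hK⟩ := ContDiff.lipschitzWith_of_hasCompactSupport hc hs (by norm_num)
  have hK0 : 0 ≤ (K : ℝ) := K.2
  refine ⟨ε / (K + 1), by positivity, fun s hs r => ?_⟩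
  rcases hs.1.eq_or_lt with h0 | h0
  · simp [← h0]
  obtain ⟨c, hc, hc'⟩ := exists_hasDerivAt_eq_slope (stepProfile m w) _ (by linarith : r < r + s)
    contDiff_stepProfile.continuous.continuousOn fun x _ => hasDerivAt_stepProfile x
  have h1 := hK.dist_le_mul c r
  rw [Real.dist_eq, Real.dist_eq, abs_of_pos (sub_pos.2 hc.1)] at h1
  have h2 : (K : ℝ) * (c - r) ≤ ε := by
    have : c - r ≤ ε / (K + 1) := by linarith [hc.2, hs.2]
    calc (K : ℝ) * (c - r) ≤ (K + 1) * (c - r) := by nlinarith [hc.1]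
      _ ≤ (K + 1) * (ε / (K + 1)) := by gcongr
      _ = ε := by field_simp
  have h3 := (abs_le.1 (h1.trans h2)).1
  rw [add_sub_cancel_left, eq_div_iff h0.ne'] at hc'
  nlinarith

end StepProfile

/-- A convex profile vanishing on `(-∞, c]` and of slope one on `[c + 1, ∞)`. -/
def rampProfile (c r : ℝ) : ℝ := (max (r - c) 0 ^ 2 - max (r - c - 1) 0 ^ 2) / 2

/-- The slope of `rampProfile`. -/
def rampSlope (c r : ℝ) : ℝ := max (r - c) 0 - max (r - c - 1) 0

section RampProfile

variable {c r : ℝ}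

theorem hasDerivAt_max_sq (r : ℝ) : HasDerivAt (fun r : ℝ => max r 0 ^ 2) (2 * max r 0) r := by
  rw [hasDerivAt_iff_isLittleO_nhds_zero]
  refine (Asymptotics.IsBigO.of_bound 1 (Eventually.of_forall fun h => ?_)).trans_isLittleO
    (Asymptotics.isLittleO_pow_id one_lt_two)
  rw [Real.norm_eq_abs, Real.norm_eq_abs, one_mul, smul_eq_mul, abs_of_nonneg (sq_nonneg h), abs_le]
  rcases max_cases (r + h) 0 with ⟨e1, e2⟩ | ⟨e1, e2⟩ <;>
    rcases max_cases r 0 with ⟨e3, e4⟩ | ⟨e3, e4⟩ <;> rw [e1, e3] <;> constructor <;> nlinarith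

theorem hasDerivAt_rampProfile (c r : ℝ) : HasDerivAt (rampProfile c) (rampSlope c r) r := by
  have h1 := (hasDerivAt_max_sq (r - c)).comp r ((hasDerivAt_id r).sub_const c)
  have h2 := (hasDerivAt_max_sq (r - c - 1)).comp r
    (((hasDerivAt_id r).sub_const c).sub_const 1)
  exact ((h1.sub h2).div_const 2).congr_deriv (by rw [rampSlope]; ring)

theorem continuous_rampProfile : Continuous (rampProfile c) := by unfold rampProfile; fun_prop

theorem continuous_rampSlope : Continuous (rampSlope c) := by unfold rampSlope; fun_prop

theorem rampProfile_eq_zero (h : r ≤ c) : rampProfile c r = 0 := by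
  rw [rampProfile, max_eq_right (by linarith), max_eq_right (by linarith)]; ring

theorem rampSlope_eq_zero (h : r ≤ c) : rampSlope c r = 0 := by
  rw [rampSlope, max_eq_right (by linarith), max_eq_right (by linarith)]; ring

theorem rampSlope_eq_one (h : c + 1 ≤ r) : rampSlope c r = 1 := by
  rw [rampSlope, max_eq_left (by linarith), max_eq_left (by linarith)]; ring

theorem rampProfile_nonneg : 0 ≤ rampProfile c r := by
  unfold rampProfile
  rcases max_cases (r - c) 0 with ⟨e1, e2⟩ | ⟨e1, e2⟩ <;>
    rcases max_cases (r - c - 1) 0 with ⟨e3, e4⟩ | ⟨e3, e4⟩ <;> rw [e1, e3] <;> nlinarith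

theorem rampProfile_pos (h : c < r) : 0 < rampProfile c r := by
  unfold rampProfile
  rw [max_eq_left (by linarith)]
  rcases max_cases (r - c - 1) 0 with ⟨e3, e4⟩ | ⟨e3, e4⟩ <;> rw [e3] <;> nlinarith

theorem sub_le_rampProfile : r - c - 1 / 2 ≤ rampProfile c r := by
  unfold rampProfile
  rcases max_cases (r - c) 0 with ⟨e1, e2⟩ | ⟨e1, e2⟩ <;>
    rcases max_cases (r - c - 1) 0 with ⟨e3, e4⟩ | ⟨e3, e4⟩ <;> rw [e1, e3] <;>
    nlinarith [sq_nonneg (r - c - 1)]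

theorem rampProfile_le (hc : 0 ≤ c) (hr : 0 ≤ r) : rampProfile c r ≤ r := by
  unfold rampProfile
  rcases max_cases (r - c) 0 with ⟨e1, e2⟩ | ⟨e1, e2⟩ <;>
    rcases max_cases (r - c - 1) 0 with ⟨e3, e4⟩ | ⟨e3, e4⟩ <;> rw [e1, e3] <;> nlinarith

theorem rampSlope_mul_sub_le (hc : 0 ≤ c) (h : c ≤ r) :
    rampSlope c r * r - rampProfile c r ≤ c + 1 / 2 := by
  unfold rampSlope rampProfile
  rw [max_eq_left (by linarith)]
  rcases max_cases (r - c - 1) 0 with ⟨e3, e4⟩ | ⟨e3, e4⟩ <;> rw [e3] <;> nlinarith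

end RampProfile

theorem hasGradientAt_quadForm (μ₁ μ₂ : ℝ) (x : R4) :
    HasGradientAt (quadForm μ₁ μ₂) (quadGrad μ₁ μ₂ x) x := by
  have hk : ∀ k, HasFDerivAt (fun x : R4 => x k ^ 2)
      ((2 * x k) • (EuclideanSpace.proj k : R4 →L[ℝ] ℝ)) x := fun k => by
    simpa using ((EuclideanSpace.proj k : R4 →L[ℝ] ℝ).hasFDerivAt (x := x)).pow 2
  have h := (((hk 0).add (hk 1)).const_mul μ₁).add (((hk 2).add (hk 3)).const_mul μ₂)
  rw [hasGradientAt_iff_hasFDerivAt]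
  refine HasFDerivAt.congr_fderiv (f := quadForm μ₁ μ₂) h ?_
  ext v
  simp [inner_R4, quadGrad_apply]
  ring

theorem continuous_quadForm (μ₁ μ₂ : ℝ) : Continuous (quadForm μ₁ μ₂) := by
  unfold quadForm; fun_prop

theorem quadForm_nonneg {μ₁ μ₂ : ℝ} (h₁ : 0 ≤ μ₁) (h₂ : 0 ≤ μ₂) (x : R4) :
    0 ≤ quadForm μ₁ μ₂ x := by
  unfold quadForm; positivity

/-- The Hamiltonian `f (γ - σ) + F (q)`, where `q` is a quadratic form. -/
def stretchedFun (μ₁ μ₂ C₀ w : ℝ) (γ : R4 → ℝ) (σ : ℝ) (x : R4) : ℝ :=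
  stepProfile (C₀ + 1) w (γ x - σ) + rampProfile C₀ (quadForm μ₁ μ₂ x)

/-- The gradient of `stretchedFun`. -/
def stretchedGrad (μ₁ μ₂ C₀ w : ℝ) (γ : R4 → ℝ) (γ' : R4 → R4) (σ : ℝ) (x : R4) : R4 :=
  deriv (stepProfile (C₀ + 1) w) (γ x - σ) • γ' x +
    rampSlope C₀ (quadForm μ₁ μ₂ x) • quadGrad μ₁ μ₂ x

section Stretched

variable {μ₁ μ₂ C₀ w σ₀ : ℝ} {γ : R4 → ℝ} {γ' : R4 → R4}

theorem HasGradientAt.stretchedFun {σ : ℝ} {x : R4} (hγ : HasGradientAt γ (γ' x) x) :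
    HasGradientAt (stretchedFun μ₁ μ₂ C₀ w γ σ) (stretchedGrad μ₁ μ₂ C₀ w γ γ' σ x) x := by
  rw [hasGradientAt_iff_hasFDerivAt] at hγ ⊢
  have h1 := (hasDerivAt_stepProfile (m := C₀ + 1) (w := w) (γ x - σ)).comp_hasFDerivAt x
    (hγ.sub_const σ)
  have h2 := (hasDerivAt_rampProfile C₀ (quadForm μ₁ μ₂ x)).comp_hasFDerivAt x
    (hasGradientAt_iff_hasFDerivAt.1 (hasGradientAt_quadForm μ₁ μ₂ x))
  refine HasFDerivAt.congr_fderiv (f := _root_.stretchedFun μ₁ μ₂ C₀ w γ σ) (h1.add h2) ?_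
  simp [stretchedGrad]

theorem isHamiltonianFamily_stretchedFun (hμ₁ : π < μ₁) (hμ₁' : μ₁ < 2 * π) (hμ₂ : 0 < μ₂)
    (hμ₂' : μ₂ < π) (hC₀ : 0 ≤ C₀) (hw : 0 < w) (hσ : σ₀ ≤ 1 - w)
    (hγ : ∀ x, HasGradientAt γ (γ' x) x) (hγ' : Continuous γ')
    (hone : ∀ x, C₀ < quadForm μ₁ μ₂ x → γ x = 1)
    {p : R4} (hp : γ p < σ₀) (hp' : quadForm μ₁ μ₂ p < C₀) :
    ∃ R, IsHamiltonianFamily μ₁ μ₂ C₀ σ₀ (1 - w) R (stretchedFun μ₁ μ₂ C₀ w γ)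
      (fun σ x => deriv (stepProfile (C₀ + 1) w) (γ x - σ)) (stretchedGrad μ₁ μ₂ C₀ w γ γ') := by
  have hm : 0 ≤ C₀ + 1 := by linarith
  have hγc : Continuous γ := continuous_iff_continuousAt.2 fun x =>
    (hasGradientAt_iff_hasFDerivAt.1 (hγ x)).continuousAt
  have hq := continuous_quadForm μ₁ μ₂
  have hd := continuous_deriv_stepProfile (m := C₀ + 1) (w := w)
  have hs := (contDiff_stepProfile (m := C₀ + 1) (w := w)).continuous
  have hr := continuous_rampProfile (c := C₀)
  have hr' := continuous_rampSlope (c := C₀)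
  have hq0 : ∀ x, 0 ≤ quadForm μ₁ μ₂ x := quadForm_nonneg (by linarith [pi_pos]) hμ₂.le
  refine ⟨√((C₀ + 1) / μ₂), hμ₁, hμ₁', hμ₂, hμ₂', hσ, ?_, ?_, ?_, fun σ x => (hγ x).stretchedFun,
    ?_, ?_, ?_, ?_, ?_, ?_⟩
  · unfold stretchedFun; fun_prop
  · fun_prop
  · unfold stretchedGrad; fun_prop
  · intro σ hσ x hx
    have h1 : C₀ + 1 ≤ quadForm μ₁ μ₂ x := by
      have h2 := quadForm_ge (c := μ₂) (by linarith) le_rfl x (μ₁ := μ₁)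
      have h3 := (Real.sqrt_le_left (norm_nonneg x)).1 hx
      rw [div_le_iff₀ hμ₂] at h3
      linarith
    rw [stretchedGrad, hone x (by linarith), deriv_stepProfile_eq_zero hm hw (by linarith [hσ.2]),
      rampSlope_eq_one h1]
    simp
  · exact fun σ _ x => add_nonneg (stepProfile_nonneg hm _) rampProfile_nonneg
  · intro σ hσ x
    rcases le_or_gt (quadForm μ₁ μ₂ x) C₀ with h | h
    · exact (sub_nonpos.2 h).trans (add_nonneg (stepProfile_nonneg hm _) rampProfile_nonneg)
    · rw [stretchedFun, hone x h, stepProfile_eq hw (by linarith [hσ.2])]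
      linarith [sub_le_rampProfile (c := C₀) (r := quadForm μ₁ μ₂ x)]
  · obtain ⟨δ, hδ, hball⟩ := Metric.eventually_nhds_iff_ball.1
      ((hγc.continuousAt.eventually_lt continuousAt_const hp).and
        (hq.continuousAt.eventually_lt continuousAt_const hp'))
    set A := C₀ + 1 + 4 * π * ‖p‖ ^ 2 with hA
    have hA0 : 0 ≤ A := by positivity
    refine ⟨A / δ ^ 4 + 4 * π / δ ^ 2, p, fun x => ?_⟩
    rcases lt_or_ge ‖x - p‖ δ with hx | hx
    · obtain ⟨h1, h2⟩ := hball x (by rwa [mem_ball, dist_eq_norm])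
      rw [stretchedFun, stepProfile_eq_zero hw (by linarith), rampProfile_eq_zero h2.le, add_zero]
      positivity
    · have h1 : quadForm μ₁ μ₂ x ≤ 2 * π * ‖x‖ ^ 2 := by
        rw [quadForm, norm_sq_R4]
        nlinarith [sq_nonneg (x 0), sq_nonneg (x 1), sq_nonneg (x 2), sq_nonneg (x 3), pi_pos]
      have h2 : ‖x‖ ^ 2 ≤ 2 * ‖x - p‖ ^ 2 + 2 * ‖p‖ ^ 2 := by
        have : ‖x‖ ≤ ‖x - p‖ + ‖p‖ := by simpa using norm_add_le (x - p) p
        nlinarith [sq_nonneg (‖x - p‖ - ‖p‖), norm_nonneg x]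
      have h3 : stretchedFun μ₁ μ₂ C₀ w γ σ₀ x ≤ A + 4 * π * ‖x - p‖ ^ 2 := by
        have := stepProfile_le (w := w) hm (γ x - σ₀)
        have := rampProfile_le hC₀ (hq0 x)
        rw [stretchedFun]
        nlinarith [pi_pos]
      have h4 : 1 ≤ ‖x - p‖ / δ := (one_le_div hδ).2 hx
      refine h3.trans ?_
      rw [add_mul]
      have e1 : A / δ ^ 4 * ‖x - p‖ ^ 4 = A * (‖x - p‖ / δ) ^ 4 := by field_simp
      have e2 : 4 * π / δ ^ 2 * ‖x - p‖ ^ 4 = 4 * π * ‖x - p‖ ^ 2 * (‖x - p‖ / δ) ^ 2 := by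
        field_simp
      rw [e1, e2]
      exact add_le_add (le_mul_of_one_le_right hA0 (one_le_pow₀ h4))
        (le_mul_of_one_le_right (by positivity) (one_le_pow₀ h4))
  · intro σ _ σ' _ h x
    exact add_le_add_left (monotone_stepProfile hm hw (by linarith)) _
  · intro ε hε
    obtain ⟨δ, hδ, h⟩ := exists_le_stepProfile_add hm hw hε
    refine ⟨δ, hδ, fun σ _ s hs _ x => ?_⟩
    have := h s hs (γ x - σ)
    rw [show γ x - σ + s = γ x - (σ - s) by ring] at this
    unfold stretchedFun
    linarith

end Stretched

theorem inner_J4_self (x : R4) : inner ℝ x (J4 x) = 0 := by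
  rw [real_inner_comm, inner_J4_left]; unfold omegaSt; ring

theorem inner_quadGrad_self (μ₁ μ₂ : ℝ) (x : R4) :
    1 / 2 * inner ℝ (quadGrad μ₁ μ₂ x) x = quadForm μ₁ μ₂ x := by
  rw [inner_R4, quadGrad_apply, quadForm]; simp; ring

theorem eq_of_hasDerivAt_zero {f : ℝ → ℝ} (h : ∀ t ∈ Icc (0:ℝ) 1, HasDerivAt f 0 t) {t : ℝ}
    (ht : t ∈ Icc (0:ℝ) 1) : f t = f 0 :=
  constant_of_has_deriv_right_zero (fun s hs => (h s hs).continuousAt.continuousWithinAt)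
    (fun s hs => (h s (Ico_subset_Icc_self hs)).hasDerivWithinAt) t ht

theorem HasGradientAt.comp_hasDerivAt {f : R4 → ℝ} {f' v : R4} {x : ℝ → R4} {t : ℝ}
    (hf : HasGradientAt f f' (x t)) (hx : HasDerivAt x v t) :
    HasDerivAt (fun t => f (x t)) (inner ℝ f' v) t := by
  exact ((hasGradientAt_iff_hasFDerivAt.1 hf).comp_hasDerivAt t hx).congr_deriv (by simp)

/-- A function equal to one outside an ellipsoid, with a value below `σ₀`, has a nontrivial
periodic Hamiltonian orbit inside the ellipsoid. -/
theorem exists_periodic_orbit {μ₁ μ₂ C₀ w σ₀ τ : ℝ} {γ : R4 → ℝ} {γ' : R4 → R4}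
    (hμ₁ : π < μ₁) (hμ₁' : μ₁ < 2 * π) (hμ₂ : 0 < μ₂)
    (hμ₂' : μ₂ < π) (hC₀ : 0 ≤ C₀) (hw : 0 < w) (hσ : σ₀ ≤ 1 - w)
    (hγ : ∀ x, HasGradientAt γ (γ' x) x) (hγ' : Continuous γ')
    (hone : ∀ x, C₀ < quadForm μ₁ μ₂ x → γ x = 1)
    {p : R4} (hp : γ p < σ₀) (hp' : quadForm μ₁ μ₂ p < C₀)
    (hτ₀ : 0 ≤ τ) (hτ : C₀ ≤ τ * (1 - w - σ₀)) :
    ∃ k, 0 < k ∧ k ≤ τ ∧ ∃ x : ℝ → R4, Continuous x ∧ x 0 = x 1 ∧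
      (∀ t ∈ Icc (0:ℝ) 1, quadForm μ₁ μ₂ (x t) ≤ C₀ ∧ HasDerivAt x (k • J4 (γ' (x t))) t) ∧
      ∃ t ∈ Icc (0:ℝ) 1, γ' (x t) ≠ 0 := by
  have hm : 0 ≤ C₀ + 1 := by linarith
  have hq0 : ∀ x, 0 ≤ quadForm μ₁ μ₂ x := quadForm_nonneg (by linarith [pi_pos]) hμ₂.le
  obtain ⟨R, hfam⟩ := isHamiltonianFamily_stretchedFun hμ₁ hμ₁' hμ₂ hμ₂' hC₀ hw hσ hγ hγ' hone hp hp'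
  by_contra hno
  refine absurd (hfam.mul_sub_lt hτ₀ ?_) (not_lt.2 hτ)
  intro σ hσ x hx hx01 hxd hact
  by_contra! hD
  have hγc : Continuous γ := continuous_iff_continuousAt.2 fun x =>
    (hasGradientAt_iff_hasFDerivAt.1 (hγ x)).continuousAt
  have hactle : ¬ ∀ t ∈ Icc (0:ℝ) 1, 1 / 2 * inner ℝ (stretchedGrad μ₁ μ₂ C₀ w γ γ' σ (x t)) (x t) -
      stretchedFun μ₁ μ₂ C₀ w γ σ (x t) ≤ 0 := by
    intro h
    refine absurd hact (not_lt.2 ?_)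
    rw [intervalIntegral.integral_of_le zero_le_one]
    exact setIntegral_nonpos measurableSet_Ioc fun t ht => h t (Ioc_subset_Icc_self ht)
  have hF : ∀ t ∈ Icc (0:ℝ) 1, rampProfile C₀ (quadForm μ₁ μ₂ (x t)) =
      rampProfile C₀ (quadForm μ₁ μ₂ (x 0)) := by
    intro t ht
    refine eq_of_hasDerivAt_zero (f := fun t => rampProfile C₀ (quadForm μ₁ μ₂ (x t)))
      (fun s hs => ?_) ht
    have h1 := (hasDerivAt_rampProfile C₀ (quadForm μ₁ μ₂ (x s))).comp s
      ((hasGradientAt_quadForm μ₁ μ₂ (x s)).comp_hasDerivAt (hxd s hs))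
    refine h1.congr_deriv ?_
    rcases le_or_gt (quadForm μ₁ μ₂ (x s)) C₀ with h | h
    · rw [rampSlope_eq_zero h, zero_mul]
    · rw [stretchedGrad, hone _ h, deriv_stepProfile_eq_zero hm hw (by linarith [hσ.2]), zero_smul,
        zero_add, map_smul, inner_smul_right, inner_J4_self, mul_zero, mul_zero]
  rcases le_or_gt (quadForm μ₁ μ₂ (x 0)) C₀ with h0 | h0
  swap
  · refine hactle fun t ht => ?_
    have h1 : C₀ < quadForm μ₁ μ₂ (x t) := by
      by_contra! hn
      have := hF t ht
      rw [rampProfile_eq_zero hn] at this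
      exact absurd this (rampProfile_pos h0).ne
    rw [stretchedGrad, stretchedFun, hone _ h1, deriv_stepProfile_eq_zero hm hw (by linarith [hσ.2]),
      zero_smul, zero_add, stepProfile_eq hw (by linarith [hσ.2]), inner_smul_left]
    have h2 := rampSlope_mul_sub_le hC₀ h1.le
    rw [← inner_quadGrad_self] at h2 ⊢
    simp only [conj_trivial]
    linarith
  have hle : ∀ t ∈ Icc (0:ℝ) 1, quadForm μ₁ μ₂ (x t) ≤ C₀ := fun t ht => by
    by_contra! hn
    have := hF t ht
    rw [rampProfile_eq_zero h0] at this
    exact absurd this (rampProfile_pos hn).ne'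
  have hG : ∀ t ∈ Icc (0:ℝ) 1, stretchedGrad μ₁ μ₂ C₀ w γ γ' σ (x t) =
      deriv (stepProfile (C₀ + 1) w) (γ (x t) - σ) • γ' (x t) := fun t ht => by
    rw [stretchedGrad, rampSlope_eq_zero (hle t ht), zero_smul, add_zero]
  have hconst : ∀ t ∈ Icc (0:ℝ) 1, γ (x t) = γ (x 0) := fun t ht =>
    eq_of_hasDerivAt_zero (f := fun t => γ (x t)) (fun s hs =>
      ((hγ (x s)).comp_hasDerivAt (hxd s hs)).congr_deriv (by
        rw [hG s hs, map_smul, inner_smul_right, inner_J4_self, mul_zero])) ht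
  set k := deriv (stepProfile (C₀ + 1) w) (γ (x 0) - σ) with hk
  have hk0 : 0 ≤ k := deriv_stepProfile_nonneg hm hw _
  have hG' : ∀ t ∈ Icc (0:ℝ) 1, stretchedGrad μ₁ μ₂ C₀ w γ γ' σ (x t) = k • γ' (x t) := fun t ht => by
    rw [hG t ht, hconst t ht]
  have hne : ¬ ∀ t ∈ Icc (0:ℝ) 1, stretchedGrad μ₁ μ₂ C₀ w γ γ' σ (x t) = 0 := fun h =>
    hactle fun t ht => by
      rw [h t ht, inner_zero_left]
      linarith [hfam.nonneg σ hσ (x t)]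
  push Not at hne
  obtain ⟨t, ht, htne⟩ := hne
  rw [hG' t ht] at htne
  refine hno ⟨k, hk0.lt_of_ne fun h => htne (by rw [← h, zero_smul]), ?_, x, hx, hx01,
    fun s hs => ⟨hle s hs, ?_⟩, t, ht, fun h => htne (by rw [h, smul_zero])⟩
  · refine le_trans (le_of_eq ?_) hD
    rw [intervalIntegral.integral_congr (g := fun _ => k)]
    · simp
    · intro s hs
      rw [uIcc_of_le zero_le_one] at hs
      simp only [hconst s hs, hk]
  · rw [← map_smul, ← hG' s hs]
    exact hxd s hs

/-- A stretched function with a small value has a periodic orbit of its Hamiltonian vector field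
with respect to the form `G ω + dG ∧ ω(Y, ·)`. -/
theorem IsStretching.exists_periodic_orbit {r R : ℝ} {G : R4 → ℝ} {Y Θ : R4 → R4}
    (h : IsStretching r R G Y Θ) {a τ : ℝ} {p : R4} (hp : G p < a) (ha : a < 1)
    (hτ : π * r ^ 2 < τ * (1 - a)) :
    ∃ k, 0 < k ∧ k ≤ τ ∧ ∃ y : ℝ → R4, Continuous y ∧ y 0 = y 1 ∧
      (∀ t ∈ Icc (0:ℝ) 1, ∃ v, HasDerivAt y v t ∧ ∀ w, G (y t) * omegaSt w v +
        (fderiv ℝ G (y t) w * omegaSt (Y (y t)) v - fderiv ℝ G (y t) v * omegaSt (Y (y t)) w) =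
          k * fderiv ℝ G (y t) w) ∧
      ∃ t ∈ Icc (0:ℝ) 1, fderiv ℝ G (y t) ≠ 0 := by
  have hpi := pi_pos
  have ha0 : 0 < a := (h.pos p).trans hp
  have hτ0 : 0 < τ := by
    by_contra! hn
    nlinarith [sq_nonneg r]
  obtain ⟨b, hb0, hΨ⟩ := h.exists_map
  obtain ⟨μ₁, hμ₁, hμ₁', hμr⟩ : ∃ μ₁, π < μ₁ ∧ μ₁ < 2 * π ∧ μ₁ * r ^ 2 < τ * (1 - a) := by
    have h1 : ∀ᶠ μ in 𝓝[>] π, μ * r ^ 2 < τ * (1 - a) :=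
      ((by fun_prop : Continuous fun μ : ℝ => μ * r ^ 2).continuousAt.eventually_lt
        continuousAt_const hτ).filter_mono nhdsWithin_le_nhds
    obtain ⟨μ, h2, h3, h4⟩ := (h1.and (Ioo_mem_nhdsGT (by linarith : π < 2 * π))).exists
    exact ⟨μ, h3, h4, h2⟩
  set s := τ * (1 - a) - μ₁ * r ^ 2 with hs
  have hs0 : 0 < s := sub_pos.2 hμr
  set K := (|R| + b) ^ 2 + 1 with hK
  have hK0 : 0 < K := by positivity
  set μ₂ := min (π / 2) (s / (2 * K)) with hμ₂d
  have hμ₂ : 0 < μ₂ := lt_min (by positivity) (by positivity)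
  have hμ₂' : μ₂ < π := (min_le_left _ _).trans_lt (by linarith)
  have hμK : μ₂ * K ≤ s / 2 := by
    calc μ₂ * K ≤ s / (2 * K) * K := by gcongr; exact min_le_right _ _
      _ = s / 2 := by field_simp
  set C₀ := μ₁ * r ^ 2 + s / 2 with hC₀
  have hC₀0 : 0 ≤ C₀ := by
    have : 0 ≤ μ₁ * r ^ 2 := mul_nonneg (by linarith) (sq_nonneg r)
    rw [hC₀]; linarith
  obtain ⟨Ψ, Ψ', hd, hc, hsurj, hnear, hid, hpull⟩ := hΨ √(C₀ / μ₂)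
  have hγone : ∀ x, C₀ ≤ quadForm μ₁ μ₂ x → G (Ψ x) = 1 := by
    intro x hx
    by_cases h1 : r ^ 2 ≤ x 0 ^ 2 + x 1 ^ 2
    · rw [hid x h1, h.eq_one_of_le x h1]
    · refine h.eq_one _ ?_
      have h2 : K ≤ ‖x‖ ^ 2 := by
        have h3 : μ₁ * (x 0 ^ 2 + x 1 ^ 2) ≤ μ₁ * r ^ 2 := by
          have := (not_le.1 h1).le
          gcongr
          linarith
        have h4 : s / 2 ≤ μ₂ * (x 2 ^ 2 + x 3 ^ 2) := by
          rw [quadForm] at hx; linarith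
        have h5 : K ≤ x 2 ^ 2 + x 3 ^ 2 := le_of_mul_le_mul_left (hμK.trans h4) hμ₂
        rw [norm_sq_R4]
        nlinarith [sq_nonneg (x 0), sq_nonneg (x 1)]
      have h6 : |R| + b ≤ ‖x‖ := le_of_sq_le_sq (by linarith) (norm_nonneg x)
      have h7 : ‖x‖ ≤ ‖Ψ x - x‖ + ‖Ψ x‖ := by
        have := norm_sub_le (Ψ x) (Ψ x - x)
        rw [sub_sub_cancel] at this
        linarith
      linarith [hnear x, le_abs_self R]
  set γ : R4 → ℝ := fun x => G (Ψ x) with hγd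
  set γ' : R4 → R4 := fun x =>
    (InnerProductSpace.toDual ℝ R4).symm ((fderiv ℝ G (Ψ x)).comp (Ψ' x)) with hγ'd
  have hγ : ∀ x, HasGradientAt γ (γ' x) x := fun x => by
    rw [hasGradientAt_iff_hasFDerivAt, hγ'd]
    simp only [LinearIsometryEquiv.apply_symm_apply]
    exact ((h.contDiff_fun.differentiable (by simp)) _).hasFDerivAt.comp x (hd x)
  have hΨc : Continuous Ψ := continuous_iff_continuousAt.2 fun x => (hd x).continuousAt
  have hγ'c : Continuous γ' := (InnerProductSpace.toDual ℝ R4).symm.continuous.comp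
    (((h.contDiff_fun.continuous_fderiv (by simp)).comp hΨc).clm_comp hc)
  have hγ'i : ∀ x v, inner ℝ (γ' x) v = fderiv ℝ G (Ψ x) (Ψ' x v) := fun x v => by
    rw [hγ'd, InnerProductSpace.toDual_symm_apply]; rfl
  obtain ⟨q, rfl⟩ := hsurj p
  have hq : quadForm μ₁ μ₂ q < C₀ := by
    by_contra! hn
    exact absurd (hγone q hn) (by linarith)
  obtain ⟨k, hk0, hkτ, x, hx, hx01, hxd, t, ht, htne⟩ := _root_.exists_periodic_orbit (τ := τ)
    (w := min (1 - a) (s / (2 * τ))) (σ₀ := a)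
    hμ₁ hμ₁' hμ₂ hμ₂' hC₀0 (lt_min (by linarith) (by positivity))
    (by linarith [min_le_left (1 - a) (s / (2 * τ))]) hγ hγ'c
    (fun x hx => hγone x hx.le) hp hq hτ0.le (by
      have h1 : τ * min (1 - a) (s / (2 * τ)) ≤ s / 2 := by
        calc τ * min (1 - a) (s / (2 * τ)) ≤ τ * (s / (2 * τ)) := by
              gcongr; exact min_le_right _ _
          _ = s / 2 := by field_simp
      nlinarith)
  refine ⟨k, hk0, hkτ, fun t => Ψ (x t), hΨc.comp hx, by simp only [hx01], fun t ht => ?_, t, ht,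
    fun h0 => htne ?_⟩
  · obtain ⟨hle, hder⟩ := hxd t ht
    refine ⟨_, (hd (x t)).comp_hasDerivAt t hder, fun w => ?_⟩
    have hL : ‖x t‖ ≤ √(C₀ / μ₂) := by
      refine Real.le_sqrt_of_sq_le ?_
      rw [le_div_iff₀ hμ₂]
      linarith [quadForm_ge (c := μ₂) (by linarith) le_rfl (x t) (μ₁ := μ₁)]
    have hinj : Function.Injective (Ψ' (x t)) := by
      rw [injective_iff_map_eq_zero]
      intro u hu
      have h1 := hpull (x t) hL u
      simp only [hu] at h1
      have h2 := h1 (J4 u)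
      have h3 : omegaSt u (J4 u) = ‖u‖ ^ 2 := by
        rw [← inner_J4_left, inner_J4_J4, real_inner_self_eq_norm_sq]
      have e1 : ∀ z, omegaSt 0 z = 0 := fun z => by simp [omegaSt]
      have e2 : ∀ z, omegaSt z 0 = 0 := fun z => by simp [omegaSt]
      rw [e1, map_zero, e2, h3] at h2
      simpa using h2.symm
    obtain ⟨u, rfl⟩ := (LinearMap.injective_iff_surjective
      (f := (Ψ' (x t) : R4 →ₗ[ℝ] R4))).1 hinj w
    have h1 := hpull (x t) hL u (k • J4 (γ' (x t)))
    have h2 : omegaSt u (k • J4 (γ' (x t))) = k * fderiv ℝ G (Ψ (x t)) (Ψ' (x t) u) := by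
      rw [omegaSt_smul_right, ← inner_J4_left, inner_J4_J4, real_inner_comm, hγ'i]
    rw [h2] at h1
    exact h1
  · rw [hγ'd]; simp only [h0]; simp

section Flow

variable {E : Type*} [NormedAddCommGroup E] [NormedSpace ℝ E]

theorem exists_integralCurve [CompleteSpace E] {X : E → E} {K L : NNReal} (hK : LipschitzWith K X)
    (hL : ∀ x, ‖X x‖ ≤ L) (p : E) :
    ∃ φ : ℝ → E, φ 0 = p ∧ ∀ t, HasDerivAt φ (X (φ t)) t := by
  have hloc : ∀ n : ℕ, ∃ γ : ℝ → E, γ 0 = p ∧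
      ∀ t ∈ Ioo (-(n + 1 : ℝ)) (n + 1), HasDerivAt γ (X (γ t)) t := by
    intro n
    have hn : (0:ℝ) < n + 1 := by positivity
    have h : IsPicardLindelof (fun _ => X) (⟨0, by constructor <;> linarith⟩ :
        Icc (-(n + 1 : ℝ)) (n + 1)) p (L * Real.toNNReal (n + 1)) 0 L K :=
      { lipschitzOnWith := fun t _ => hK.lipschitzOnWith
        continuousOn := fun x _ => continuousOn_const
        norm_le := fun t _ x _ => hL x
        mul_max_le := by simp }
    obtain ⟨γ, h0, hγ⟩ := h.exists_eq_forall_mem_Icc_hasDerivWithinAt₀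
    exact ⟨γ, h0, fun t ht => (hγ t (Ioo_subset_Icc_self ht)).hasDerivAt (Icc_mem_nhds ht.1 ht.2)⟩
  choose γ h0 hγ using hloc
  have huniq : ∀ m n : ℕ, m ≤ n → ∀ t ∈ Ioo (-(m + 1 : ℝ)) (m + 1), γ m t = γ n t := by
    intro m n hmn t ht
    have hm : (m:ℝ) ≤ n := by exact_mod_cast hmn
    have hm0 : (0:ℝ) ≤ m := m.cast_nonneg
    refine ODE_solution_unique_of_mem_Ioo (v := fun _ => X) (s := fun _ => univ) (K := K)
      (t₀ := 0) (fun _ _ => hK.lipschitzOnWith) ⟨by linarith, by linarith⟩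
      (fun s hs => ⟨hγ m s hs, mem_univ _⟩)
      (fun s hs => ⟨hγ n s ⟨by linarith [hs.1], by linarith [hs.2]⟩, mem_univ _⟩) ?_ ht
    rw [h0, h0]
  have habs : ∀ t : ℝ, t ∈ Ioo (-((⌈|t|⌉₊ : ℝ) + 1)) ((⌈|t|⌉₊ : ℝ) + 1) := fun t =>
    abs_lt.1 ((Nat.le_ceil |t|).trans_lt (lt_add_one _))
  refine ⟨fun t => γ ⌈|t|⌉₊ t, by simp [h0], fun t => ?_⟩
  refine (hγ _ t (habs t)).congr_of_eventuallyEq ?_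
  have h1 : ∀ᶠ s : ℝ in 𝓝 t, |s| < (⌈|t|⌉₊ : ℝ) + 1 :=
    continuous_abs.continuousAt.eventually_lt continuousAt_const
      ((Nat.le_ceil |t|).trans_lt (lt_add_one _))
  filter_upwards [h1] with s hs
  have h2 : ⌈|s|⌉₊ ≤ ⌈|t|⌉₊ + 1 := Nat.ceil_le.2 (by push_cast; exact hs.le)
  rw [huniq _ _ h2 s (habs s), huniq _ _ (Nat.le_succ ⌈|t|⌉₊) s (abs_lt.1 hs)]

/-- The trajectories of the complete vector field `X`. -/
structure IsGlobalFlow (X : E → E) (φ : E → ℝ → E) : Prop where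
  zero : ∀ p, φ p 0 = p
  hasDerivAt : ∀ p t, HasDerivAt (φ p) (X (φ p t)) t

theorem exists_isGlobalFlow [FiniteDimensional ℝ E] {X : E → E} (hX : ContDiff ℝ ∞ X)
    (hc : HasCompactSupport X) : ∃ φ K, IsGlobalFlow X φ ∧ LipschitzWith K X := by
  have := FiniteDimensional.complete ℝ E
  obtain ⟨K, hK⟩ := (hX.of_le (by norm_cast)).lipschitzWith_of_hasCompactSupport hc one_ne_zero
  obtain ⟨b, hb⟩ := hc.exists_bound_of_continuous hX.continuous
  have hb0 : 0 ≤ b := (norm_nonneg _).trans (hb 0)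
  choose φ h0 hφ using exists_integralCurve (L := ⟨b, hb0⟩) hK hb
  exact ⟨φ, K, ⟨h0, hφ⟩, hK⟩

namespace IsGlobalFlow

variable {X : E → E} {φ : E → ℝ → E} {K : NNReal}

theorem continuous (h : IsGlobalFlow X φ) (p : E) : Continuous (φ p) :=
  continuous_iff_continuousAt.2 fun t => (h.hasDerivAt p t).continuousAt

theorem eq_of_hasDerivAt (h : IsGlobalFlow X φ) (hK : LipschitzWith K X) {γ : ℝ → E}
    (hγ : ∀ t, HasDerivAt γ (X (γ t)) t) (t : ℝ) : γ t = φ (γ 0) t := by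
  have := ODE_solution_unique_univ (v := fun _ => X) (s := fun _ => univ) (K := K) (t₀ := 0)
    (f := γ) (g := φ (γ 0)) (fun _ => hK.lipschitzOnWith) (fun t => ⟨hγ t, mem_univ _⟩)
    (fun t => ⟨h.hasDerivAt _ t, mem_univ _⟩) (h.zero _).symm
  rw [this, h.zero]

theorem flow_add (h : IsGlobalFlow X φ) (hK : LipschitzWith K X) (p : E) (s t : ℝ) :
    φ p (t + s) = φ (φ p s) t := by
  have := h.eq_of_hasDerivAt hK (γ := fun t => φ p (t + s))
    (fun t => HasDerivAt.comp_add_const t s (h.hasDerivAt p (t + s))) t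
  simpa using this

theorem dist_le (h : IsGlobalFlow X φ) (hK : LipschitzWith K X) (p q : E) {t : ℝ} (ht : 0 ≤ t) :
    dist (φ p t) (φ q t) ≤ dist p q * exp (K * t) := by
  have := dist_le_of_trajectories_ODE (v := fun _ => X) (K := K) (a := 0) (b := t)
    (δ := dist p q) (f := φ p) (g := φ q) (fun _ => hK) (h.continuous p).continuousOn
    (fun t _ => (h.hasDerivAt p t).hasDerivWithinAt) (h.continuous q).continuousOn
    (fun t _ => (h.hasDerivAt q t).hasDerivWithinAt) (by rw [h.zero, h.zero]) t ⟨ht, le_rfl⟩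
  simpa using this

theorem flow_nat_mul (h : IsGlobalFlow X φ) (hK : LipschitzWith K X) {p : E} {T : ℝ}
    (hT : φ p T = p) (n : ℕ) : φ p (n * T) = p := by
  induction n with
  | zero => simp [h.zero]
  | succ n ih => rw [Nat.cast_succ, add_mul, one_mul, h.flow_add hK, hT, ih]

theorem exists_period_mem (h : IsGlobalFlow X φ) (hK : LipschitzWith K X) {p : E} {T τ : ℝ}
    (hT : φ p T = p) (hT0 : 0 < T) (hTτ : T ≤ τ) : ∃ S ∈ Icc (τ / 2) τ, φ p S = p := by
  refine ⟨⌊τ / T⌋₊ * T, ⟨?_, ?_⟩, h.flow_nat_mul hK hT _⟩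
  · have h1 : (1:ℝ) ≤ ⌊τ / T⌋₊ := by
      exact_mod_cast (Nat.one_le_floor_iff _).2 ((one_le_div hT0).2 hTτ)
    have h2 := Nat.lt_floor_add_one (τ / T)
    rw [div_lt_iff₀ hT0] at h2
    nlinarith
  · have := Nat.floor_le (div_nonneg (hT0.le.trans hTτ) hT0.le)
    rwa [le_div_iff₀ hT0] at this

/-- Closed orbits accumulate at closed orbits. -/
theorem exists_closed_orbit_of_seq (h : IsGlobalFlow X φ) (hK : LipschitzWith K X) {C : Set E}
    (hC : IsCompact C) {p : ℕ → E} {T : ℕ → ℝ} {τ : ℝ} (hp : ∀ n, p n ∈ C)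
    (hT : ∀ n, 0 < T n ∧ T n ≤ τ) (hφ : ∀ n, φ (p n) (T n) = p n) :
    ∃ q ∈ C, ∃ S, 0 < S ∧ S ≤ τ ∧ φ q S = q ∧
      ∃ k : ℕ → ℕ, StrictMono k ∧ Tendsto (p ∘ k) atTop (𝓝 q) := by
  have hτ : 0 < τ := (hT 0).1.trans_le (hT 0).2
  choose S hS hφS using fun n => h.exists_period_mem hK (hφ n) (hT n).1 (hT n).2
  obtain ⟨⟨q, s⟩, hqs, k, hk, hlim⟩ := (hC.prod isCompact_Icc).tendsto_subseq
    (x := fun n => (p n, S n)) (s := C ×ˢ Icc (τ / 2) τ) fun n => ⟨hp n, hS n⟩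
  have hs0 : 0 < s := by have := hqs.2.1; dsimp only at this; linarith
  have hlp : Tendsto (p ∘ k) atTop (𝓝 q) := (continuous_fst.tendsto _).comp hlim
  have hls : Tendsto (S ∘ k) atTop (𝓝 s) := (continuous_snd.tendsto _).comp hlim
  refine ⟨q, hqs.1, s, hs0, hqs.2.2, ?_, k, hk, hlp⟩
  have h1 : Tendsto (fun n => φ q (S (k n))) atTop (𝓝 (φ q s)) :=
    ((h.continuous q).tendsto s).comp hls
  have h2 : Tendsto (fun n => dist (p (k n)) q * exp (K * τ)) atTop (𝓝 0) := by
    have := (tendsto_iff_dist_tendsto_zero.1 hlp).mul_const (exp (K * τ))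
    simpa using this
  have h3 : Tendsto (fun n => dist (p (k n)) (φ q (S (k n)))) atTop (𝓝 0) := by
    refine squeeze_zero (fun _ => dist_nonneg) (fun n => ?_) h2
    have hSn := hS (k n)
    have hS0 : 0 ≤ S (k n) := by linarith [hSn.1]
    calc dist (p (k n)) (φ q (S (k n))) = dist (φ (p (k n)) (S (k n))) (φ q (S (k n))) := by
          rw [hφS]
      _ ≤ dist (p (k n)) q * exp (K * S (k n)) := h.dist_le hK _ _ hS0
      _ ≤ dist (p (k n)) q * exp (K * τ) := by gcongr; exact hSn.2
  have h4 : Tendsto (fun n => dist (p (k n)) (φ q (S (k n)))) atTop (𝓝 (dist q (φ q s))) :=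
    hlp.dist h1
  exact (dist_eq_zero.1 (tendsto_nhds_unique h4 h3)).symm

theorem contDiff (h : IsGlobalFlow X φ) (hX : ContDiff ℝ ∞ X) (p : E) : ContDiff ℝ ∞ (φ p) := by
  rw [contDiff_infty]
  intro n
  induction n with
  | zero => exact contDiff_zero.2 (h.continuous p)
  | succ n ih =>
    rw [Nat.cast_succ, contDiff_succ_iff_deriv]
    refine ⟨fun t => (h.hasDerivAt p t).differentiableAt, by simp, ?_⟩
    have : deriv (φ p) = fun t => X (φ p t) := funext fun t => (h.hasDerivAt p t).deriv
    rw [this]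
    exact (hX.of_le (by exact_mod_cast le_top)).comp ih

/-- A time change of a trajectory of `X` follows a trajectory. -/
theorem eq_of_hasDerivAt_smul (h : IsGlobalFlow X φ) (hK : LipschitzWith K X) {y : ℝ → E}
    {m : ℝ → ℝ} (hm : Continuous m) {κ : ℝ} (hκ : ∀ t ∈ Icc (0:ℝ) 1, |m t| ≤ κ)
    (hy : ∀ t ∈ Icc (0:ℝ) 1, HasDerivAt y (m t • X (y t)) t) {t : ℝ} (ht : t ∈ Icc (0:ℝ) 1) :
    y t = φ (y 0) (∫ u in (0:ℝ)..t, m u) := by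
  set s : ℝ → ℝ := fun t => ∫ u in (0:ℝ)..t, m u with hs
  have hsd : ∀ t, HasDerivAt s (m t) t := fun t =>
    intervalIntegral.integral_hasDerivAt_right (hm.intervalIntegrable _ _)
      (hm.stronglyMeasurableAtFilter _ _) hm.continuousAt
  have hκ0 : 0 ≤ κ := (abs_nonneg _).trans (hκ 0 ⟨le_rfl, zero_le_one⟩)
  have hl : ∀ t ∈ Ico (0:ℝ) 1, LipschitzOnWith (κ.toNNReal * K) (fun x => m t • X x) univ := by
    intro t ht
    refine (LipschitzWith.of_dist_le_mul fun x z => ?_).lipschitzOnWith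
    rw [dist_smul₀, NNReal.coe_mul, Real.coe_toNNReal _ hκ0, mul_assoc]
    exact mul_le_mul (hκ t (Ico_subset_Icc_self ht)) (hK.dist_le_mul x z) dist_nonneg hκ0
  have hγ : ∀ t, HasDerivAt (fun t => φ (y 0) (s t)) (m t • X (φ (y 0) (s t))) t := fun t =>
    (h.hasDerivAt (y 0) (s t)).scomp t (hsd t)
  have := ODE_solution_unique_of_mem_Icc_right (v := fun t x => m t • X x) (s := fun _ => univ)
    (f := y) (g := fun t => φ (y 0) (s t)) (a := 0) (b := 1) hl
    (fun t ht => (hy t ht).continuousAt.continuousWithinAt)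
    (fun t ht => (hy t (Ico_subset_Icc_self ht)).hasDerivWithinAt) (fun _ _ => mem_univ _)
    (fun t _ => (hγ t).continuousAt.continuousWithinAt) (fun t _ => (hγ t).hasDerivWithinAt)
    (fun _ _ => mem_univ _) (by simp [hs, h.zero])
  exact this ht

end IsGlobalFlow

end Flow

theorem ContDiffOn.bump_smul {E F : Type*} [NormedAddCommGroup E] [NormedSpace ℝ E]
    [NormedAddCommGroup F] [NormedSpace ℝ F] {V : Set E} {f : E → F} {b : E → ℝ}
    (hf : ContDiffOn ℝ ∞ f V) (hV : IsOpen V) (hb : ContDiff ℝ ∞ b) (hbV : tsupport b ⊆ V) :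
    ContDiff ℝ ∞ fun x => b x • f x := by
  rw [contDiff_iff_contDiffAt]
  intro x
  by_cases hx : x ∈ tsupport b
  · exact hb.contDiffAt.smul (hf.contDiffAt (hV.mem_nhds (hbV hx)))
  · have : (fun x => b x • f x) =ᶠ[𝓝 x] fun _ => 0 := by
      filter_upwards [notMem_tsupport_iff_eventuallyEq.1 hx] with z hz
      simp [hz]
    exact contDiffAt_const.congr_of_eventuallyEq this

theorem IsCompact.exists_contDiff_eq_one_nhds {M V : Set R4} (hM : IsCompact M) (hV : IsOpen V)
    (hMV : M ⊆ V) : ∃ W, IsOpen W ∧ M ⊆ W ∧ W ⊆ V ∧ ∃ b : R4 → ℝ, ContDiff ℝ ∞ b ∧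
      HasCompactSupport b ∧ tsupport b ⊆ V ∧ ∀ x ∈ W, b x = 1 := by
  obtain ⟨K₂, hK₂, hMK₂, hK₂V⟩ := exists_compact_between hM hV hMV
  obtain ⟨K₁, hK₁, hMK₁, hK₁K₂⟩ := exists_compact_between hM isOpen_interior hMK₂
  obtain ⟨b, hb, -, hsupp, hone⟩ := exists_contMDiff_support_eq_eq_one_iff (n := (⊤ : ℕ∞))
    (modelWithCornersSelf ℝ R4) (isOpen_interior (s := K₂)) hK₁.isClosed hK₁K₂
  have hts : tsupport b ⊆ K₂ := by
    rw [tsupport, hsupp]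
    exact closure_minimal interior_subset hK₂.isClosed
  exact ⟨interior K₁, isOpen_interior, hMK₁,
    interior_subset.trans (hK₁K₂.trans (interior_subset.trans hK₂V)), b, hb.contDiff,
    hK₂.of_isClosed_subset (isClosed_tsupport b) hts, hts.trans hK₂V,
    fun x hx => (hone x).1 (interior_subset hx)⟩

/-- A Liouville field `Z` transverse to the hypersurface `M = g⁻¹(0)` near `M`, the sign `σ` of
`dg(Z)` and its inverse `κ`, extended smoothly from the neighbourhood `W` of `M`. -/
structure IsContactData (g : R4 → ℝ) (M W : Set R4) (Z : R4 → R4) (σ κ : R4 → ℝ) : Prop where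
  contDiff_fun : ContDiff ℝ ∞ g
  isOpen : IsOpen W
  subset : M ⊆ W
  mem_iff : ∀ x, x ∈ M ↔ g x = 0
  contDiff_field : ContDiff ℝ ∞ Z
  liouville : ∀ x ∈ W, ∀ u v : R4,
    omegaSt (fderiv ℝ Z x u) v + omegaSt u (fderiv ℝ Z x v) = omegaSt u v
  contDiff_sign : ContDiff ℝ ∞ σ
  hasCompactSupport_sign : HasCompactSupport σ
  sign_pos : ∀ x ∈ W, 0 < σ x * fderiv ℝ g x (Z x)
  fderiv_sign : ∀ x ∈ W, fderiv ℝ σ x = 0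
  contDiff_factor : ContDiff ℝ ∞ κ
  hasCompactSupport_factor : HasCompactSupport κ
  factor : ∀ x ∈ W, κ x * fderiv ℝ g x (Z x) = 1

theorem exists_isContactData {g : R4 → ℝ} (hg : ContDiff ℝ ∞ g) {M : Set R4} (hM : M = g ⁻¹' {0})
    (hMcpt : IsCompact M) {U : Set R4} (hU : IsOpen U) (hMU : M ⊆ U)
    {Y : R4 → R4} (hY : ContDiffOn ℝ ∞ Y U)
    (hLiou : ∀ x ∈ U, ∀ u v : R4,
      omegaSt (fderiv ℝ Y x u) v + omegaSt u (fderiv ℝ Y x v) = omegaSt u v)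
    (htrans : ∀ x ∈ M, fderiv ℝ g x (Y x) ≠ 0) :
    ∃ W Z σ κ, IsContactData g M W Z σ κ ∧ ∀ x ∈ M, Z x = Y x := by
  set d : R4 → ℝ := fun x => fderiv ℝ g x (Y x) with hd
  have hdc : ContDiffOn ℝ ∞ d U :=
    (hg.fderiv_right (m := ∞) (by simp)).contDiffOn.clm_apply hY
  set V := U ∩ d ⁻¹' {0}ᶜ with hVd
  have hV : IsOpen V := hdc.continuousOn.isOpen_inter_preimage hU isOpen_compl_singleton
  have hMV : M ⊆ V := fun x hx => ⟨hMU hx, htrans x hx⟩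
  obtain ⟨W, hW, hMW, hWV, b, hb, hbc, hbV, hb1⟩ := hMcpt.exists_contDiff_eq_one_nhds hV hMV
  have hVU : V ⊆ U := inter_subset_left
  have hsmul : ∀ f : R4 → ℝ, HasCompactSupport fun x => b x • f x := fun f =>
    hbc.mono fun x hx h => hx (by simp [h])
  have hZ : ∀ x ∈ W, (fun x => b x • Y x) x = Y x := fun x hx => by simp [hb1 x hx]
  refine ⟨W, fun x => b x • Y x, fun x => b x • (d x / |d x|), fun x => b x • (d x)⁻¹,
    { contDiff_fun := hg
      isOpen := hW
      subset := hMW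
      mem_iff := fun x => by rw [hM]; rfl
      contDiff_field := (hY.mono hVU).bump_smul hV hb hbV
      liouville := ?_
      contDiff_sign := ContDiffOn.bump_smul (fun x hx => ContDiffAt.contDiffWithinAt
        ((hdc.contDiffAt (hU.mem_nhds hx.1)).div
          ((hdc.contDiffAt (hU.mem_nhds hx.1)).abs hx.2) (abs_ne_zero.2 hx.2))) hV hb hbV
      hasCompactSupport_sign := hsmul _
      sign_pos := ?_
      fderiv_sign := ?_
      contDiff_factor := ((hdc.mono hVU).inv fun x hx => hx.2).bump_smul hV hb hbV
      hasCompactSupport_factor := hsmul _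
      factor := ?_ }, fun x hx => hZ x (hMW hx)⟩
  · intro x hx u v
    have : (fun x => b x • Y x) =ᶠ[𝓝 x] Y := by
      filter_upwards [hW.mem_nhds hx] with z hz using hZ z hz
    rw [this.fderiv_eq]
    exact hLiou x (hVU (hWV hx)) u v
  · intro x hx
    have h0 : d x ≠ 0 := (hWV hx).2
    simp only [hb1 x hx, one_smul]
    change 0 < d x / |d x| * d x
    rw [div_mul_eq_mul_div, ← sq]
    positivity
  · intro x hx
    have h0 : d x ≠ 0 := (hWV hx).2
    have hdx : ContinuousAt d x := (hdc.contDiffAt (hU.mem_nhds (hVU (hWV hx)))).continuousAt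
    have : (fun x => b x • (d x / |d x|)) =ᶠ[𝓝 x] fun _ => d x / |d x| := by
      rcases lt_or_gt_of_ne h0 with h | h
      · filter_upwards [hW.mem_nhds hx, hdx.eventually_lt continuousAt_const h] with z hz hz0
        rw [hb1 z hz, one_smul, abs_of_neg h, abs_of_neg hz0, div_neg, div_neg, div_self h.ne,
          div_self hz0.ne]
      · filter_upwards [hW.mem_nhds hx, continuousAt_const.eventually_lt hdx h] with z hz hz0
        rw [hb1 z hz, one_smul, abs_of_pos h, abs_of_pos hz0, div_self h.ne', div_self hz0.ne']
    rw [this.fderiv_eq]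
    simp
  · intro x hx
    have h0 : d x ≠ 0 := (hWV hx).2
    simp only [hb1 x hx, one_smul]
    exact inv_mul_cancel₀ h0

/-- A compactly supported closed one-form has a primitive, which vanishes on all rays and outside
all balls avoiding the support. -/
theorem exists_primitive {ζ : R4 → R4 →L[ℝ] ℝ} (hζ : ContDiff ℝ ∞ ζ) (hc : HasCompactSupport ζ)
    (hcl : ∀ x u v, fderiv ℝ ζ x u v = fderiv ℝ ζ x v u) :
    ∃ ρ : R4 → ℝ, ContDiff ℝ ∞ ρ ∧ (∀ x, fderiv ℝ ρ x = ζ x) ∧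
      (∀ r : ℝ, (∀ x : R4, r ≤ x 0 ^ 2 + x 1 ^ 2 → ζ x = 0) →
        ∀ x : R4, r ≤ x 0 ^ 2 + x 1 ^ 2 → ρ x = 0) ∧
      ∀ R : ℝ, 0 ≤ R → (∀ x, R ≤ ‖x‖ → ζ x = 0) → ∀ x, R ≤ ‖x‖ → ρ x = 0 := by
  set e : R4 := EuclideanSpace.single 2 1 with he
  have hen : ‖e‖ = 1 := by simp [he]
  have hζv : ∀ v, ContDiff ℝ ∞ fun x => ζ x v := fun v => hζ.clm_apply contDiff_const
  have hcv : ∀ v, HasCompactSupport fun x => ζ x v := fun v =>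
    hc.mono fun x hx h => hx (by simp [h])
  have hdv : ∀ v x u, fderiv ℝ (fun y => ζ y v) x u = fderiv ℝ ζ x u v := fun v x u => by
    have e1 : HasFDerivAt (fun y => ζ y v) _ x :=
      (hζ.differentiable (by simp) x).hasFDerivAt.clm_apply (hasFDerivAt_const v x)
    rw [e1.fderiv]; simp
  set ρ := rayIntegral e fun x => ζ x e with hρ
  have hdρ : ∀ x, fderiv ℝ ρ x = ζ x := by
    intro x
    ext v
    rw [hρ, fderiv_rayIntegral hen (hζv e) (hcv e)]
    simp only [hdv, hcl _ v e]
    simp only [← hdv]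
    exact rayIntegral_fderiv_self hen (hζv v) (hcv v) x
  have hρs : ContDiff ℝ ∞ ρ := contDiff_rayIntegral hen (hζv e) (hcv e)
  refine ⟨ρ, hρs, hdρ, fun r hr x hx => ?_, fun R hR0 hR x hx => ?_⟩
  · refine rayIntegral_eq_zero fun τ => ?_
    rw [hr _ (by simpa [he] using hx)]; simp
  · obtain ⟨s, hs, hs3⟩ : ∃ s : ℝ, s ^ 2 = 1 ∧ 0 ≤ s * x 3 := by
      rcases le_total 0 (x 3) with h | h
      · exact ⟨1, by norm_num, by linarith⟩
      · exact ⟨-1, by norm_num, by linarith⟩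
    set w : R4 := EuclideanSpace.single 3 s with hw
    have hwn : ∀ t : ℝ, 0 ≤ t → R ≤ ‖x + t • w‖ := by
      intro t ht
      refine hx.trans (le_of_sq_le_sq ?_ (norm_nonneg _))
      rw [norm_sq_R4, norm_sq_R4]
      simp [hw]
      nlinarith [mul_nonneg ht hs3, sq_nonneg t]
    have h1 := eq_of_hasDerivAt_zero (f := fun t => ρ (x + (t * R) • w)) (fun t ht => by
      have e1 : HasDerivAt (fun t : ℝ => x + (t * R) • w) (R • w) t := by
        have := (((hasDerivAt_id t).mul_const R).smul_const w).const_add x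
        simpa using this
      have e2 := (hρs.differentiable (by simp) (x + (t * R) • w)).hasFDerivAt.comp_hasDerivAt t e1
      exact e2.congr_deriv (by
        rw [hdρ, hR _ (hwn _ (mul_nonneg ht.1 hR0))]; simp)) (t := 1) ⟨zero_le_one, le_rfl⟩
    have h2 : ρ (x + (1 * R) • w) = 0 := by
      refine rayIntegral_eq_zero fun τ => ?_
      rw [hR]
      · simp
      · refine le_of_sq_le_sq ?_ (norm_nonneg _)
        rw [norm_sq_R4]
        have : (x + (1 * R) • w - τ • e) 3 = x 3 + R * s := by simp [hw, he]
        rw [this]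
        nlinarith [sq_nonneg ((x + (1 * R) • w - τ • e) 0), sq_nonneg ((x + (1 * R) • w - τ • e) 1),
          sq_nonneg ((x + (1 * R) • w - τ • e) 2), mul_nonneg hR0 hs3, sq_nonneg (x 3)]
    simp only [zero_mul, zero_smul, add_zero] at h1
    rw [← h1, h2]

namespace IsContactData

variable {g : R4 → ℝ} {M W : Set R4} {Z : R4 → R4} {σ κ : R4 → ℝ}

theorem exists_isShellPotential (h : IsContactData g M W Z σ κ) (hMne : M.Nonempty) {r : ℝ}
    (hr : ∀ x ∈ M, x 0 ^ 2 + x 1 ^ 2 < r ^ 2) {ε : ℝ} (hε : 0 < ε) :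
    ∃ R ρ, IsShellPotential r R ρ Z ∧
      (∀ x, fderiv ℝ ρ x ≠ 0 → x ∈ W ∧ x ∈ tsupport σ ∧ |g x| < ε) ∧
      ∀ x, ∃ c : ℝ, fderiv ℝ ρ x = c • fderiv ℝ g x := by
  have hg := h.contDiff_fun
  set N := W ∩ {x : R4 | x 0 ^ 2 + x 1 ^ 2 < r ^ 2} with hN
  have hNo : IsOpen N := h.isOpen.inter (isOpen_lt (by fun_prop) (by fun_prop))
  obtain ⟨δ, hδ, hδN⟩ : ∃ δ, 0 < δ ∧ ∀ x ∈ tsupport σ, x ∉ N → δ ≤ |g x| := by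
    have hK : IsCompact (tsupport σ \ N) := IsCompact.diff h.hasCompactSupport_sign hNo
    rcases (tsupport σ \ N).eq_empty_or_nonempty with he | hne
    · exact ⟨1, one_pos, fun x hx hn => absurd (he ▸ ⟨hx, hn⟩ : x ∈ (∅ : Set R4)) (notMem_empty x)⟩
    · obtain ⟨x₀, hx₀, hmin⟩ := hK.exists_isMinOn hne hg.continuous.abs.continuousOn
      refine ⟨|g x₀|, abs_pos.2 fun h0 => hx₀.2 ?_, fun x hx hn => hmin ⟨hx, hn⟩⟩
      have := (h.mem_iff x₀).2 h0
      exact ⟨h.subset this, hr x₀ this⟩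
  have hη : 0 < min δ ε := lt_min hδ hε
  let ψ : ContDiffBump (0:ℝ) := ⟨min δ ε / 2, min δ ε, by linarith, by linarith⟩
  have hψ : ∀ x, ψ (g x) ≠ 0 → |g x| < min δ ε := by
    intro x hx
    have : g x ∈ Function.support ψ := hx
    rw [ψ.support_eq] at this
    simpa [ψ] using this
  have hψ1 : ψ 0 = 1 := ψ.one_of_mem_closedBall (mem_closedBall_self ψ.rIn_pos.le)
  set θ : R4 → ℝ := fun x => ψ (g x) * σ x with hθ
  have hψg : ContDiff ℝ ∞ fun x => ψ (g x) := ψ.contDiff.comp hg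
  have hθs : ContDiff ℝ ∞ θ := hψg.mul h.contDiff_sign
  have hθN : ∀ x, θ x ≠ 0 → x ∈ N ∧ x ∈ tsupport σ ∧ |g x| < ε := by
    intro x hx
    have h1 := hψ x (left_ne_zero_of_mul hx)
    have h2 : x ∈ tsupport σ := subset_tsupport _ (right_ne_zero_of_mul hx)
    refine ⟨?_, h2, h1.trans_le (min_le_right _ _)⟩
    by_contra hn
    exact absurd (hδN x h2 hn) (not_le.2 (h1.trans_le (min_le_left _ _)))
  have hσψ : ∀ x, ψ (g x) • fderiv ℝ σ x = 0 := by
    intro x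
    by_cases h0 : ψ (g x) = 0
    · rw [h0, zero_smul]
    have h1 := (hψ x h0).trans_le (min_le_left _ _)
    by_cases h2 : x ∈ tsupport σ
    · have h3 : x ∈ N := by
        by_contra hn
        exact absurd (hδN x h2 hn) (not_le.2 h1)
      rw [h.fderiv_sign x h3.1, smul_zero]
    · rw [(notMem_tsupport_iff_eventuallyEq.1 h2).fderiv_eq]
      simp
  have hdθ : ∀ x, fderiv ℝ θ x = (σ x * deriv ψ (g x)) • fderiv ℝ g x := by
    intro x
    have e1 : HasFDerivAt (fun x => ψ (g x)) (deriv ψ (g x) • fderiv ℝ g x) x :=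
      ((ψ.contDiff (n := 1)).differentiable (by simp) (g x)).hasDerivAt.comp_hasFDerivAt x
        (hg.differentiable (by simp) x).hasFDerivAt
    have e2 : HasFDerivAt θ _ x :=
      e1.mul (h.contDiff_sign.differentiable (by simp) x).hasFDerivAt
    rw [e2.fderiv, hσψ, zero_add, smul_smul]
  have hdg : ContDiff ℝ ∞ (fderiv ℝ g) := hg.fderiv_right (m := ∞) (by simp)
  set ζ : R4 → R4 →L[ℝ] ℝ := fun x => θ x • fderiv ℝ g x with hζ
  have hζs : ContDiff ℝ ∞ ζ := hθs.smul hdg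
  have hζ0 : ∀ x, ζ x ≠ 0 → θ x ≠ 0 := fun x hx h0 => hx (by simp [hζ, h0])
  have hζc : HasCompactSupport ζ := h.hasCompactSupport_sign.mono fun x hx h0 =>
    hx (by simp [hζ, hθ, h0])
  have hζd : ∀ x u v, fderiv ℝ ζ x u v = θ x * fderiv ℝ (fderiv ℝ g) x u v +
      σ x * deriv ψ (g x) * fderiv ℝ g x u * fderiv ℝ g x v := by
    intro x u v
    have e1 : HasFDerivAt ζ _ x := (hθs.differentiable (by simp) x).hasFDerivAt.smul
      (hdg.differentiable (by simp) x).hasFDerivAt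
    rw [e1.fderiv, hdθ]
    simp
  have hsym : ∀ x u v, fderiv ℝ (fderiv ℝ g) x u v = fderiv ℝ (fderiv ℝ g) x v u := fun x u v =>
    second_derivative_symmetric (fun y => (hg.differentiable (by simp) y).hasFDerivAt)
      (hdg.differentiable (by simp) x).hasFDerivAt u v
  obtain ⟨ρ, hρ, hdρ, hρr, hρR⟩ := exists_primitive hζs hζc fun x u v => by
    rw [hζd, hζd, hsym x u v]; ring
  obtain ⟨R, hR⟩ := hζc.isCompact.isBounded.subset_ball (0:R4)
  refine ⟨max R 0, ρ,
    { contDiff_fun := hρ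
      contDiff_field := h.contDiff_field
      eq_zero := hρR _ (le_max_right _ _) fun x hx => ?_
      eq_zero_of_le := hρr _ fun x hx => ?_
      liouville := fun x => ?_
      nonneg := fun x => ?_
      pos := ?_ }, fun x hx => ?_, fun x => ⟨θ x, hdρ x⟩⟩
  · refine image_eq_zero_of_notMem_tsupport fun hn => ?_
    have := hR hn
    rw [mem_ball_zero_iff] at this
    exact absurd ((le_max_left _ _).trans hx) (not_le.2 this)
  · by_contra h0
    exact absurd hx (not_le.2 (hθN x (hζ0 x h0)).1.2)
  · rw [hdρ]
    by_cases h0 : ζ x = 0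
    · exact Or.inl h0
    · exact Or.inr (h.liouville x (hθN x (hζ0 x h0)).1.1)
  · rw [hdρ]
    by_cases h0 : θ x = 0
    · simp [hζ, h0]
    · change 0 ≤ ψ (g x) * σ x * fderiv ℝ g x (Z x)
      rw [mul_assoc]
      exact mul_nonneg ψ.nonneg (h.sign_pos x (hθN x h0).1.1).le
  · obtain ⟨x, hx⟩ := hMne
    refine ⟨x, ?_⟩
    rw [hdρ]
    change 0 < ψ (g x) * σ x * fderiv ℝ g x (Z x)
    rw [(h.mem_iff x).1 hx, hψ1, one_mul]
    exact h.sign_pos x (h.subset hx)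
  · rw [hdρ] at hx
    obtain ⟨h1, h2⟩ := hθN x (hζ0 x hx)
    exact ⟨h1.1, h2⟩

end IsContactData

theorem eq_of_forall_omegaSt_eq {v v' : R4} (h : ∀ w, omegaSt w v = omegaSt w v') : v = v' := by
  have h1 : omegaSt (J4 (v - v')) (v - v') = 0 := by rw [omegaSt_sub_right, h, sub_self]
  rw [← inner_J4_left, J4_J4, inner_neg_left, real_inner_self_eq_norm_sq, neg_eq_zero,
    sq_eq_zero_iff, norm_eq_zero, sub_eq_zero] at h1
  exact h1

/-- The multiple by `κ` of the Hamiltonian vector field of `g`. -/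
def reebField (g κ : R4 → ℝ) (x : R4) : R4 := -(κ x • hamField g x)

theorem omegaSt_reebField (g κ : R4 → ℝ) (x w : R4) :
    omegaSt w (reebField g κ x) = κ x * fderiv ℝ g x w := by
  rw [omegaSt_swap, reebField, ← neg_smul, omegaSt_smul_left,
    omegaSt_hamField]
  ring

theorem fderiv_reebField (g κ : R4 → ℝ) (x : R4) : fderiv ℝ g x (reebField g κ x) = 0 := by
  have h1 : omegaSt (hamField g x) (hamField g x) = 0 := by simp only [omegaSt]; ring
  rw [omegaSt_hamField] at h1
  rw [reebField, map_neg, map_smul, h1, smul_zero, neg_zero]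

namespace IsContactData

variable {g : R4 → ℝ} {M W : Set R4} {Z : R4 → R4} {σ κ : R4 → ℝ}

theorem contDiff_reebField (h : IsContactData g M W Z σ κ) : ContDiff ℝ ∞ (reebField g κ) :=
  (h.contDiff_factor.smul (contDiff_hamField h.contDiff_fun)).neg

theorem hasCompactSupport_reebField (h : IsContactData g M W Z σ κ) :
    HasCompactSupport (reebField g κ) :=
  h.hasCompactSupport_factor.mono fun x hx h0 => hx (by simp [reebField, h0])

theorem exists_closed_orbit (h : IsContactData g M W Z σ κ) (hMne : M.Nonempty) {r τ ε : ℝ}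
    (hr0 : 0 ≤ r) (hr : ∀ x ∈ M, x 0 ^ 2 + x 1 ^ 2 < r ^ 2) (hτ : π * r ^ 2 < τ) (hε : 0 < ε)
    {φ : R4 → ℝ → R4} {K : NNReal} (hφ : IsGlobalFlow (reebField g κ) φ)
    (hK : LipschitzWith K (reebField g κ)) :
    ∃ p T, p ∈ tsupport σ ∧ |g p| < ε ∧ 0 < T ∧ T ≤ τ ∧ φ p T = p := by
  obtain ⟨R, ρ, hρ, hρsupp, hρg⟩ := h.exists_isShellPotential hMne hr hε
  obtain ⟨r', hτ', hrr'⟩ : ∃ r', π * r' ^ 2 < τ ∧ r < r' := by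
    have h1 : ∀ᶠ s in 𝓝[>] r, π * s ^ 2 < τ :=
      ((by fun_prop : Continuous fun s : ℝ => π * s ^ 2).continuousAt.eventually_lt
        continuousAt_const hτ).filter_mono nhdsWithin_le_nhds
    exact (h1.and self_mem_nhdsWithin).exists
  obtain ⟨a, ⟨hτa, ha1⟩, ha0⟩ : ∃ a : ℝ, (π * r' ^ 2 < τ * (1 - a) ∧ a < 1) ∧ 0 < a := by
    have h1 : ∀ᶠ s in 𝓝[>] (0:ℝ), π * r' ^ 2 < τ * (1 - s) :=
      (continuousAt_const.eventually_lt
        (by fun_prop : Continuous fun s : ℝ => τ * (1 - s)).continuousAt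
        (by simpa using hτ')).filter_mono nhdsWithin_le_nhds
    have h2 : ∀ᶠ s in 𝓝[>] (0:ℝ), s < 1 :=
      (eventually_lt_nhds one_pos).filter_mono nhdsWithin_le_nhds
    exact ((h1.and h2).and self_mem_nhdsWithin).exists
  obtain ⟨q, hq⟩ := hρ.exists_neg
  obtain ⟨ν, hν, hνq⟩ : ∃ ν, 0 < ν ∧ Real.exp (ν * ρ q) < a := by
    have hla := log_neg ha0 ha1
    refine ⟨(log a - 1) / ρ q, div_pos_of_neg_of_neg (by linarith) hq, ?_⟩
    rw [div_mul_cancel₀ _ hq.ne]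
    calc Real.exp (log a - 1) < Real.exp (log a) := exp_lt_exp.2 (by linarith)
      _ = a := exp_log ha0
  obtain ⟨Θ, hΘ⟩ := hρ.exists_isStretching hν.le hr0 hrr'
  obtain ⟨k, hk0, hkτ, y, hy, hy01, hyd, t₀, ht₀, hne⟩ :=
    hΘ.exists_periodic_orbit (p := q) hνq ha1 hτa
  set G : R4 → ℝ := fun x => Real.exp (ν * ρ x) with hG
  have hG0 : ∀ x, 0 < G x := fun x => exp_pos _
  have hGd : ∀ x, fderiv ℝ G x = (G x * ν) • fderiv ℝ ρ x := by
    intro x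
    have e1 : HasFDerivAt G _ x :=
      ((hρ.contDiff_fun.differentiable (by simp) x).hasFDerivAt.const_mul ν).exp
    rw [e1.fderiv, smul_smul]
  have hGZ : ∀ x, 0 ≤ fderiv ℝ G x (Z x) := by
    intro x
    rw [hGd]
    exact mul_nonneg (mul_nonneg (hG0 x).le hν.le) (hρ.nonneg x)
  have hD : ∀ x, 0 < G x + fderiv ℝ G x (Z x) := fun x => add_pos_of_pos_of_nonneg (hG0 x) (hGZ x)
  set m : ℝ → ℝ := fun t => k * fderiv ℝ G (y t) (Z (y t)) / (G (y t) + fderiv ℝ G (y t) (Z (y t)))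
    with hm
  have hm0 : ∀ t, 0 ≤ m t := fun t => div_nonneg (mul_nonneg hk0.le (hGZ _)) (hD _).le
  have hmk : ∀ t, m t ≤ k := fun t => by
    rw [hm, div_le_iff₀ (hD _)]
    nlinarith [hG0 (y t)]
  have hdGZ : Continuous fun x => fderiv ℝ G x (Z x) :=
    (hΘ.contDiff_fun.continuous_fderiv (by simp)).clm_apply h.contDiff_field.continuous
  have hmc : Continuous m := (continuous_const.mul (hdGZ.comp hy)).div
    ((hΘ.contDiff_fun.continuous.comp hy).add (hdGZ.comp hy)) fun t => (hD _).ne'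
  have hsmul : ∀ t ∈ Icc (0:ℝ) 1, HasDerivAt y (m t • reebField g κ (y t)) t := by
    intro t ht
    obtain ⟨v, hv, heq⟩ := hyd t ht
    refine hv.congr_deriv (eq_of_forall_omegaSt_eq fun w => ?_)
    rw [omegaSt_smul_right, omegaSt_reebField]
    have hself : ∀ u, omegaSt u u = 0 := fun u => by simp only [omegaSt]; ring
    have h1 : fderiv ℝ G (y t) v = 0 := by
      have := heq v
      rw [hself, mul_zero, zero_add, mul_comm, sub_self] at this
      exact (mul_eq_zero.1 this.symm).resolve_left hk0.ne'
    have h2 := heq (Z (y t))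
    have h3 := heq w
    rw [h1] at h2 h3
    have h4 := hD (y t)
    have h5 := hG0 (y t)
    by_cases h0 : fderiv ℝ ρ (y t) = 0
    · have h6 : fderiv ℝ G (y t) = 0 := by rw [hGd, h0, smul_zero]
      have h7 : m t = 0 := by simp [hm, h6]
      rw [h6] at h3
      rw [h7]
      simpa [h5.ne'] using h3
    · obtain ⟨c, hc⟩ := hρg (y t)
      have h6 := h.factor _ (hρsupp _ h0).1
      have h7 : ∀ u, fderiv ℝ G (y t) u = G (y t) * ν * c * fderiv ℝ g (y t) u := by
        intro u
        rw [hGd, hc]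
        simp [mul_assoc]
      have h8 : omegaSt (Z (y t)) v = m t := by
        rw [hm, eq_div_iff h4.ne']
        linarith
      rw [h8] at h3
      have h9 : G (y t) * omegaSt w v = (k - m t) * fderiv ℝ G (y t) w := by linarith
      have h10 : (k - m t) * (G (y t) + fderiv ℝ G (y t) (Z (y t))) = k * G (y t) := by
        rw [sub_mul, hm, div_mul_cancel₀ _ h4.ne']; ring
      have h11 : m t * (G (y t) + fderiv ℝ G (y t) (Z (y t))) =
          k * fderiv ℝ G (y t) (Z (y t)) := by
        rw [hm, div_mul_cancel₀ _ h4.ne']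
      refine mul_left_cancel₀ (mul_pos h5 h4).ne' ?_
      calc G (y t) * (G (y t) + fderiv ℝ G (y t) (Z (y t))) * omegaSt w v
          = (G (y t) * omegaSt w v) * (G (y t) + fderiv ℝ G (y t) (Z (y t))) := by ring
        _ = ((k - m t) * (G (y t) + fderiv ℝ G (y t) (Z (y t)))) * fderiv ℝ G (y t) w := by
            rw [h9]; ring
        _ = G (y t) * (k * (G (y t) * ν * c * fderiv ℝ g (y t) w)) * 1 := by
            rw [h10, h7]; ring
        _ = G (y t) * (k * fderiv ℝ G (y t) (Z (y t))) * (κ (y t) * fderiv ℝ g (y t) w) := by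
            rw [← h6, h7]; ring
        _ = _ := by rw [← h11]; ring
  have hflow : ∀ t ∈ Icc (0:ℝ) 1, y t = φ (y 0) (∫ u in (0:ℝ)..t, m u) := fun t ht =>
    hφ.eq_of_hasDerivAt_smul hK hmc (κ := k)
      (fun t _ => by rw [abs_of_nonneg (hm0 t)]; exact hmk t) hsmul ht
  have hρ0 : fderiv ℝ ρ (y t₀) ≠ 0 := fun h0 => hne (by rw [hGd, h0, smul_zero])
  have hm_pos : 0 < m t₀ := by
    refine div_pos (mul_pos hk0 (lt_of_le_of_ne (hGZ _) fun h0 => ?_)) (hD _)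
    obtain ⟨c, hc⟩ := hρg (y t₀)
    have h6 := h.factor _ (hρsupp _ hρ0).1
    rw [hGd, hc] at h0
    have hc0 : c ≠ 0 := fun hc0 => hρ0 (by rw [hc, hc0, zero_smul])
    have hg0 : fderiv ℝ g (y t₀) (Z (y t₀)) ≠ 0 := right_ne_zero_of_mul (h6 ▸ one_ne_zero)
    exact mul_ne_zero (mul_ne_zero (hG0 _).ne' hν.ne') (mul_ne_zero hc0 hg0) h0.symm
  refine ⟨y t₀, ∫ u in (0:ℝ)..1, m u, (hρsupp _ hρ0).2.1, (hρsupp _ hρ0).2.2, ?_, ?_, ?_⟩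
  · exact intervalIntegral.integral_pos one_pos hmc.continuousOn (fun t _ => hm0 t)
      ⟨t₀, ht₀, hm_pos⟩
  · refine le_trans ?_ hkτ
    have := intervalIntegral.integral_mono_on (f := m) (g := fun _ => k) (a := 0) (b := 1)
      (μ := volume) zero_le_one (hmc.intervalIntegrable _ _) (by simp) fun t _ => hmk t
    simpa using this
  · rw [hflow t₀ ht₀, ← hφ.flow_add hK, add_comm, hφ.flow_add hK,
      ← hflow 1 ⟨zero_le_one, le_rfl⟩, ← hy01]

end IsContactData

section Circumradius

variable {V : Type*} [NormedAddCommGroup V] [InnerProductSpace ℝ V] {ι : Type*} [Fintype ι]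

theorem sum_mul_norm_sq_sub_norm_sq (p : ι → V) {w : ι → ℝ} (hw : ∑ i, w i = 1) :
    ∑ i, w i * ‖p i‖ ^ 2 - ‖∑ i, w i • p i‖ ^ 2 = (∑ i, ∑ j, w i * w j * ‖p i - p j‖ ^ 2) / 2 := by
  have h1 : ∀ i j, w i * w j * ‖p i - p j‖ ^ 2 =
      w j * (w i * ‖p i‖ ^ 2) + w i * (w j * ‖p j‖ ^ 2) - 2 * (w i * (w j * inner ℝ (p i) (p j))) := by
    intro i j
    rw [norm_sub_sq_real]; ring
  have h2 : ‖∑ i, w i • p i‖ ^ 2 = ∑ i, ∑ j, w i * (w j * inner ℝ (p i) (p j)) := by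
    rw [← real_inner_self_eq_norm_sq, sum_inner]
    refine Finset.sum_congr rfl fun i _ => ?_
    rw [inner_sum]
    refine Finset.sum_congr rfl fun j _ => ?_
    rw [real_inner_smul_left, real_inner_smul_right]
  simp only [h1, Finset.sum_sub_distrib, Finset.sum_add_distrib, ← Finset.sum_mul, hw,
    ← Finset.mul_sum, h2]
  ring

/-- Jung's theorem for finitely many points. -/
theorem exists_norm_sub_sq_le [Nonempty ι] (p : ι → V) {d : ℝ} (hd : ∀ i j, ‖p i - p j‖ ≤ d) :
    ∃ c, ∀ i, ‖p i - c‖ ^ 2 ≤ (1 - 1 / Fintype.card ι) / 2 * d ^ 2 := by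
  classical
  set f : (ι → ℝ) → ℝ := fun w => ∑ i, w i * ‖p i‖ ^ 2 - ‖∑ i, w i • p i‖ ^ 2 with hf
  have hfc : Continuous f := by fun_prop
  obtain ⟨w, hw, hmax⟩ := (isCompact_stdSimplex ℝ ι).exists_isMaxOn
    ⟨_, single_mem_stdSimplex ℝ (Classical.arbitrary ι)⟩ hfc.continuousOn
  have hf2 := sum_mul_norm_sq_sub_norm_sq p hw.2
  have hf0 : 0 ≤ f w := by
    simp only [hf, hf2]
    exact div_nonneg (Finset.sum_nonneg fun i _ => Finset.sum_nonneg fun j _ =>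
      mul_nonneg (mul_nonneg (hw.1 i) (hw.1 j)) (sq_nonneg _)) zero_le_two
  have hn : (0:ℝ) < Fintype.card ι := by exact_mod_cast Fintype.card_pos
  have hfd : f w ≤ (1 - 1 / Fintype.card ι) / 2 * d ^ 2 := by
    have h1 : ∀ i j, w i * w j * ‖p i - p j‖ ^ 2 ≤
        d ^ 2 * (w i * w j - if i = j then w i ^ 2 else 0) := by
      intro i j
      split_ifs with hij
      · subst hij; simp; nlinarith
      · rw [sub_zero, mul_comm]
        exact mul_le_mul_of_nonneg_right (pow_le_pow_left₀ (norm_nonneg _) (hd i j) 2)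
          (mul_nonneg (hw.1 i) (hw.1 j))
    have h2 : ∑ i, ∑ j, w i * w j * ‖p i - p j‖ ^ 2 ≤ d ^ 2 * (1 - ∑ i, w i ^ 2) := by
      refine (Finset.sum_le_sum fun i _ => Finset.sum_le_sum fun j _ => h1 i j).trans_eq ?_
      simp [← Finset.mul_sum, Finset.sum_sub_distrib, hw.2]
    have h3 : 1 / (Fintype.card ι : ℝ) ≤ ∑ i, w i ^ 2 := by
      rw [div_le_iff₀ hn]
      have := sq_sum_le_card_mul_sum_sq (s := Finset.univ) (f := w)
      rw [hw.2] at this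
      simpa [mul_comm] using this
    simp only [hf, hf2]
    nlinarith [sq_nonneg d]
  refine ⟨∑ i, w i • p i, fun i => le_trans ?_ hfd⟩
  set c := ∑ i, w i • p i with hc
  set D := ‖p i - c‖ ^ 2 with hD
  have hmix : ∀ t ∈ Ioo (0:ℝ) 1, (1 - t) * D ≤ f w := by
    intro t ht
    have h1 : (1 - t) • w + t • (Pi.single i 1 : ι → ℝ) ∈ stdSimplex ℝ ι :=
      convex_stdSimplex ℝ ι hw (single_mem_stdSimplex ℝ i) (by linarith [ht.2]) ht.1.le (by ring)
    have h2 : f ((1 - t) • w + t • (Pi.single i 1 : ι → ℝ)) ≤ f w := hmax h1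
    have h3 : f ((1 - t) • w + t • (Pi.single i 1 : ι → ℝ)) = (1 - t) * f w + t * ((1 - t) * D) := by
      have e1 : ∑ j, ((1 - t) • w + t • (Pi.single i 1 : ι → ℝ)) j * ‖p j‖ ^ 2 =
          (1 - t) * ∑ j, w j * ‖p j‖ ^ 2 + t * ‖p i‖ ^ 2 := by
        simp [add_mul, Finset.sum_add_distrib, Finset.mul_sum, mul_assoc, Pi.single_apply]
      have e2 : ∑ j, ((1 - t) • w + t • (Pi.single i 1 : ι → ℝ)) j • p j = (1 - t) • c + t • p i := by
        simp [add_smul, Finset.sum_add_distrib, Finset.smul_sum, mul_smul, Pi.single_apply, hc]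
      simp only [hf]
      rw [e1, e2, ← hc, hD, norm_add_sq_real, norm_sub_sq_real, norm_smul, norm_smul,
        real_inner_smul_left, real_inner_smul_right, real_inner_comm, mul_pow, mul_pow,
        norm_eq_abs, norm_eq_abs, sq_abs, sq_abs]
      ring
    rw [h3] at h2
    nlinarith [ht.1]
  by_contra! hlt
  have hD0 : 0 < D := hf0.trans_lt hlt
  have h4 := hmix ((D - f w) / (2 * D)) ⟨by apply div_pos <;> linarith, by
    rw [div_lt_one (by linarith)]; linarith⟩
  have h5 : (1 - (D - f w) / (2 * D)) * D = (D + f w) / 2 := by field_simp; ring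
  linarith

end Circumradius

/-- Jung's theorem in the plane. -/
theorem exists_closedBall_of_planar (S : Set (EuclideanSpace ℝ (Fin 2))) {d : ℝ}
    (hd : ∀ x ∈ S, ∀ y ∈ S, ‖x - y‖ ≤ d) :
    ∃ c, ∀ x ∈ S, ‖x - c‖ ^ 2 ≤ d ^ 2 / 3 := by
  have h := Convex.helly_theorem_compact' (𝕜 := ℝ)
    (F := fun x : S => closedBall (x : EuclideanSpace ℝ (Fin 2)) √(d ^ 2 / 3))
    (fun x => convex_closedBall _ _) (fun x => isCompact_closedBall _ _) fun I hI => ?_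
  · obtain ⟨c, hc⟩ := h
    refine ⟨c, fun x hx => ?_⟩
    have h1 := mem_iInter.1 hc ⟨x, hx⟩
    rw [mem_closedBall, dist_comm, dist_eq_norm] at h1
    exact (pow_le_pow_left₀ (norm_nonneg _) h1 2).trans_eq (Real.sq_sqrt (by positivity))
  · rcases I.eq_empty_or_nonempty with rfl | hne
    · simp
    · have : Nonempty I := hne.to_subtype
      obtain ⟨c, hc⟩ := exists_norm_sub_sq_le (ι := I) (fun x => (x.1 : EuclideanSpace ℝ (Fin 2)))
        (d := d) fun i j => hd _ i.1.2 _ j.1.2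
      refine ⟨c, mem_iInter₂.2 fun x hx => ?_⟩
      rw [mem_closedBall, dist_comm, dist_eq_norm]
      refine Real.le_sqrt_of_sq_le ((hc ⟨x, hx⟩).trans ?_)
      have h3 : (Fintype.card I : ℝ) ≤ 3 := by
        rw [finrank_euclideanSpace_fin] at hI
        rw [Fintype.card_coe]
        exact_mod_cast hI
      have h0 : (0:ℝ) < Fintype.card I := by exact_mod_cast Fintype.card_pos
      have h4 : 1 / (3:ℝ) ≤ 1 / Fintype.card I := one_div_le_one_div_of_le h0 h3
      nlinarith [sq_nonneg d]

/-- A hypersurface of contact type in the cylinder of radius `r` has closed Reeb orbits of every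
period bound larger than `π r²`. -/
theorem exists_closed_reeb_orbit {g : R4 → ℝ} (hg : ContDiff ℝ ∞ g)
    {M : Set R4} (hM : M = g ⁻¹' {0}) (hMne : M.Nonempty) (hMcpt : IsCompact M)
    {U : Set R4} (hU : IsOpen U) (hMU : M ⊆ U) {Y : R4 → R4} (hY : ContDiffOn ℝ ∞ Y U)
    (hLiou : ∀ x ∈ U, ∀ u v : R4,
      omegaSt (fderiv ℝ Y x u) v + omegaSt u (fderiv ℝ Y x v) = omegaSt u v)
    (htrans : ∀ x ∈ M, fderiv ℝ g x (Y x) ≠ 0) {r τ : ℝ} (hr0 : 0 ≤ r)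
    (hr : ∀ x ∈ M, x 0 ^ 2 + x 1 ^ 2 < r ^ 2) (hτ : π * r ^ 2 < τ) :
    ∃ (T : ℝ) (γ γ' : ℝ → R4), 0 < T ∧ T ≤ τ ∧ ContDiff ℝ ∞ γ ∧ (∀ t, HasDerivAt γ (γ' t) t) ∧
      (∀ t, γ t ∈ M) ∧ (∀ t, γ (t + T) = γ t) ∧ (∀ t, fderiv ℝ g (γ t) (γ' t) = 0) ∧
      (∀ t, ∀ v : R4, fderiv ℝ g (γ t) v = 0 → omegaSt (γ' t) v = 0) ∧
      ∀ t, omegaSt (Y (γ t)) (γ' t) = 1 := by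
  obtain ⟨W, Z, σ, κ, h, hZY⟩ := exists_isContactData hg hM hMcpt hU hMU hY hLiou htrans
  obtain ⟨φ, K, hφ, hK⟩ := exists_isGlobalFlow h.contDiff_reebField h.hasCompactSupport_reebField
  choose p T hp hgp hT0 hTτ hφT using fun n : ℕ =>
    h.exists_closed_orbit hMne hr0 hr hτ (Nat.one_div_pos_of_nat (n := n) (α := ℝ)) hφ hK
  obtain ⟨q, -, S, hS0, hSτ, hqS, k, hk, hlim⟩ := hφ.exists_closed_orbit_of_seq hK
    h.hasCompactSupport_sign hp (fun n => ⟨hT0 n, hTτ n⟩) hφT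
  have hq0 : g q = 0 := by
    have h1 : Tendsto (fun n => g (p (k n))) atTop (𝓝 (g q)) :=
      (hg.continuous.tendsto q).comp hlim
    have h2 : Tendsto (fun n => g (p (k n))) atTop (𝓝 0) :=
      squeeze_zero_norm (fun n => (hgp (k n)).le)
        ((tendsto_one_div_add_atTop_nhds_zero_nat (𝕜 := ℝ)).comp hk.tendsto_atTop)
    exact tendsto_nhds_unique h1 h2
  have hγ : ∀ t, φ q t ∈ M := by
    intro t
    rw [h.mem_iff]
    have hd : ∀ t, HasDerivAt (fun t => g (φ q t)) 0 t := fun t =>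
      ((hg.differentiable (by simp) (φ q t)).hasFDerivAt.comp_hasDerivAt t
        (hφ.hasDerivAt q t)).congr_deriv (fderiv_reebField g κ _)
    have := is_const_of_deriv_eq_zero (fun t => (hd t).differentiableAt) (fun t => (hd t).deriv) t 0
    rw [this, hφ.zero, hq0]
  refine ⟨S, φ q, fun t => reebField g κ (φ q t), hS0, hSτ, hφ.contDiff h.contDiff_reebField q,
    hφ.hasDerivAt q, hγ, fun t => by rw [hφ.flow_add hK, hqS], fun t => fderiv_reebField g κ _,
    fun t v hv => ?_, fun t => ?_⟩
  · rw [omegaSt_swap, omegaSt_reebField, hv, mul_zero, neg_zero]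
  · rw [omegaSt_reebField, ← hZY _ (hγ t), h.factor _ (h.subset (hγ t))]

theorem preimage_zero_ne_singleton {g : R4 → ℝ} (hg : ContDiff ℝ ∞ g) {p : R4}
    (hreg : fderiv ℝ g p ≠ 0) : g ⁻¹' {0} ≠ {p} := by
  intro hp
  have h0 : ∀ x, g x = 0 ↔ x = p := fun x => by
    rw [← mem_singleton_iff, ← mem_preimage, hp, mem_singleton_iff]
  have hc : IsPreconnected ({p}ᶜ : Set R4) :=
    (isConnected_compl_singleton_of_one_lt_rank (by
      rw [← Module.finrank_eq_rank, finrank_euclideanSpace_fin]; norm_num) p).isPreconnected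
  have hgp : g p = 0 := (h0 p).2 rfl
  have himg : IsPreconnected (g '' {p}ᶜ) := hc.image g hg.continuous.continuousOn
  have hn0 : (0:ℝ) ∉ g '' {p}ᶜ := by
    rintro ⟨x, hx, hx0⟩
    exact hx ((h0 x).1 hx0)
  have hsign : (∀ x, x ≠ p → 0 < g x) ∨ ∀ x, x ≠ p → g x < 0 := by
    by_contra! hcon
    obtain ⟨⟨x, hx, hx0⟩, y, hy, hy0⟩ := hcon
    exact hn0 (himg.ordConnected.out ⟨x, hx, rfl⟩ ⟨y, hy, rfl⟩ ⟨hx0, hy0⟩)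
  rcases hsign with hs | hs
  · have : IsLocalMin g p := Eventually.of_forall fun x => by
      rcases eq_or_ne x p with rfl | hx
      · exact le_rfl
      · rw [hgp]; exact (hs x hx).le
    exact hreg this.fderiv_eq_zero
  · have : IsLocalMax g p := Eventually.of_forall fun x => by
      rcases eq_or_ne x p with rfl | hx
      · exact le_rfl
      · rw [hgp]; exact (hs x hx).le
    exact hreg this.fderiv_eq_zero

theorem exists_cylinder {M : Set R4} (hMcpt : IsCompact M) :
    ∃ c : R4, ∀ x ∈ M, (x 0 - c 0) ^ 2 + (x 1 - c 1) ^ 2 ≤ diam M ^ 2 / 3 := by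
  set P : R4 → EuclideanSpace ℝ (Fin 2) := fun x => !₂[x 0, x 1] with hP
  have hPn : ∀ x y, ‖P x - P y‖ ^ 2 = (x 0 - y 0) ^ 2 + (x 1 - y 1) ^ 2 := fun x y => by
    rw [EuclideanSpace.norm_sq_eq]; simp [hP]
  obtain ⟨c, hc⟩ := exists_closedBall_of_planar (P '' M) (d := diam M) (by
    rintro _ ⟨x, hx, rfl⟩ _ ⟨y, hy, rfl⟩
    have h1 := dist_le_diam_of_mem hMcpt.isBounded hx hy
    rw [dist_eq_norm] at h1
    refine le_trans (le_of_sq_le_sq ?_ (norm_nonneg _)) h1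
    rw [hPn, norm_sq_R4]
    simp only [PiLp.sub_apply]
    nlinarith [sq_nonneg (x 2 - y 2), sq_nonneg (x 3 - y 3)])
  refine ⟨!₂[c 0, c 1, 0, 0], fun x hx => ?_⟩
  have h1 := hc _ ⟨x, hx, rfl⟩
  rw [EuclideanSpace.norm_sq_eq] at h1
  simpa [hP] using h1

/-- On a compact hypersurface M = g⁻¹(0) ⊂ ℝ⁴ of contact type, the induced
contact form α = (ι_Y ω_st)|TM has a closed Reeb orbit of period at most
(2/5)·π·(diam M)². -/
theorem contact_type_short_reeb_orbit
    (g : R4 → ℝ) (hg : ContDiff ℝ ∞ g)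
    (M : Set R4) (hM : M = g ⁻¹' {0})
    (hMne : M.Nonempty) (hMcpt : IsCompact M)
    (hreg : ∀ x ∈ M, fderiv ℝ g x ≠ 0)
    (U : Set R4) (hU : IsOpen U) (hMU : M ⊆ U)
    (Y : R4 → R4) (hY : ContDiffOn ℝ ∞ Y U)
    (hLiou : ∀ x ∈ U, ∀ u v : R4,
      omegaSt (fderiv ℝ Y x u) v + omegaSt u (fderiv ℝ Y x v) = omegaSt u v)
    (htrans : ∀ x ∈ M, fderiv ℝ g x (Y x) ≠ 0) :
    ∃ (T : ℝ) (γ : ℝ → R4), 0 < T ∧ T ≤ (2 / 5) * π * Metric.diam M ^ 2 ∧ ContDiff ℝ ∞ γ ∧ (∃ t s, γ t ≠ γ s) ∧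
      (∀ t, γ t ∈ M) ∧ (∀ t, γ (t + T) = γ t) ∧
      -- γ′(t) is tangent to M:
      (∀ t, fderiv ℝ g (γ t) (deriv γ t) = 0) ∧
      -- γ′(t) lies in the kernel of ω_st restricted to T_{γ(t)}M:
      (∀ t, ∀ v : R4, fderiv ℝ g (γ t) v = 0 → omegaSt (deriv γ t) v = 0) ∧
      -- normalisation α(γ′) = ω_st(Y, γ′) = 1:
      (∀ t, omegaSt (Y (γ t)) (deriv γ t) = 1) := by
  have hd : 0 < diam M := by
    refine lt_of_le_of_ne diam_nonneg fun h0 => ?_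
    obtain ⟨p, hp⟩ := hMne
    refine preimage_zero_ne_singleton hg (hreg p hp) ?_
    rw [← hM]
    refine Subset.antisymm (fun x hx => ?_) (singleton_subset_iff.2 hp)
    have := dist_le_diam_of_mem hMcpt.isBounded hx hp
    rw [← h0] at this
    exact dist_le_zero.1 this
  obtain ⟨c, hc⟩ := exists_cylinder hMcpt
  set e : R4 ≃ₜ R4 := Homeomorph.addRight c with he
  have hfd : ∀ x, fderiv ℝ (fun x => g (x + c)) x = fderiv ℝ g (x + c) := fun x =>
    fderiv_comp_add_right c
  have hfdY : ∀ x, fderiv ℝ (fun x => Y (x + c)) x = fderiv ℝ Y (x + c) := fun x =>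
    fderiv_comp_add_right c
  have hadd : ContDiff ℝ ∞ fun x : R4 => x + c := contDiff_id.add contDiff_const
  set r := √(7 / 20 * diam M ^ 2) with hr
  have hr2 : r ^ 2 = 7 / 20 * diam M ^ 2 := Real.sq_sqrt (by positivity)
  have hd2 : 0 < diam M ^ 2 := by positivity
  obtain ⟨T, γ, γ', hT0, hT, hγ, hγ', hγM, hγT, h1, h2, h3⟩ := exists_closed_reeb_orbit
    (g := fun x => g (x + c)) (M := e ⁻¹' M) (U := e ⁻¹' U) (Y := fun x => Y (x + c))
    (r := r) (τ := 2 / 5 * π * diam M ^ 2) (hg.comp hadd) (by rw [hM]; rfl)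
    (hMne.preimage e.surjective) (e.isCompact_preimage.2 hMcpt) (hU.preimage e.continuous)
    (preimage_mono hMU) (hY.comp hadd.contDiffOn fun x hx => hx)
    (fun x hx u v => by rw [hfdY]; exact hLiou _ hx u v)
    (fun x hx => by rw [hfd]; exact htrans _ hx) (Real.sqrt_nonneg _)
    (fun x hx => by
      have := hc _ hx
      simp [he] at this
      rw [hr2]
      linarith)
    (by rw [hr2]; nlinarith [mul_pos pi_pos hd2])
  simp only [hfd] at h1 h2
  have hd' : ∀ t, deriv (fun t => γ t + c) t = γ' t := fun t => ((hγ' t).add_const c).deriv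
  refine ⟨T, fun t => γ t + c, hT0, hT, hγ.add contDiff_const, ?_, hγM, fun t => by simp only [hγT],
    fun t => by rw [hd']; exact h1 t, fun t v hv => by rw [hd']; exact h2 t v hv,
    fun t => by rw [hd']; exact h3 t⟩
  by_contra! hcon
  have h4 : γ' 0 = 0 := by
    rw [← hd' 0, show (fun t => γ t + c) = fun _ => γ 0 + c from funext fun t => hcon t 0]
    simp
  have h5 := h3 0
  rw [h4] at h5
  simp [omegaSt] at h5
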